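/- Lemma 2.2: Fix dyadic lattices D_k on X_k, k = 1,…,n. For each k = 2,…,n choose S̃_k to be either the vectorized Lusin square function 𝐒_k^L or the vectorized dyadic square function 𝐒_{D_k} in the variable x_k (the choice may differ for different k), with target Hilbert space H̃_k, and set H̃¹ := H̃₂⊗…⊗H̃ₙ. Then there is a constant C, independent of f, such that ∫_X ‖(𝐒₁^L ⊗ S̃₂ ⊗ … ⊗ S̃ₙ f)(x)‖_{H₁⊗H̃¹} dx ≤ C ∫_X ‖(𝐒_{D₁} ⊗ S̃₂ ⊗ … ⊗ S̃ₙ f)(x)‖_{ℓ²⊗H̃¹} dx for every f ∈ L¹(X) for which the right-hand side is finite. -/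

import Mathlib

open MeasureTheory Filter Topology
open scoped ENNReal

noncomputable section

namespace Treil

/-- The cube of sidelength `2^k` of the dyadic lattice `t + 𝒟₀` that contains `x`. -/
def dcube {N : ℕ} (t : Fin N → ℝ) (k : ℤ) (x : Fin N → ℝ) : Set (Fin N → ℝ) :=
  {y | ∀ i, ⌊(y i - t i) / (2 : ℝ) ^ k⌋ = ⌊(x i - t i) / (2 : ℝ) ^ k⌋}

/-- The averaging operator `E_k` over the cubes of sidelength `2^k` of the (generalized)
dyadic lattice whose layer at scale `2^k` has offset `c k`. -/
def avg {N : ℕ} (c : ℤ → Fin N → ℝ) (k : ℤ) (f : (Fin N → ℝ) → ℝ) (x : Fin N → ℝ) : ℝ :=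
  (∫ y in dcube (c k) k x, f y) / ((2 : ℝ) ^ k) ^ (N : ℕ)

/-- The martingale difference `Δ_k = E_{k-1} - E_k`. -/
def mdiff {N : ℕ} (c : ℤ → Fin N → ℝ) (k : ℤ) (f : (Fin N → ℝ) → ℝ) (x : Fin N → ℝ) : ℝ :=
  avg c (k - 1) f x - avg c k f x

/-- The square of the dyadic square function, `|S_𝒟 f (x)|² = ∑_k |Δ_k f (x)|²`,
with values in `[0,∞]`. -/
def Ssq {N : ℕ} (c : ℤ → Fin N → ℝ) (f : (Fin N → ℝ) → ℝ) (x : Fin N → ℝ) : ℝ≥0∞ :=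
  ∑' k : ℤ, ENNReal.ofReal ((mdiff c k f x) ^ 2)

/-- The offset (at scale `2^k`) of the random dyadic lattice on `ℝ` built from the uniform
shift `u ∈ [0,1)` and the fair signs `ξ_j`, `j ≥ 1`, encoded as the binary digits of
`v ∈ [0,1)` (`ξ_j = -1` iff `⌊v 2^j⌋` is odd); the interval `I_0 = [u-1, u)` belongs to the
lattice, and `I_k` is obtained from `I_{k-1}` by adjoining the right neighbour if `ξ_k = +1`
and the left neighbour if `ξ_k = -1`. -/
def randOffset1 (u v : ℝ) (k : ℤ) : ℝ :=
  u - 1 - ∑ j ∈ Finset.range k.toNat, (if ⌊v * 2 ^ (j + 1)⌋ % 2 = 1 then (2 : ℝ) ^ j else 0)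

/-- The sample space for the random dyadic lattice in `ℝ^N`: each of the `N` independent
coordinate lattices is driven by a pair (uniform shift, digit-encoded fair signs). -/
abbrev RSpace (N : ℕ) := Fin N → ℝ × ℝ

/-- The probability measure of the random dyadic lattice in `ℝ^N`. -/
def randMeasure (N : ℕ) : Measure (RSpace N) :=
  Measure.pi fun _ =>
    (volume.restrict (Set.Ico (0 : ℝ) 1)).prod (volume.restrict (Set.Ico (0 : ℝ) 1))

/-- The per-scale offsets of the random dyadic lattice `𝒟(ω)` in `ℝ^N`. -/
def randOffset {N : ℕ} (ω : RSpace N) (k : ℤ) : Fin N → ℝ :=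
  fun i => randOffset1 (ω i).1 (ω i).2 k

/-- An (axis-parallel, half-open) cube in `ℝ^N`. -/
def IsPCube {N : ℕ} (Q : Set (Fin N → ℝ)) : Prop :=
  ∃ (a : Fin N → ℝ) (l : ℝ), 0 < l ∧ Q = Set.univ.pi fun i => Set.Ico (a i) (a i + l)

/-- An `H¹`-atom: supported in a cube `Q`, bounded by `|Q|⁻¹`, with zero mean. -/
def IsAtom {N : ℕ} (a : (Fin N → ℝ) → ℝ) : Prop :=
  ∃ Q : Set (Fin N → ℝ), IsPCube Q ∧ (∀ x, x ∉ Q → a x = 0) ∧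
    (∀ x, |a x| ≤ ((volume Q).toReal)⁻¹) ∧ (∫ x, a x) = 0

/-- The atomic `H¹(ℝ^N)` norm: the infimum of `∑ |λ_j|` over all decompositions
`f = ∑ λ_j a_j` converging in `L¹`, with atoms `a_j`. -/
def H1norm {N : ℕ} (f : (Fin N → ℝ) → ℝ) : ℝ≥0∞ :=
  ⨅ (lam : ℕ → ℝ) (a : ℕ → (Fin N → ℝ) → ℝ) (_ : ∀ j, IsAtom (a j))
    (_ : Tendsto (fun m => ∫ x, |f x - ∑ j ∈ Finset.range m, lam j * a j x|) atTop (𝓝 0)),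
    ∑' j, ENNReal.ofReal |lam j|
/-! ### Multi-parameter setting: `X = X₁ × ⋯ × Xₙ`, `X_j = ℝ^{N_j}` -/

variable (n : ℕ) (Nd : Fin n → ℕ)

/-- The product space `X = X₁ × X₂ × ⋯ × Xₙ`, `X_j = ℝ^{N_j}`. -/
abbrev X := Π j : Fin n, (Fin (Nd j) → ℝ)

/-- The averaging operator `E_𝐤 = E¹_{k₁} ⋯ Eⁿ_{kₙ}` over the "rectangles"
`R = Q₁ × ⋯ × Qₙ` of the product lattice with per-variable, per-scale offsets `c`. -/
def ravg (c : Π j : Fin n, ℤ → Fin (Nd j) → ℝ) (k : Fin n → ℤ) (f : X n Nd → ℝ)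
    (x : X n Nd) : ℝ :=
  (∫ y in Set.univ.pi fun j => dcube (c j (k j)) (k j) (x j), f y) /
    ∏ j, ((2 : ℝ) ^ (k j)) ^ (Nd j : ℕ)

/-- The multi-parameter martingale difference
`Δ_𝐤 = Δ¹_{k₁} ⋯ Δⁿ_{kₙ} = ∏_j (E^j_{k_j - 1} - E^j_{k_j})`, expanded by multilinearity. -/
def rmdiff (c : Π j : Fin n, ℤ → Fin (Nd j) → ℝ) (k : Fin n → ℤ) (f : X n Nd → ℝ)
    (x : X n Nd) : ℝ :=
  ∑ ε : Fin n → Bool,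
    (-1 : ℝ) ^ (Finset.univ.filter fun j => ε j = false).card *
      ravg n Nd c (fun j => k j - if ε j then 1 else 0) f x

/-- The square of the multi-parameter dyadic square function,
`|S_𝒟 f (x)|² = ∑_{R ∋ x} |Δ_R f (x)|² = ∑_{𝐤 ∈ ℤⁿ} |Δ_𝐤 f (x)|²`. -/
def rSsq (c : Π j : Fin n, ℤ → Fin (Nd j) → ℝ) (f : X n Nd → ℝ) (x : X n Nd) : ℝ≥0∞ :=
  ∑' k : Fin n → ℤ, ENNReal.ofReal ((rmdiff n Nd c k f x) ^ 2)

/-- The sample space of the random product dyadic lattice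
`𝒟(ω) = 𝒟₁(ω) × ⋯ × 𝒟ₙ(ω)`. -/
abbrev PSpace := Π j : Fin n, RSpace (Nd j)

instance randMeasure.instSigmaFinite (M : ℕ) : SigmaFinite (randMeasure M) := by
  unfold randMeasure; infer_instance

/-- The probability measure of the random product dyadic lattice (the `n` factors are
independent). -/
def prodRandMeasure : Measure (PSpace n Nd) := Measure.pi fun j => randMeasure (Nd j)

/-- The quantity `∫_X [𝔼_ω |S_{𝒟(ω)} f (x)|²]^{1/2} dx` for the multi-parameter random
dyadic square function. -/
def randProdSNorm (f : X n Nd → ℝ) : ℝ≥0∞ :=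
  ∫⁻ x, (∫⁻ ω, rSsq n Nd (fun j => randOffset (ω j)) f x ∂prodRandMeasure n Nd) ^ (1 / 2 : ℝ)

/-! ### The product (Chang–Fefferman) Hardy space `H¹(X₁ × ⋯ × Xₙ)` -/

/-- The upper half-space variables `((y₁,t₁),…,(yₙ,tₙ))`. -/
abbrev W := Π j : Fin n, ((Fin (Nd j) → ℝ) × ℝ)

/-- The Poisson kernel of the upper half-space `ℝ^{M+1}_+`. -/
def pk (M : ℕ) (y : Fin M → ℝ) (t : ℝ) : ℝ :=
  (Real.Gamma (((M : ℝ) + 1) / 2) / Real.pi ^ (((M : ℝ) + 1) / 2)) * t /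
    ((∑ i, y i ^ 2) + t ^ 2) ^ (((M : ℝ) + 1) / 2)

/-- The extension of `f` to `ℝ^{N₁+1}_+ × ⋯ × ℝ^{Nₙ+1}_+` obtained by applying the Poisson
(harmonic) extension in each variable. -/
def prodPoisson (f : X n Nd → ℝ) (p : W n Nd) : ℝ :=
  ∫ z, f z * ∏ j, pk (Nd j) ((p j).1 - z j) (p j).2

/-- The coordinate direction `i` in the `j`-th half-space factor (`i = N_j` is the
`t_j`-direction). -/
def dirW (j : Fin n) (i : Fin (Nd j + 1)) : W n Nd :=
  Pi.single j (if h : (i : ℕ) < Nd j then (Pi.single (⟨i, h⟩ : Fin (Nd j)) 1, 0) else (0, 1))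

/-- `|∇₁ ∇₂ ⋯ ∇ₙ u (p)|²`: the sum over all choices of one coordinate direction in each
half-space factor of the square of the corresponding mixed partial derivative. -/
def mixedGradSq (u : W n Nd → ℝ) (p : W n Nd) : ℝ :=
  ∑ d : Π j : Fin n, Fin (Nd j + 1),
    (iteratedFDeriv ℝ n u p fun j => dirW n Nd j (d j)) ^ 2

/-- The product cone `Γ_{x₁} × ⋯ × Γ_{xₙ}`, `Γ_{x_j} = {(y,t) : |y - x_j| < t}`. -/
def prodCone (x : X n Nd) : Set (W n Nd) :=
  {p | ∀ j, Real.sqrt (∑ i, ((p j).1 i - x j i) ^ 2) < (p j).2}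

/-- The square of the product Lusin square function `S⃗^L f`. -/
def lusinSq (f : X n Nd → ℝ) (x : X n Nd) : ℝ≥0∞ :=
  ∫⁻ p in prodCone n Nd x,
    ENNReal.ofReal (mixedGradSq n Nd (prodPoisson n Nd f) p *
      ∏ j, (p j).2 ^ (1 - (Nd j : ℝ)))

/-- The norm of the multi-parameter (product) Hardy space `H¹(X₁ × ⋯ × Xₙ)` of
Chang–Fefferman: `‖f‖ = ‖S⃗^L f‖_{L¹(X)}`. -/
def H1prodNorm (f : X n Nd → ℝ) : ℝ≥0∞ :=
  ∫⁻ x, (lusinSq n Nd f x) ^ (1 / 2 : ℝ)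
/-! ### Vectorized tensor-product square functions (fixed dyadic lattices)

For each variable `x_j` we consider the vectorized square functions: the dyadic one
`𝐒_{𝒟_j} f (x) = (m ↦ Δ_m^{𝒟_j} f(x)) ∈ ℓ²(ℤ)` for a fixed dyadic lattice `𝒟_j = t_j + 𝒟₀`
on `X_j`, and the Lusin one `𝐒_j^L f (x) = ((y,t) ↦ t^{(1-N_j)/2} ∇u(x_j + y, t))`, indexed
by the cone `Γ_j = {|y| < t}` and the gradient coordinate. A tensor product of such square
functions, taken in distinct variables, is obtained by applying the indexed scalar
components successively in the respective variables; the norm of the resulting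
Hilbert-space (`L²` over the product of the index spaces) valued function is computed by
integrating the square of the composed scalar component over all the indices.

An index for the `j`-th variable: either a dyadic index `m ∈ ℤ` or a Lusin index
`((y, t), d)` with `(y,t)` in the half-space and `d` a gradient coordinate (`d = N_j` being
the `t`-direction). -/
abbrev Idx (M : ℕ) := ℤ ⊕ (((Fin M → ℝ) × ℝ) × Fin (M + 1))

/-- The scalar component, with index `ι`, of the vectorized square function in the `j`-th
variable (for the fixed product dyadic lattice determined by the translations `t`), applied
(in the variable `x_j` only) to `f : X → ℝ`: for a dyadic index `m` it is the martingale
difference `Δ_m^{𝒟_j}`, and for a Lusin index `((y,s), d)` it is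
`s^{(1-N_j)/2} ∂_d P_j f (x_j + y, s)`, where `P_j` is the Poisson extension in the `j`-th
variable. -/
def opComp (n : ℕ) (Nd : Fin n → ℕ) (t : Π j : Fin n, Fin (Nd j) → ℝ) (j : Fin n)
    (ι : Idx (Nd j)) (f : X n Nd → ℝ) (x : X n Nd) : ℝ :=
  match ι with
  | Sum.inl m =>
      mdiff (fun _ => t j) m (fun z => f (Function.update x j z)) (x j)
  | Sum.inr (q, d) =>
      q.2 ^ ((1 - (Nd j : ℝ)) / 2) *
        fderiv ℝ (fun w : (Fin (Nd j) → ℝ) × ℝ =>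
            ∫ z : Fin (Nd j) → ℝ, f (Function.update x j z) * pk (Nd j) (w.1 - z) w.2)
          (x j + q.1, q.2)
          (if h : (d : ℕ) < Nd j then (Pi.single (⟨d, h⟩ : Fin (Nd j)) 1, 0) else (0, 1))

/-- The measure on the dyadic index summand: counting measure on the scales (so that the
target is `ℓ²(ℤ)`). -/
def dyadIdxMeas (M : ℕ) : Measure (Idx M) :=
  (Measure.count : Measure ℤ).map Sum.inl

/-- The cone `Γ = {(y,t) : |y| < t}`. -/
def coneSet (M : ℕ) : Set ((Fin M → ℝ) × ℝ) :=
  {q | Real.sqrt (∑ i, q.1 i ^ 2) < q.2}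

/-- The measure on the Lusin index summand: Lebesgue measure on the cone `Γ` times counting
measure on the gradient coordinates. -/
def lusinIdxMeas (M : ℕ) : Measure (Idx M) :=
  ((volume.restrict (coneSet M)).prod (Measure.count : Measure (Fin (M + 1)))).map Sum.inr

/-- The index measure for the `j`-th variable: concentrated on the summand corresponding to
the chosen square function (`true` = Lusin `𝐒^L`, `false` = dyadic `𝐒_{𝒟_j}`). -/
def idxMeas (M : ℕ) (lusin : Bool) : Measure (Idx M) :=
  if lusin then lusinIdxMeas M else dyadIdxMeas M

/-- The composition of the indexed scalar components over all the variables. -/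
def compAll (n : ℕ) (Nd : Fin n → ℕ) (t : Π j : Fin n, Fin (Nd j) → ℝ)
    (ι : Π j, Idx (Nd j)) (f : X n Nd → ℝ) : X n Nd → ℝ :=
  (List.finRange n).foldr (fun j g => opComp n Nd t j (ι j) g) f

/-- Iterated integration over the index spaces of all the variables. -/
def intAll (n : ℕ) (Nd : Fin n → ℕ) (ch : Fin n → Bool) :
    List (Fin n) → ((Π j, Idx (Nd j)) → ℝ≥0∞) → (Π j, Idx (Nd j)) → ℝ≥0∞
  | [], F, ι => F ι
  | j :: l, F, ι =>
      ∫⁻ a, intAll n Nd ch l F (Function.update ι j a) ∂idxMeas (Nd j) (ch j)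

/-- A base point of the index space. -/
def defIdx (n : ℕ) (Nd : Fin n → ℕ) : Π j : Fin n, Idx (Nd j) :=
  fun _ => Sum.inl 0

/-- The squared pointwise Hilbert-space norm `‖(S̃₁ ⊗ ⋯ ⊗ S̃ₙ f)(x)‖²` of the tensor product
of the square functions chosen by `ch` (`ch j = true`: Lusin `𝐒_j^L`; `ch j = false`: the
dyadic `𝐒_{𝒟_j}` for the fixed lattice `𝒟_j = t_j + 𝒟₀`), applied to `f`. -/
def tensorNormSq (n : ℕ) (Nd : Fin n → ℕ) (t : Π j : Fin n, Fin (Nd j) → ℝ)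
    (ch : Fin n → Bool) (f : X n Nd → ℝ) (x : X n Nd) : ℝ≥0∞ :=
  intAll n Nd ch (List.finRange n)
    (fun ι => ENNReal.ofReal ((compAll n Nd t ι f x) ^ 2)) (defIdx n Nd)

/-- `∫_X ‖(S̃₁ ⊗ ⋯ ⊗ S̃ₙ f)(x)‖ dx`. -/
def tensorL1Norm (n : ℕ) (Nd : Fin n → ℕ) (t : Π j : Fin n, Fin (Nd j) → ℝ)
    (ch : Fin n → Bool) (f : X n Nd → ℝ) : ℝ≥0∞ :=
  ∫⁻ x, (tensorNormSq n Nd t ch f x) ^ (1 / 2 : ℝ)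

/-! ### The gradient of the Poisson kernel -/

/-- `|v|² + s²`. -/
def rsq {N : ℕ} (v : Fin N → ℝ) (s : ℝ) : ℝ := (∑ i, v i ^ 2) + s ^ 2

/-- The normalizing constant of the Poisson kernel. -/
def pcoef (N : ℕ) : ℝ := Real.Gamma (((N : ℝ) + 1) / 2) / Real.pi ^ (((N : ℝ) + 1) / 2)

/-- The unit vector in the coordinate direction `d` of the half-space. -/
def dirE {N : ℕ} (d : Fin (N + 1)) : (Fin N → ℝ) × ℝ :=
  if h : (d : ℕ) < N then (Pi.single (⟨d, h⟩ : Fin N) 1, 0) else (0, 1)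

/-- The differential of `v, s ↦ |v|² + s²`. -/
def rsqL {N : ℕ} (v : Fin N → ℝ) (s : ℝ) : ((Fin N → ℝ) × ℝ) →L[ℝ] ℝ :=
  (∑ i, (2 * v i) • (ContinuousLinearMap.proj (R := ℝ) (φ := fun _ : Fin N => ℝ) i).comp
    (ContinuousLinearMap.fst ℝ (Fin N → ℝ) ℝ)) +
    (2 * s) • ContinuousLinearMap.snd ℝ (Fin N → ℝ) ℝ

/-- The differential of the Poisson kernel. -/
def pkL {N : ℕ} (v : Fin N → ℝ) (s : ℝ) : ((Fin N → ℝ) × ℝ) →L[ℝ] ℝ :=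
  pcoef N • (rsq v s ^ (-(((N : ℝ) + 1) / 2)) • ContinuousLinearMap.snd ℝ (Fin N → ℝ) ℝ +
    (s * (-(((N : ℝ) + 1) / 2) * rsq v s ^ (-(((N : ℝ) + 1) / 2) - 1))) • rsqL v s)

/-- The partial derivative of the Poisson kernel in the direction `d`. -/
def kd {N : ℕ} (d : Fin (N + 1)) (v : Fin N → ℝ) (s : ℝ) : ℝ := pkL v s (dirE d)

lemma pcoef_pos (N : ℕ) : 0 < pcoef N := by
  have : 0 < ((N : ℝ) + 1) / 2 := by positivity
  exact div_pos (Real.Gamma_pos_of_pos this) (Real.rpow_pos_of_pos Real.pi_pos _)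

lemma rsq_pos {N : ℕ} (v : Fin N → ℝ) {s : ℝ} (hs : 0 < s) : 0 < rsq v s := by
  have : 0 ≤ ∑ i, v i ^ 2 := Finset.sum_nonneg fun i _ => sq_nonneg _
  unfold rsq; positivity

lemma sq_le_rsq {N : ℕ} (v : Fin N → ℝ) (s : ℝ) : s ^ 2 ≤ rsq v s := by
  have : 0 ≤ ∑ i, v i ^ 2 := Finset.sum_nonneg fun i _ => sq_nonneg _
  unfold rsq; linarith

lemma coord_sq_le_rsq {N : ℕ} (v : Fin N → ℝ) (s : ℝ) (i : Fin N) : v i ^ 2 ≤ rsq v s := by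
  have := Finset.single_le_sum (f := fun i => v i ^ 2) (fun i _ => sq_nonneg _)
    (Finset.mem_univ i)
  have h2 := sq_nonneg s
  unfold rsq; linarith

lemma norm_sq_le_rsq {N : ℕ} (v : Fin N → ℝ) {s : ℝ} (hs : 0 < s) : ‖v‖ ^ 2 ≤ rsq v s := by
  have : ‖v‖ ≤ √(rsq v s) := by
    rw [pi_norm_le_iff_of_nonneg (Real.sqrt_nonneg _)]
    intro i
    exact Real.le_sqrt_of_sq_le (by simpa using coord_sq_le_rsq v s i)
  calc ‖v‖ ^ 2 ≤ √(rsq v s) ^ 2 := by gcongr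
    _ = rsq v s := Real.sq_sqrt (rsq_pos v hs).le

lemma sq_add_norm_le_rsq {N : ℕ} (v : Fin N → ℝ) {s : ℝ} (hs : 0 < s) :
    ((s + ‖v‖) / 2) ^ 2 ≤ rsq v s := by
  have h1 := norm_sq_le_rsq v hs
  have h2 := sq_le_rsq v s
  nlinarith [sq_nonneg (s - ‖v‖)]

lemma rsq_rpow_le {N : ℕ} (v : Fin N → ℝ) {s : ℝ} (hs : 0 < s) {b : ℝ} (hb : 0 ≤ b) :
    rsq v s ^ (-(b / 2)) ≤ 2 ^ b * (s + ‖v‖) ^ (-b) := by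
  have h0 : 0 < (s + ‖v‖) / 2 := by positivity
  calc rsq v s ^ (-(b / 2)) ≤ (((s + ‖v‖) / 2) ^ 2) ^ (-(b / 2)) :=
        Real.rpow_le_rpow_of_nonpos (by positivity) (sq_add_norm_le_rsq v hs) (by linarith)
    _ = ((s + ‖v‖) / 2) ^ (-b) := by
        rw [← Real.rpow_natCast, ← Real.rpow_mul h0.le]; congr 1; push_cast; ring
    _ = 2 ^ b * (s + ‖v‖) ^ (-b) := by
        rw [Real.div_rpow (by positivity) (by norm_num), Real.rpow_neg (by norm_num : (0:ℝ) ≤ 2)]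
        field_simp

lemma hasFDerivAt_rsq {N : ℕ} (v : Fin N → ℝ) (s : ℝ) :
    HasFDerivAt (fun p : (Fin N → ℝ) × ℝ => rsq p.1 p.2) (rsqL v s) (v, s) := by
  unfold rsq rsqL
  apply HasFDerivAt.add
  · apply HasFDerivAt.fun_sum
    intro i _
    have h : HasFDerivAt (fun p : (Fin N → ℝ) × ℝ => p.1 i)
        ((ContinuousLinearMap.proj (R := ℝ) (φ := fun _ : Fin N => ℝ) i).comp
          (ContinuousLinearMap.fst ℝ (Fin N → ℝ) ℝ)) (v, s) :=
      ((ContinuousLinearMap.proj (R := ℝ) (φ := fun _ : Fin N => ℝ) i).comp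
        (ContinuousLinearMap.fst ℝ (Fin N → ℝ) ℝ)).hasFDerivAt
    simpa using h.pow 2
  · have h : HasFDerivAt (fun p : (Fin N → ℝ) × ℝ => p.2)
        (ContinuousLinearMap.snd ℝ (Fin N → ℝ) ℝ) (v, s) := hasFDerivAt_snd
    simpa using h.pow 2

lemma pk_eq {N : ℕ} (v : Fin N → ℝ) {s : ℝ} (hs : 0 < s) :
    pk N v s = pcoef N * (s * rsq v s ^ (-(((N : ℝ) + 1) / 2))) := by
  have : (∑ i, v i ^ 2) + s ^ 2 = rsq v s := rfl
  rw [pk, this, Real.rpow_neg (rsq_pos v hs).le, pcoef, div_eq_mul_inv, mul_assoc]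

lemma hasFDerivAt_pk {N : ℕ} (v : Fin N → ℝ) {s : ℝ} (hs : 0 < s) :
    HasFDerivAt (fun p : (Fin N → ℝ) × ℝ => pk N p.1 p.2) (pkL v s) (v, s) := by
  have h1 := (hasFDerivAt_rsq v s).rpow_const (p := -(((N : ℝ) + 1) / 2))
    (Or.inl (rsq_pos v hs).ne')
  have h2 : HasFDerivAt (fun p : (Fin N → ℝ) × ℝ => p.2)
    (ContinuousLinearMap.snd ℝ (Fin N → ℝ) ℝ) (v, s) := hasFDerivAt_snd
  have h3 := (h2.mul h1).const_mul (pcoef N)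
  have h4 : HasFDerivAt (fun p : (Fin N → ℝ) × ℝ =>
      pcoef N * (p.2 * rsq p.1 p.2 ^ (-(((N : ℝ) + 1) / 2)))) (pkL v s) (v, s) := by
    refine h3.congr_fderiv ?_
    unfold pkL
    rw [smul_smul, add_comm]
  refine h4.congr_of_eventuallyEq ?_
  have : ∀ᶠ p : (Fin N → ℝ) × ℝ in 𝓝 (v, s), 0 < p.2 :=
    (continuous_snd.tendsto (v, s)).eventually (lt_mem_nhds hs)
  filter_upwards [this] with p hp using pk_eq p.1 hp

lemma abs_rsqL_le_of_le {N : ℕ} {v : Fin N → ℝ} {s K : ℝ} (hv : ∀ i, |v i| ≤ K)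
    (hs : |s| ≤ K) (w : (Fin N → ℝ) × ℝ) : |rsqL v s w| ≤ 2 * (N + 1) * K * ‖w‖ := by
  have h1 : ∀ i, |w.1 i| ≤ ‖w‖ := fun i => (norm_le_pi_norm w.1 i).trans (norm_fst_le w)
  have h2 : |w.2| ≤ ‖w‖ := norm_snd_le w
  have hK : 0 ≤ K := (abs_nonneg _).trans hs
  have : rsqL v s w = (∑ i, 2 * v i * w.1 i) + 2 * s * w.2 := by
    simp [rsqL]
  rw [this]
  calc |(∑ i, 2 * v i * w.1 i) + 2 * s * w.2|
      ≤ (∑ i, |2 * v i * w.1 i|) + |2 * s * w.2| :=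
        (abs_add_le _ _).trans (add_le_add (Finset.abs_sum_le_sum_abs _ _) le_rfl)
    _ ≤ (∑ i : Fin N, 2 * (K * ‖w‖)) + 2 * (K * ‖w‖) := by
        gcongr with i
        · rw [mul_assoc, abs_mul, abs_mul, abs_two]
          gcongr; exacts [hv i, h1 i]
        · rw [mul_assoc, abs_mul, abs_mul, abs_two]
          gcongr
    _ = _ := by simp; ring

lemma abs_rsqL_le {N : ℕ} (v : Fin N → ℝ) (s : ℝ) (w : (Fin N → ℝ) × ℝ) :
    |rsqL v s w| ≤ 2 * (N + 1) * √(rsq v s) * ‖w‖ :=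
  abs_rsqL_le_of_le (fun i => Real.abs_le_sqrt (coord_sq_le_rsq v s i))
    (Real.abs_le_sqrt (sq_le_rsq v s)) w

lemma norm_pkL_le (N : ℕ) : ∃ C : ℝ, 0 < C ∧ ∀ (v : Fin N → ℝ) (s : ℝ), 0 < s →
    ‖pkL v s‖ ≤ C * (s + ‖v‖) ^ (-((N : ℝ) + 1)) := by
  refine ⟨pcoef N * (1 + ((N : ℝ) + 1) ^ 2) * 2 ^ ((N : ℝ) + 1),
    mul_pos (mul_pos (pcoef_pos N) (by positivity)) (by positivity), fun v s hs => ?_⟩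
  have hr := rsq_pos v hs
  have hle := rsq_rpow_le v hs (b := (N : ℝ) + 1) (by positivity)
  have hp := pcoef_pos N
  have hs' : s ≤ √(rsq v s) := Real.le_sqrt_of_sq_le (sq_le_rsq v s)
  have hmul : √(rsq v s) * √(rsq v s) = rsq v s := Real.mul_self_sqrt hr.le
  have hpow : rsq v s ^ (-(((N : ℝ) + 1) / 2) - 1) * rsq v s =
      rsq v s ^ (-(((N : ℝ) + 1) / 2)) := by
    rw [← Real.rpow_add_one hr.ne']; ring_nf
  set A := rsq v s ^ (-(((N : ℝ) + 1) / 2)) with hA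
  set B := rsq v s ^ (-(((N : ℝ) + 1) / 2) - 1) with hB
  have hA0 : 0 < A := Real.rpow_pos_of_pos hr _
  have hB0 : 0 < B := Real.rpow_pos_of_pos hr _
  refine ContinuousLinearMap.opNorm_le_bound _ (by positivity) fun w => ?_
  have h1 : pkL v s w = pcoef N * (A * w.2 + s * (-(((N : ℝ) + 1) / 2) * B) * rsqL v s w) := by
    simp [pkL, ← hA, ← hB]; ring
  have h2 : |w.2| ≤ ‖w‖ := norm_snd_le w
  have h3 := abs_rsqL_le v s w
  rw [h1, Real.norm_eq_abs, abs_mul, abs_of_pos hp]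
  have h4 : |A * w.2 + s * (-(((N : ℝ) + 1) / 2) * B) * rsqL v s w| ≤
      (1 + ((N : ℝ) + 1) ^ 2) * A * ‖w‖ := by
    calc _ ≤ |A * w.2| + |s * (-(((N : ℝ) + 1) / 2) * B) * rsqL v s w| := abs_add_le _ _
      _ ≤ A * ‖w‖ + √(rsq v s) * (((N : ℝ) + 1) / 2 * B) *
          (2 * (N + 1) * √(rsq v s) * ‖w‖) := by
          rw [abs_mul, abs_mul, abs_mul, abs_mul, abs_of_pos hA0, abs_of_pos hB0, abs_of_pos hs,
            abs_neg, abs_of_pos (by positivity : 0 < ((N : ℝ) + 1) / 2)]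
          gcongr
      _ = A * ‖w‖ + ((N : ℝ) + 1) ^ 2 * (B * (√(rsq v s) * √(rsq v s))) * ‖w‖ := by ring
      _ = _ := by rw [hmul, hpow]; ring
  calc _ ≤ pcoef N * ((1 + ((N : ℝ) + 1) ^ 2) * A * ‖w‖) := by gcongr
    _ ≤ pcoef N * ((1 + ((N : ℝ) + 1) ^ 2) *
          (2 ^ ((N : ℝ) + 1) * (s + ‖v‖) ^ (-((N : ℝ) + 1))) * ‖w‖) := by gcongr
    _ = _ := by ring

lemma norm_dirE_le {N : ℕ} (d : Fin (N + 1)) : ‖dirE d‖ ≤ 1 := by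
  unfold dirE
  split_ifs with h
  · rw [Prod.norm_def]
    simp [Pi.norm_single]
  · rw [Prod.norm_def]; simp

lemma abs_kd_le (N : ℕ) : ∃ C : ℝ, 0 < C ∧ ∀ (d : Fin (N + 1)) (v : Fin N → ℝ) (s : ℝ), 0 < s →
    |kd d v s| ≤ C * (s + ‖v‖) ^ (-((N : ℝ) + 1)) := by
  obtain ⟨C, hC, h⟩ := norm_pkL_le N
  refine ⟨C, hC, fun d v s hs => ?_⟩
  calc |kd d v s| ≤ ‖pkL v s‖ * ‖dirE d‖ := (pkL v s).le_opNorm _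
    _ ≤ ‖pkL v s‖ * 1 := by gcongr; exact norm_dirE_le d
    _ ≤ _ := by rw [mul_one]; exact h v s hs

/-! ### Decaying weights -/

/-- The weight `(s + |v|)^{-(N+β)}`. -/
def wt {N : ℕ} (β s : ℝ) (v : Fin N → ℝ) : ℝ := (s + ‖v‖) ^ (-((N : ℝ) + β))

lemma wt_nonneg {N : ℕ} (β : ℝ) {s : ℝ} (hs : 0 < s) (v : Fin N → ℝ) : 0 ≤ wt β s v := by
  unfold wt; positivity

lemma wt_pos {N : ℕ} (β : ℝ) {s : ℝ} (hs : 0 < s) (v : Fin N → ℝ) : 0 < wt β s v := by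
  unfold wt; positivity

lemma measurable_wt_right {N : ℕ} (β s : ℝ) : Measurable fun v : Fin N → ℝ => wt β s v := by
  unfold wt; fun_prop

lemma wt_neg {N : ℕ} (β s : ℝ) (v : Fin N → ℝ) : wt β s (-v) = wt β s v := by simp [wt]

lemma wt_smul {N : ℕ} (β : ℝ) {s : ℝ} (hs : 0 < s) (v : Fin N → ℝ) :
    wt β s (s • v) = s ^ (-((N : ℝ) + β)) * wt β 1 v := by
  unfold wt
  rw [norm_smul, Real.norm_of_nonneg hs.le, ← Real.mul_rpow hs.le (by positivity)]
  ring_nf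

lemma wt_le_of_le {N : ℕ} {β : ℝ} (hβ : 0 ≤ β) {s s' K : ℝ} {v v' : Fin N → ℝ} (hs : 0 < s)
    (hK : 0 < K) (h : s + ‖v‖ ≤ K * (s' + ‖v'‖)) :
    wt β s' v' ≤ K ^ ((N : ℝ) + β) * wt β s v := by
  unfold wt
  have h0 : 0 < s + ‖v‖ := by positivity
  have h1 : 0 < K * (s' + ‖v'‖) := h0.trans_le h
  have h2 : 0 < s' + ‖v'‖ := by
    by_contra! h2
    nlinarith
  calc (s' + ‖v'‖) ^ (-((N : ℝ) + β))
      = K ^ ((N : ℝ) + β) * (K * (s' + ‖v'‖)) ^ (-((N : ℝ) + β)) := by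
        rw [Real.mul_rpow hK.le h2.le, ← mul_assoc, ← Real.rpow_add hK]
        simp
    _ ≤ K ^ ((N : ℝ) + β) * (s + ‖v‖) ^ (-((N : ℝ) + β)) := by
        exact mul_le_mul_of_nonneg_left (Real.rpow_le_rpow_of_nonpos h0 h
          (by linarith [Nat.cast_nonneg (α := ℝ) N])) (by positivity)

/-- The integral of `(1 + |v|)^{-(N+β)}`. -/
def wtI (N : ℕ) (β : ℝ) : ℝ≥0∞ := ∫⁻ v : Fin N → ℝ, ENNReal.ofReal (wt β 1 v)

lemma wtI_lt_top (N : ℕ) {β : ℝ} (hβ : 0 < β) : wtI N β < ∞ := by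
  unfold wtI wt
  apply finite_integral_one_add_norm
  simpa using hβ

lemma lintegral_scale {N : ℕ} {s : ℝ} (hs : 0 < s) (f : (Fin N → ℝ) → ℝ≥0∞) (hf : Measurable f) :
    ∫⁻ v, f v = ENNReal.ofReal (s ^ N) * ∫⁻ v, f (s • v) := by
  have h := Measure.map_addHaar_smul (volume : Measure (Fin N → ℝ)) hs.ne'
  have h1 : ∫⁻ v, f (s • v) = ENNReal.ofReal |(s ^ N)⁻¹| * ∫⁻ v, f v := by
    rw [← lintegral_map (f := f) (g := fun v => s • v) hf (measurable_const_smul s), h]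
    simp
  have hp : 0 < s ^ N := by positivity
  rw [h1, ← mul_assoc, ← ENNReal.ofReal_mul hp.le, abs_of_pos (by positivity),
    mul_inv_cancel₀ hp.ne']
  simp

lemma lintegral_wt {N : ℕ} (β : ℝ) {s : ℝ} (hs : 0 < s) :
    ∫⁻ v : Fin N → ℝ, ENNReal.ofReal (wt β s v) = ENNReal.ofReal (s ^ (-β)) * wtI N β := by
  rw [lintegral_scale hs _ (measurable_wt_right β s).ennreal_ofReal, wtI]
  simp_rw [wt_smul β hs]
  simp_rw [ENNReal.ofReal_mul (Real.rpow_nonneg hs.le _)]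
  rw [lintegral_const_mul _ (measurable_wt_right β 1).ennreal_ofReal, ← mul_assoc,
    ← ENNReal.ofReal_mul (by positivity)]
  congr 2
  rw [← Real.rpow_natCast, ← Real.rpow_add hs]
  ring_nf

lemma integrable_wt (N : ℕ) {β : ℝ} (hβ : 0 < β) {s : ℝ} (hs : 0 < s) :
    Integrable fun v : Fin N → ℝ => wt β s v := by
  refine ⟨(measurable_wt_right β s).aestronglyMeasurable, ?_⟩
  rw [hasFiniteIntegral_iff_ofReal (ae_of_all _ fun v => wt_nonneg β hs v), lintegral_wt β hs]
  exact ENNReal.mul_lt_top ENNReal.ofReal_lt_top (wtI_lt_top N hβ)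

lemma abs_kd_le_wt (N : ℕ) : ∃ C : ℝ, 0 < C ∧ ∀ (d : Fin (N + 1)) (v : Fin N → ℝ) (s : ℝ), 0 < s →
    |kd d v s| ≤ C * wt 1 s v := abs_kd_le N

lemma continuousOn_pkL (N : ℕ) :
    ContinuousOn (fun p : (Fin N → ℝ) × ℝ => pkL p.1 p.2) {p | 0 < p.2} := by
  have hr : Continuous fun p : (Fin N → ℝ) × ℝ => rsq p.1 p.2 := by unfold rsq; fun_prop
  have hp : ∀ q : ℝ, ContinuousOn (fun p : (Fin N → ℝ) × ℝ => rsq p.1 p.2 ^ q) {p | 0 < p.2} :=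
    fun q => hr.continuousOn.rpow_const fun p hp => Or.inl (rsq_pos p.1 hp).ne'
  have hL : Continuous fun p : (Fin N → ℝ) × ℝ => rsqL p.1 p.2 := by
    unfold rsqL; fun_prop
  unfold pkL
  have h1 := hp (-(((N : ℝ) + 1) / 2))
  have h2 := hp (-(((N : ℝ) + 1) / 2) - 1)
  fun_prop

lemma continuous_pkL {N : ℕ} {s : ℝ} (hs : 0 < s) : Continuous fun v : Fin N → ℝ => pkL v s :=
  (continuousOn_pkL N).comp_continuous (f := fun v => (v, s)) (by fun_prop) fun _ => hs

lemma continuous_kd {N : ℕ} (d : Fin (N + 1)) {s : ℝ} (hs : 0 < s) :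
    Continuous fun v : Fin N → ℝ => kd d v s := by
  have := continuous_pkL (N := N) hs
  unfold kd; fun_prop

lemma measurable_kd {N : ℕ} :
    Measurable fun p : Fin (N + 1) × (Fin N → ℝ) × ℝ => kd p.1 p.2.1 p.2.2 := by
  refine measurable_from_prod_countable_right fun d => ?_
  have hr : Measurable fun p : (Fin N → ℝ) × ℝ => rsq p.1 p.2 := by unfold rsq; fun_prop
  have hL : Continuous fun p : (Fin N → ℝ) × ℝ => rsqL p.1 p.2 (dirE d) := by
    unfold rsqL; fun_prop
  have hL := hL.measurable
  simp only [kd, pkL, smul_apply, add_apply]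
  fun_prop

lemma continuous_pk {N : ℕ} {s : ℝ} (hs : 0 < s) : Continuous fun v : Fin N → ℝ => pk N v s := by
  rw [continuous_iff_continuousAt]
  intro v
  exact (hasFDerivAt_pk v hs).continuousAt.comp (f := fun v => (v, s)) (by fun_prop)

lemma abs_pk_le {N : ℕ} (v : Fin N → ℝ) {s : ℝ} (hs : 0 < s) :
    |pk N v s| ≤ pcoef N * s * 2 ^ ((N : ℝ) + 1) * wt 1 s v := by
  have hp := pcoef_pos N
  have h0 := rsq_pos v hs
  rw [pk_eq v hs, abs_of_pos (by positivity), mul_assoc, mul_assoc]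
  unfold wt
  have := rsq_rpow_le v hs (b := (N : ℝ) + 1) (by positivity)
  gcongr

lemma exists_wt_le_of_mem_ball {N : ℕ} (x : Fin N → ℝ) {s : ℝ} (hs : 0 < s) :
    ∃ K : ℝ, 0 < K ∧ ∀ w ∈ Metric.ball (x, s) (s / 2), 0 < w.2 ∧
      ∀ z, wt 1 w.2 (w.1 - z) ≤ K * wt 1 1 z := by
  set K : ℝ := (1 + ‖x‖ + s / 2) / (s / 2) + 1 with hK
  have hK0 : 0 < K := by positivity
  refine ⟨K ^ ((N : ℝ) + 1), by positivity, fun w hw => ?_⟩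
  have h1 : ‖w - (x, s)‖ < s / 2 := by simpa [dist_eq_norm] using hw
  have h2 : ‖w.1 - x‖ < s / 2 := (norm_fst_le (w - (x, s))).trans_lt h1
  have h3 : |w.2 - s| < s / 2 := (norm_snd_le (w - (x, s))).trans_lt h1
  have h4 : s / 2 < w.2 := by rw [abs_lt] at h3; linarith
  refine ⟨by linarith, fun z => wt_le_of_le zero_le_one one_pos hK0 ?_⟩
  have h5 : ‖z‖ ≤ ‖x‖ + s / 2 + ‖w.1 - z‖ := by
    have : z = x + (w.1 - x) - (w.1 - z) := by abel
    calc ‖z‖ = ‖x + (w.1 - x) - (w.1 - z)‖ := by rw [← this]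
      _ ≤ ‖x‖ + ‖w.1 - x‖ + ‖w.1 - z‖ :=
        (norm_sub_le _ _).trans (by gcongr; exact norm_add_le _ _)
      _ ≤ _ := by gcongr
  have h6 : 1 + ‖x‖ + s / 2 = (1 + ‖x‖ + s / 2) / (s / 2) * (s / 2) := by field_simp
  have h7 : 0 ≤ (1 + ‖x‖ + s / 2) / (s / 2) := by positivity
  have h8 := norm_nonneg (w.1 - z)
  have h9 := mul_le_mul_of_nonneg_left h4.le h7
  have h10 := mul_nonneg h7 h8
  rw [hK, add_mul, mul_add, one_mul]
  linarith

lemma aestronglyMeasurable_mul_pk {N : ℕ} {g : (Fin N → ℝ) → ℝ}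
    (hg : AEStronglyMeasurable g volume) (x : Fin N → ℝ) {s : ℝ} (hs : 0 < s) :
    AEStronglyMeasurable (fun z => g z * pk N (x - z) s) volume :=
  hg.mul ((continuous_pk hs).comp (by fun_prop : Continuous fun z => x - z)).aestronglyMeasurable

lemma integrable_mul_pk {N : ℕ} {g : (Fin N → ℝ) → ℝ} (hg : AEStronglyMeasurable g volume)
    (hgi : Integrable fun z => g z * wt 1 1 z) (x : Fin N → ℝ) {s : ℝ} (hs : 0 < s) :
    Integrable fun z => g z * pk N (x - z) s := by
  obtain ⟨K, hK, hw⟩ := exists_wt_le_of_mem_ball x hs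
  refine (hgi.norm.const_mul (pcoef N * s * 2 ^ ((N : ℝ) + 1) * K)).mono'
    (aestronglyMeasurable_mul_pk hg x hs) (ae_of_all _ fun z => ?_)
  have h1 := (hw _ (Metric.mem_ball_self (by positivity))).2 z
  have h2 := abs_pk_le (x - z) hs
  have h4 := wt_nonneg (N := N) 1 one_pos z
  have hp := pcoef_pos N
  rw [norm_mul, norm_mul, Real.norm_of_nonneg h4]
  calc ‖g z‖ * ‖pk N (x - z) s‖ ≤
      ‖g z‖ * (pcoef N * s * 2 ^ ((N : ℝ) + 1) * (K * wt 1 1 z)) := by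
        gcongr
        exact h2.trans (mul_le_mul_of_nonneg_left h1 (by positivity))
    _ = _ := by ring

lemma hasFDerivAt_mul_pk_sub {N : ℕ} (c : ℝ) (z : Fin N → ℝ) {w : (Fin N → ℝ) × ℝ}
    (h1 : 0 < w.2) : HasFDerivAt (fun w : (Fin N → ℝ) × ℝ => c * pk N (w.1 - z) w.2)
      (c • pkL (w.1 - z) w.2) w := by
  have h2 : HasFDerivAt (fun w : (Fin N → ℝ) × ℝ => (w.1 - z, w.2))
      (ContinuousLinearMap.id ℝ ((Fin N → ℝ) × ℝ)) w := by
    have := (hasFDerivAt_id (𝕜 := ℝ) w).sub_const ((z, 0) : (Fin N → ℝ) × ℝ)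
    refine this.congr_of_eventuallyEq (Eventually.of_forall fun y => ?_)
    ext <;> simp
  have h3 := (hasFDerivAt_pk (w.1 - z) h1).comp w h2
  exact h3.const_mul c

/-- Differentiation of the Poisson integral. -/
lemma hasFDerivAt_poisson {N : ℕ} {g : (Fin N → ℝ) → ℝ} (hg : AEStronglyMeasurable g volume)
    (hgi : Integrable fun z => g z * wt 1 1 z) (x : Fin N → ℝ) {s : ℝ} (hs : 0 < s) :
    Integrable (fun z => g z • pkL (x - z) s) ∧
    HasFDerivAt (fun w : (Fin N → ℝ) × ℝ => ∫ z, g z * pk N (w.1 - z) w.2)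
      (∫ z, g z • pkL (x - z) s) (x, s) := by
  obtain ⟨C, hC, hL⟩ := norm_pkL_le N
  obtain ⟨K, hK, hw⟩ := exists_wt_le_of_mem_ball x hs
  have hx : (x, s) ∈ Metric.ball (x, s) (s / 2) := Metric.mem_ball_self (by positivity)
  have hc : Continuous fun z => pkL (x - z) s :=
    (continuous_pkL hs).comp (by fun_prop : Continuous fun z => x - z)
  have hLm : AEStronglyMeasurable (fun z => g z • pkL (x - z) s) volume :=
    hg.smul hc.aestronglyMeasurable
  have hbound : ∀ z, ∀ w ∈ Metric.ball (x, s) (s / 2), ‖g z • pkL (w.1 - z) w.2‖ ≤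
      C * K * ‖g z * wt 1 1 z‖ := by
    intro z w hwb
    obtain ⟨h1, h2⟩ := hw w hwb
    have h3 : ‖pkL (w.1 - z) w.2‖ ≤ C * (K * wt 1 1 z) :=
      (hL (w.1 - z) w.2 h1).trans (mul_le_mul_of_nonneg_left (h2 z) hC.le)
    rw [norm_smul, norm_mul, Real.norm_of_nonneg (wt_nonneg (N := N) 1 one_pos z)]
    calc ‖g z‖ * ‖pkL (w.1 - z) w.2‖ ≤ ‖g z‖ * (C * (K * wt 1 1 z)) :=
          mul_le_mul_of_nonneg_left h3 (norm_nonneg _)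
      _ = _ := by ring
  have hbi : Integrable fun z => C * K * ‖g z * wt 1 1 z‖ := hgi.norm.const_mul _
  have hm : ∀ᶠ w : (Fin N → ℝ) × ℝ in 𝓝 (x, s),
      AEStronglyMeasurable (fun z => g z * pk N (w.1 - z) w.2) volume := by
    filter_upwards [Metric.ball_mem_nhds (x, s) (by positivity : 0 < s / 2)] with w hwb
    exact aestronglyMeasurable_mul_pk hg _ (hw w hwb).1
  refine ⟨hbi.mono' hLm (ae_of_all _ fun z => hbound z (x, s) hx), ?_⟩
  have hd : ∀ z, ∀ w ∈ Metric.ball (x, s) (s / 2), HasFDerivAt (fun w : (Fin N → ℝ) × ℝ =>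
    g z * pk N (w.1 - z) w.2) (g z • pkL (w.1 - z) w.2) w :=
      fun z w hwb => hasFDerivAt_mul_pk_sub _ _ (hw w hwb).1
  exact hasFDerivAt_integral_of_dominated_of_fderiv_le (𝕜 := ℝ)
    (F := fun w : (Fin N → ℝ) × ℝ => fun z => g z * pk N (w.1 - z) w.2)
    (F' := fun w z => g z • pkL (w.1 - z) w.2) (x₀ := (x, s))
    (Metric.ball_mem_nhds (x, s) (by positivity)) hm (integrable_mul_pk hg hgi x hs) hLm
    (ae_of_all _ hbound) hbi (ae_of_all _ hd)

lemma fderiv_poisson {N : ℕ} {g : (Fin N → ℝ) → ℝ} (hg : AEStronglyMeasurable g volume)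
    (hgi : Integrable fun z => g z * wt 1 1 z) (x : Fin N → ℝ) {s : ℝ} (hs : 0 < s)
    (d : Fin (N + 1)) :
    fderiv ℝ (fun w : (Fin N → ℝ) × ℝ => ∫ z, g z * pk N (w.1 - z) w.2) (x, s) (dirE d) =
      ∫ z, g z * kd d (x - z) s := by
  obtain ⟨h1, h2⟩ := hasFDerivAt_poisson hg hgi x hs
  rw [h2.fderiv, ContinuousLinearMap.integral_apply h1]
  rfl

lemma integral_pk {N : ℕ} (x : Fin N → ℝ) {s : ℝ} (hs : 0 < s) :
    ∫ z, pk N (x - z) s = ∫ z, pk N z 1 := by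
  rw [integral_sub_left_eq_self (fun z => pk N z s)]
  have h := Measure.integral_comp_smul_of_nonneg (volume : Measure (Fin N → ℝ))
    (fun z => pk N z s) s (hR := hs.le)
  have h1 : ∀ z : Fin N → ℝ, pk N (s • z) s = (s ^ N)⁻¹ * pk N z 1 := by
    intro z
    rw [pk_eq _ hs, pk_eq _ one_pos]
    have : rsq (s • z) s = s ^ 2 * rsq z 1 := by
      simp [rsq, mul_pow, mul_add, Finset.mul_sum]
    rw [this, Real.mul_rpow (by positivity) (rsq_pos z one_pos).le, ← Real.rpow_natCast s 2,
      ← Real.rpow_mul hs.le, ← Real.rpow_natCast s N, ← Real.rpow_neg hs.le]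
    have : s * s ^ (((2 : ℕ) : ℝ) * -(((N : ℝ) + 1) / 2)) = s ^ (-(N : ℝ)) := by
      nth_rewrite 1 [← Real.rpow_one s]
      rw [← Real.rpow_add hs]; congr 1; push_cast; ring
    rw [← this]; ring
  simp_rw [h1] at h
  rw [integral_const_mul] at h
  simp only [Module.finrank_fin_fun, smul_eq_mul] at h
  have h3 : (s ^ N)⁻¹ ≠ 0 := by positivity
  exact (mul_left_cancel₀ h3 h).symm

/-- The derivatives of the Poisson kernel have mean zero. -/
lemma integral_kd {N : ℕ} (d : Fin (N + 1)) (x : Fin N → ℝ) {s : ℝ} (hs : 0 < s) :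
    ∫ z, kd d (x - z) s = 0 := by
  have h := fderiv_poisson (g := fun _ : Fin N → ℝ => (1 : ℝ)) aestronglyMeasurable_const
    (by simpa using integrable_wt N one_pos one_pos) x hs d
  have h2 : HasFDerivAt (fun w : (Fin N → ℝ) × ℝ => ∫ z, (1 : ℝ) * pk N (w.1 - z) w.2)
      (0 : ((Fin N → ℝ) × ℝ) →L[ℝ] ℝ) (x, s) := by
    refine (hasFDerivAt_const (∫ z, pk N z 1) (x, s)).congr_of_eventuallyEq ?_
    have : ∀ᶠ p : (Fin N → ℝ) × ℝ in 𝓝 (x, s), 0 < p.2 :=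
      (continuous_snd.tendsto (x, s)).eventually (lt_mem_nhds hs)
    filter_upwards [this] with p hp
    simpa using integral_pk p.1 hp
  rw [h2.fderiv] at h
  simpa using h.symm

lemma rsqL_apply {N : ℕ} (v : Fin N → ℝ) (s : ℝ) (w : (Fin N → ℝ) × ℝ) :
    rsqL v s w = (∑ i, 2 * v i * w.1 i) + 2 * s * w.2 := by
  simp [rsqL]

lemma kd_eq {N : ℕ} (d : Fin (N + 1)) (v : Fin N → ℝ) (s : ℝ) :
    kd d v s = pcoef N * (rsq v s ^ (-(((N : ℝ) + 1) / 2)) * (dirE d).2 +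
      s * (-(((N : ℝ) + 1) / 2) * rsq v s ^ (-(((N : ℝ) + 1) / 2) - 1)) * rsqL v s (dirE d)) := by
  simp [kd, pkL]
  ring

/-- The derivative of `kd` along lines. -/
lemma abs_deriv_kd_line_le (N : ℕ) : ∃ C : ℝ, 0 < C ∧ ∀ (d : Fin (N + 1)) (v δ : Fin N → ℝ)
    (s : ℝ), 0 < s → ∀ τ : ℝ, ∃ g' : ℝ, HasDerivAt (fun τ : ℝ => kd d (v + τ • δ) s) g' τ ∧
      |g'| ≤ C * ‖δ‖ * wt 2 s (v + τ • δ) := by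
  set α : ℝ := ((N : ℝ) + 1) / 2 with hα
  have hα0 : 0 < α := by positivity
  have hp := pcoef_pos N
  refine ⟨pcoef N * (α * (2 * (N + 1)) + (α * (α + 1) * (2 * (N + 1)) * (2 * (N + 1)) +
    α * (2 * (N + 1)))) * 2 ^ ((N : ℝ) + 2), by positivity, fun d v δ s hs τ => ?_⟩
  set r := rsq (v + τ • δ) s with hr
  have hr0 : 0 < r := rsq_pos _ hs
  set ρ := √r with hρ
  have hρ0 : 0 < ρ := Real.sqrt_pos.2 hr0
  have hρρ : ρ * ρ = r := Real.mul_self_sqrt hr0.le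
  set B := r ^ (-α - 1) with hB
  have hB0 : 0 < B := Real.rpow_pos_of_pos hr0 _
  set D := ‖δ‖ with hD
  have hD0 : 0 ≤ D := norm_nonneg _
  set ℓ := rsqL (v + τ • δ) s (dirE d) with hℓ
  set R' := rsqL (v + τ • δ) s (δ, 0) with hR'
  set ℓ' := rsqL δ 0 (dirE d) with hℓ'
  have hde := norm_dirE_le d
  have hde2 : |(dirE d).2| ≤ 1 := (norm_snd_le (dirE d)).trans hde
  have hsρ : |s| ≤ ρ := Real.abs_le_sqrt (sq_le_rsq _ s)
  have b1 : |ℓ| ≤ 2 * (N + 1) * ρ := (abs_rsqL_le _ s _).trans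
    (by rw [← hr, ← hρ]; exact mul_le_of_le_one_right (by positivity) hde)
  have b2 : |R'| ≤ 2 * (N + 1) * ρ * D := (abs_rsqL_le _ s _).trans
    (by rw [← hr, ← hρ, Prod.norm_def]; simp [hD])
  have b3 : |ℓ'| ≤ 2 * (N + 1) * D := (abs_rsqL_le_of_le (K := D)
    (fun i => norm_le_pi_norm δ i) (by simpa using hD0) _).trans
    (mul_le_of_le_one_right (by positivity) hde)
  have hline : HasDerivAt (fun τ : ℝ => ((v + τ • δ, s) : (Fin N → ℝ) × ℝ)) (δ, 0) τ := by
    have h1 : HasDerivAt (fun τ : ℝ => v + τ • δ) δ τ := by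
      simpa using ((hasDerivAt_id τ).smul_const δ).const_add v
    exact h1.prodMk (hasDerivAt_const τ s)
  have dR : HasDerivAt (fun τ : ℝ => rsq (v + τ • δ) s) R' τ :=
    HasFDerivAt.comp_hasDerivAt (f := fun τ : ℝ => ((v + τ • δ, s) : (Fin N → ℝ) × ℝ)) τ
      (hasFDerivAt_rsq (v + τ • δ) s) hline
  have dℓ : HasDerivAt (fun τ : ℝ => rsqL (v + τ • δ) s (dirE d)) ℓ' τ := by
    have h1 : ∀ τ : ℝ, rsqL (v + τ • δ) s (dirE d) = rsqL v s (dirE d) + τ * ℓ' := by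
      intro τ
      simp only [hℓ', rsqL_apply, Pi.add_apply, Pi.smul_apply, smul_eq_mul]
      simp only [mul_add, add_mul, Finset.sum_add_distrib, Finset.mul_sum]
      simp only [mul_assoc, mul_left_comm]
      ring
    simp_rw [h1]
    simpa using ((hasDerivAt_id τ).mul_const ℓ').const_add (rsqL v s (dirE d))
  have dA := dR.rpow_const (p := -α) (Or.inl hr0.ne')
  have dB := dR.rpow_const (p := -α - 1) (Or.inl hr0.ne')
  have dK := ((dA.mul_const (dirE d).2).add
    (((dB.const_mul (-α)).const_mul s).mul dℓ)).const_mul (pcoef N)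
  refine ⟨_, by simp_rw [kd_eq]; exact dK, ?_⟩
  have hBr : r ^ (-α - 1 - 1) * r = B := by rw [← Real.rpow_add_one hr0.ne', hB]; congr 1; ring
  have hB2 : 0 < r ^ (-α - 1 - 1) := Real.rpow_pos_of_pos hr0 _
  simp only [← hr, ← hB, ← hℓ]
  set B2 := r ^ (-α - 1 - 1) with hB2d
  have key : |R' * -α * B * (dirE d).2 +
      (s * (-α * (R' * (-α - 1) * B2)) * ℓ + s * (-α * B) * ℓ')| ≤
      (α * (2 * (N + 1)) + (α * (α + 1) * (2 * (N + 1)) * (2 * (N + 1)) +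
        α * (2 * (N + 1)))) * D * (ρ * B) := by
    calc _ ≤ |R' * -α * B * (dirE d).2| +
        (|s * (-α * (R' * (-α - 1) * B2)) * ℓ| + |s * (-α * B) * ℓ'|) :=
          (abs_add_le _ _).trans (add_le_add le_rfl (abs_add_le _ _))
      _ ≤ (2 * (N + 1) * ρ * D) * α * B * 1 +
          (ρ * (α * ((2 * (N + 1) * ρ * D) * (α + 1) * B2)) * (2 * (N + 1) * ρ) +
            ρ * (α * B) * (2 * (N + 1) * D)) := by
          have e1 : |-α - 1| = α + 1 := by
            rw [abs_of_neg (by linarith)]; ring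
          simp only [abs_mul, abs_neg, e1, abs_of_pos hα0, abs_of_pos hB0, abs_of_pos hB2]
          gcongr
      _ = (α * (2 * (N + 1))) * D * (ρ * B) +
          (α * (α + 1) * (2 * (N + 1)) * (2 * (N + 1)) * D * (ρ * (B2 * (ρ * ρ))) +
            α * (2 * (N + 1)) * D * (ρ * B)) := by ring
      _ = _ := by rw [hρρ, hBr]; ring
  have hρB : ρ * B ≤ 2 ^ ((N : ℝ) + 2) * wt 2 s (v + τ • δ) := by
    have h1 := rsq_rpow_le (v + τ • δ) hs (b := (N : ℝ) + 2) (by positivity)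
    have h2 : ρ * B = r ^ (-(((N : ℝ) + 2) / 2)) := by
      rw [hρ, Real.sqrt_eq_rpow, hB, ← Real.rpow_add hr0, hα]; ring_nf
    rw [h2]; exact h1
  rw [abs_mul, abs_of_pos hp]
  calc _ ≤ pcoef N * ((α * (2 * (N + 1)) + (α * (α + 1) * (2 * (N + 1)) * (2 * (N + 1)) +
        α * (2 * (N + 1)))) * D * (2 ^ ((N : ℝ) + 2) * wt 2 s (v + τ • δ))) := by
        refine mul_le_mul_of_nonneg_left (key.trans ?_) hp.le
        exact mul_le_mul_of_nonneg_left hρB (by positivity)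
    _ = _ := by ring

/-- The Lipschitz estimate for the gradient of the Poisson kernel. -/
lemma abs_kd_sub_le (N : ℕ) : ∃ C : ℝ, 0 < C ∧ ∀ (d : Fin (N + 1)) (v v' : Fin N → ℝ) (s : ℝ),
    0 < s → 2 * ‖v' - v‖ ≤ s + ‖v‖ → |kd d v' s - kd d v s| ≤ C * ‖v' - v‖ * wt 2 s v := by
  obtain ⟨C, hC, h⟩ := abs_deriv_kd_line_le N
  refine ⟨C * 2 ^ ((N : ℝ) + 2), by positivity, fun d v v' s hs hv => ?_⟩
  choose g' hg' hb using h d v (v' - v) s hs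
  have := norm_image_sub_le_of_norm_deriv_le_segment_01'
    (f := fun τ : ℝ => kd d (v + τ • (v' - v)) s) (f' := g')
    (C := C * 2 ^ ((N : ℝ) + 2) * ‖v' - v‖ * wt 2 s v)
    (fun τ _ => (hg' τ).hasDerivWithinAt) (fun τ hτ => (hb τ).trans ?_)
  · simpa using this
  · have h1 : wt 2 s (v + τ • (v' - v)) ≤ 2 ^ ((N : ℝ) + 2) * wt 2 s v := by
      refine wt_le_of_le (by norm_num) hs two_pos ?_
      have h2 : ‖v‖ ≤ ‖v + τ • (v' - v)‖ + ‖v' - v‖ := by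
        calc ‖v‖ = ‖(v + τ • (v' - v)) - τ • (v' - v)‖ := by simp
          _ ≤ ‖v + τ • (v' - v)‖ + ‖τ • (v' - v)‖ := norm_sub_le _ _
          _ ≤ _ := by
            gcongr
            rw [norm_smul, Real.norm_of_nonneg hτ.1]
            exact mul_le_of_le_one_left (norm_nonneg _) hτ.2.le
      linarith
    calc C * ‖v' - v‖ * wt 2 s (v + τ • (v' - v))
        ≤ C * ‖v' - v‖ * (2 ^ ((N : ℝ) + 2) * wt 2 s v) := by gcongr
      _ = _ := by ring

/-! ### Dyadic cubes and averages -/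

/-- The index of the cube of scale `2^m` containing `x`. -/
def idx {N : ℕ} (t : Fin N → ℝ) (m : ℤ) (x : Fin N → ℝ) : Fin N → ℤ :=
  fun i => ⌊(x i - t i) / (2 : ℝ) ^ m⌋

/-- The cube of scale `2^m` with index `κ`. -/
def cube {N : ℕ} (t : Fin N → ℝ) (m : ℤ) (κ : Fin N → ℤ) : Set (Fin N → ℝ) :=
  {y | idx t m y = κ}

lemma mem_cube {N : ℕ} {t : Fin N → ℝ} {m : ℤ} {κ : Fin N → ℤ} {y : Fin N → ℝ} :
    y ∈ cube t m κ ↔ idx t m y = κ := Iff.rfl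

lemma dcube_eq {N : ℕ} (t : Fin N → ℝ) (m : ℤ) (x : Fin N → ℝ) :
    dcube t m x = cube t m (idx t m x) := by
  ext y; simp [dcube, cube, idx, funext_iff]

lemma measurable_idx {N : ℕ} (t : Fin N → ℝ) (m : ℤ) : Measurable (idx t m) := by
  refine measurable_pi_lambda _ fun i => Int.measurable_floor.comp ?_
  fun_prop

lemma measurableSet_cube {N : ℕ} (t : Fin N → ℝ) (m : ℤ) (κ : Fin N → ℤ) :
    MeasurableSet (cube t m κ) := measurable_idx t m (measurableSet_singleton κ)

lemma floor_eq_iff_mem_Ico {t y ℓ : ℝ} (hℓ : 0 < ℓ) (κ : ℤ) :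
    ⌊(y - t) / ℓ⌋ = κ ↔ y ∈ Set.Ico (t + κ * ℓ) (t + (κ + 1) * ℓ) := by
  rw [Int.floor_eq_iff, le_div_iff₀ hℓ, div_lt_iff₀ hℓ, Set.mem_Ico]
  constructor <;> rintro ⟨h1, h2⟩ <;> constructor <;> linarith

lemma cube_eq_pi {N : ℕ} (t : Fin N → ℝ) (m : ℤ) (κ : Fin N → ℤ) :
    cube t m κ = Set.univ.pi fun i =>
      Set.Ico (t i + κ i * (2 : ℝ) ^ m) (t i + (κ i + 1) * (2 : ℝ) ^ m) := by
  ext y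
  have h2 : (0 : ℝ) < 2 ^ m := by positivity
  simp only [cube, idx, funext_iff, Set.mem_ofPred_eq, Set.mem_univ_pi,
    floor_eq_iff_mem_Ico h2]

lemma volume_cube {N : ℕ} (t : Fin N → ℝ) (m : ℤ) (κ : Fin N → ℤ) :
    volume (cube t m κ) = ENNReal.ofReal (((2 : ℝ) ^ m) ^ N) := by
  rw [cube_eq_pi, Real.volume_pi_Ico]
  have : ∀ i, t i + (κ i + 1) * (2 : ℝ) ^ m - (t i + κ i * (2 : ℝ) ^ m) = 2 ^ m := fun i => by ring
  simp only [this, Finset.prod_const, Finset.card_univ, Fintype.card_fin]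
  rw [ENNReal.ofReal_pow (by positivity)]

lemma norm_sub_le_of_idx_eq {N : ℕ} {t : Fin N → ℝ} {m : ℤ} {x y : Fin N → ℝ}
    (h : idx t m x = idx t m y) : ‖x - y‖ ≤ 2 ^ m := by
  have h2 : (0 : ℝ) < 2 ^ m := by positivity
  rw [pi_norm_le_iff_of_nonneg h2.le]
  intro i
  have hx := (floor_eq_iff_mem_Ico (t := t i) (y := x i) h2 _).1 (congrFun h i)
  have hy := (floor_eq_iff_mem_Ico (t := t i) (y := y i) h2 _).1 rfl
  simp only [idx, Set.mem_Ico] at hx hy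
  rw [Real.norm_eq_abs, Pi.sub_apply, abs_le]
  constructor <;> linarith [hx.1, hx.2, hy.1, hy.2]

lemma idx_eq_of_le {N : ℕ} {t : Fin N → ℝ} {k m : ℤ} (hkm : k ≤ m) {x y : Fin N → ℝ}
    (h : idx t k x = idx t k y) : idx t m x = idx t m y := by
  obtain ⟨j, rfl⟩ := Int.le.dest hkm
  have key : ∀ z : Fin N → ℝ, ∀ i, idx t (k + j) z i = idx t k z i / ((2 ^ j : ℕ) : ℤ) := by
    intro z i
    simp only [idx]
    rw [← Int.floor_div_natCast]
    congr 1
    rw [zpow_add₀ two_ne_zero, zpow_natCast]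
    push_cast
    rw [div_div]
  ext i
  rw [key, key, h]

lemma avg_eq {N : ℕ} (t : Fin N → ℝ) (k : ℤ) (f : (Fin N → ℝ) → ℝ) (x : Fin N → ℝ) :
    avg (fun _ => t) k f x = (∫ y in cube t k (idx t k x), f y) / ((2 : ℝ) ^ k) ^ N := by
  rw [avg, dcube_eq]

lemma avg_congr {N : ℕ} {t : Fin N → ℝ} {k : ℤ} {f : (Fin N → ℝ) → ℝ} {x y : Fin N → ℝ}
    (h : idx t k x = idx t k y) : avg (fun _ => t) k f x = avg (fun _ => t) k f y := by
  rw [avg_eq, avg_eq, h]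

lemma mdiff_congr {N : ℕ} {t : Fin N → ℝ} {k : ℤ} {f : (Fin N → ℝ) → ℝ} {x y : Fin N → ℝ}
    (h : idx t (k - 1) x = idx t (k - 1) y) :
    mdiff (fun _ => t) k f x = mdiff (fun _ => t) k f y := by
  rw [mdiff, mdiff, avg_congr h, avg_congr (idx_eq_of_le (by linarith) h)]

lemma avg_of_const {N : ℕ} {t : Fin N → ℝ} {k : ℤ} {f : (Fin N → ℝ) → ℝ} {x : Fin N → ℝ}
    (h : ∀ y, idx t k y = idx t k x → f y = f x) : avg (fun _ => t) k f x = f x := by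
  rw [avg_eq, setIntegral_congr_fun (g := fun _ => f x) (measurableSet_cube _ _ _) fun y hy =>
      h y hy]
  have h2 : (0 : ℝ) < ((2 : ℝ) ^ k) ^ N := by positivity
  rw [setIntegral_const, Measure.real, volume_cube, ENNReal.toReal_ofReal h2.le, smul_eq_mul]
  field_simp

lemma abs_avg_le {N : ℕ} (t : Fin N → ℝ) (k : ℤ) {f : (Fin N → ℝ) → ℝ} (hf : Integrable f)
    (x : Fin N → ℝ) : |avg (fun _ => t) k f x| ≤ (∫ y, |f y|) / ((2 : ℝ) ^ k) ^ N := by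
  have h2 : (0 : ℝ) < ((2 : ℝ) ^ k) ^ N := by positivity
  rw [avg_eq, abs_div, abs_of_pos h2]
  gcongr
  exact (abs_integral_le_integral_abs).trans
    (setIntegral_le_integral hf.abs (ae_of_all _ fun _ => abs_nonneg _))

lemma abs_avg_sub_le {N : ℕ} {t : Fin N → ℝ} {k : ℤ} {g : (Fin N → ℝ) → ℝ} {x : Fin N → ℝ} {A : ℝ}
    (hg : IntegrableOn g (cube t k (idx t k x)))
    (h : ∀ y, idx t k y = idx t k x → |g y - g x| ≤ A) : |avg (fun _ => t) k g x - g x| ≤ A := by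
  have h2 : (0 : ℝ) < ((2 : ℝ) ^ k) ^ N := by positivity
  have hv : volume.real (cube t k (idx t k x)) = ((2 : ℝ) ^ k) ^ N := by
    rw [Measure.real, volume_cube, ENNReal.toReal_ofReal h2.le]
  have hfin : volume (cube t k (idx t k x)) < ∞ := by rw [volume_cube]; exact ENNReal.ofReal_lt_top
  have h3 : avg (fun _ => t) k g x - g x =
      (∫ y in cube t k (idx t k x), (g y - g x)) / ((2 : ℝ) ^ k) ^ N := by
    rw [integral_sub hg (integrableOn_const hfin.ne), avg_eq, setIntegral_const, hv, smul_eq_mul]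
    field_simp
  rw [h3, abs_div, abs_of_pos h2, div_le_iff₀ h2, ← hv]
  exact norm_setIntegral_le_of_norm_le_const (f := fun y => g y - g x) hfin (fun y hy => h y hy)

lemma measurableSet_idx_eq {N : ℕ} (t : Fin N → ℝ) (k : ℤ) :
    MeasurableSet {p : (Fin N → ℝ) × (Fin N → ℝ) | idx t k p.2 = idx t k p.1} :=
  measurableSet_eq_fun ((measurable_idx t k).comp measurable_snd)
    ((measurable_idx t k).comp measurable_fst)

lemma avg_eq_integral {N : ℕ} (t : Fin N → ℝ) (k : ℤ) (f : (Fin N → ℝ) → ℝ) (x : Fin N → ℝ) :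
    avg (fun _ => t) k f x =
      (∫ y, {p : (Fin N → ℝ) × (Fin N → ℝ) | idx t k p.2 = idx t k p.1}.indicator 1 (x, y) * f y) /
        ((2 : ℝ) ^ k) ^ N := by
  rw [avg_eq, ← integral_indicator (measurableSet_cube _ _ _)]
  congr 2 with y
  by_cases h : idx t k y = idx t k x <;> simp [Set.indicator, mem_cube, h]

lemma measurable_avg {N : ℕ} {Ω : Type*} [MeasurableSpace Ω] (t : Fin N → ℝ) (k : ℤ)
    {h : Ω → (Fin N → ℝ) → ℝ} (hh : Measurable fun p : Ω × (Fin N → ℝ) => h p.1 p.2) :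
    Measurable fun p : Ω × (Fin N → ℝ) => avg (fun _ => t) k (h p.1) p.2 := by
  simp_rw [avg_eq_integral]
  refine Measurable.div_const ?_ _
  have : Measurable fun q : (Ω × (Fin N → ℝ)) × (Fin N → ℝ) =>
      {p : (Fin N → ℝ) × (Fin N → ℝ) | idx t k p.2 = idx t k p.1}.indicator
          (1 : (Fin N → ℝ) × (Fin N → ℝ) → ℝ) (q.1.2, q.2) *
        h q.1.1 q.2 := by
    refine Measurable.mul ?_ (hh.comp (by fun_prop : Measurable fun q : (Ω × (Fin N → ℝ)) ×
        (Fin N → ℝ) => (q.1.1, q.2)))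
    exact (measurable_one.indicator (measurableSet_idx_eq t k)).comp
        (by fun_prop : Measurable fun q : (Ω × (Fin N → ℝ)) × (Fin N → ℝ) => (q.1.2, q.2))
  exact this.stronglyMeasurable.integral_prod_right'.measurable

lemma measurable_mdiff {N : ℕ} {Ω : Type*} [MeasurableSpace Ω] (t : Fin N → ℝ) (k : ℤ)
    {h : Ω → (Fin N → ℝ) → ℝ} (hh : Measurable fun p : Ω × (Fin N → ℝ) => h p.1 p.2) :
    Measurable fun p : Ω × (Fin N → ℝ) => mdiff (fun _ => t) k (h p.1) p.2 :=
  (measurable_avg t (k - 1) hh).sub (measurable_avg t k hh)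

/-- Averages over cubes, for nonnegative functions, are symmetric. -/
lemma lintegral_mul_cube_swap {N : ℕ} (t : Fin N → ℝ) (k : ℤ) {f g : (Fin N → ℝ) → ℝ≥0∞}
    (hf : Measurable f) (hg : Measurable g) :
    ∫⁻ z, f z * ∫⁻ y in cube t k (idx t k z), g y = ∫⁻ y, g y * ∫⁻ z in cube t k (idx t k y),
        f z := by
  set S := {p : (Fin N → ℝ) × (Fin N → ℝ) | idx t k p.2 = idx t k p.1} with hS
  have hm : Measurable fun p : (Fin N → ℝ) × (Fin N → ℝ) =>
      S.indicator (fun p => f p.1 * g p.2) p :=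
    ((hf.comp measurable_fst).mul (hg.comp measurable_snd)).indicator (measurableSet_idx_eq t k)
  have h1 : ∀ z, f z * ∫⁻ y in cube t k (idx t k z), g y =
      ∫⁻ y, S.indicator (fun p => f p.1 * g p.2) (z, y) := by
    intro z
    rw [← lintegral_indicator (measurableSet_cube _ _ _), ← lintegral_const_mul _
      (hg.indicator (measurableSet_cube _ _ _))]
    congr with y
    by_cases h : idx t k y = idx t k z <;> simp [Set.indicator, mem_cube, hS, h]
  have h2 : ∀ y, g y * ∫⁻ z in cube t k (idx t k y), f z =
      ∫⁻ z, S.indicator (fun p => f p.1 * g p.2) (z, y) := by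
    intro y
    rw [← lintegral_indicator (measurableSet_cube _ _ _), ← lintegral_const_mul _
      (hf.indicator (measurableSet_cube _ _ _))]
    congr with z
    by_cases h : idx t k z = idx t k y
    · simp [Set.indicator, mem_cube, hS, h, mul_comm]
    · simp [Set.indicator, mem_cube, hS, h, Ne.symm h]
  simp_rw [h1, h2]
  exact lintegral_lintegral_swap hm.aemeasurable

lemma integral_avg_mul_swap {N : ℕ} (t : Fin N → ℝ) (k : ℤ) {h g : (Fin N → ℝ) → ℝ} {A : ℝ}
    (hh : Integrable h) (hg : Measurable g) (hA : ∀ z, |g z| ≤ A) :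
    Integrable (avg (fun _ => t) k h) ∧
    ∫ z, g z * avg (fun _ => t) k h z = ∫ z, avg (fun _ => t) k g z * h z := by
  set S := {p : (Fin N → ℝ) × (Fin N → ℝ) | idx t k p.2 = idx t k p.1} with hS
  have hSm : MeasurableSet S := measurableSet_idx_eq t k
  have hSs : ∀ y z, S.indicator (1 : (Fin N → ℝ) × (Fin N → ℝ) → ℝ) (z, y) =
      S.indicator 1 (y, z) := by
    intro y z
    by_cases h : idx t k z = idx t k y
    · simp [Set.indicator, hS, h]
    · simp [Set.indicator, hS, h, Ne.symm h]
  have h1 : Integrable (fun p : (Fin N → ℝ) × (Fin N → ℝ) =>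
      S.indicator (1 : (Fin N → ℝ) × (Fin N → ℝ) → ℝ) (p.1, p.2) * h p.2)
      (volume.prod volume) := by
    have hm : AEStronglyMeasurable (fun p : (Fin N → ℝ) × (Fin N → ℝ) =>
        S.indicator (1 : (Fin N → ℝ) × (Fin N → ℝ) → ℝ) (p.1, p.2) * h p.2) (volume.prod volume) :=
      (measurable_one.indicator hSm).aestronglyMeasurable.mul hh.aestronglyMeasurable.comp_snd
    rw [integrable_prod_iff' hm]
    have hfin : ∀ y, volume (cube t k (idx t k y)) < ∞ := fun y => by
      rw [volume_cube]; exact ENNReal.ofReal_lt_top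
    have e : ∀ y z, S.indicator (1 : (Fin N → ℝ) × (Fin N → ℝ) → ℝ) (z, y) =
        (cube t k (idx t k y)).indicator (fun _ => (1 : ℝ)) z := by
      intro y z
      rw [hSs]
      by_cases h : idx t k z = idx t k y <;> simp [Set.indicator, hS, mem_cube, h]
    refine ⟨ae_of_all _ fun y => ?_, ?_⟩
    · simp only [e]
      exact ((integrable_indicator_iff (measurableSet_cube _ _ _)).2
        (integrableOn_const (hfin y).ne)).mul_const _
    · have : ∀ y, ∫ z, ‖S.indicator (1 : (Fin N → ℝ) × (Fin N → ℝ) → ℝ) (z, y) * h y‖ =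
          ((2 : ℝ) ^ k) ^ N * ‖h y‖ := by
        intro y
        simp only [norm_mul, e]
        rw [integral_mul_const]
        congr 1
        have h2 : (0 : ℝ) < ((2 : ℝ) ^ k) ^ N := by positivity
        have : ∀ z, ‖(cube t k (idx t k y)).indicator (fun _ => (1 : ℝ)) z‖ =
          (cube t k (idx t k y)).indicator (fun _ => (1 : ℝ)) z := fun z => by
            rw [Real.norm_of_nonneg (Set.indicator_nonneg (by simp) _)]
        simp only [this]
        rw [integral_indicator (measurableSet_cube _ _ _), setIntegral_const, Measure.real,
          volume_cube, ENNReal.toReal_ofReal h2.le]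
        simp
      simp only [this]
      exact hh.norm.const_mul _
  constructor
  · have : avg (fun _ => t) k h = fun x => (∫ y, S.indicator (1 : (Fin N → ℝ) × (Fin N → ℝ) → ℝ)
        (x, y) * h y) / ((2 : ℝ) ^ k) ^ N := by
      ext x; rw [avg_eq_integral]
    rw [this]
    exact h1.integral_prod_left.div_const _
  · have h3 : Integrable (fun p : (Fin N → ℝ) × (Fin N → ℝ) =>
        g p.1 * (S.indicator (1 : (Fin N → ℝ) × (Fin N → ℝ) → ℝ) (p.1, p.2) * h p.2))
            (volume.prod volume) :=
      h1.bdd_mul (c := A) (hg.comp measurable_fst).aestronglyMeasurable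
        (ae_of_all _ fun p => hA p.1)
    simp_rw [avg_eq_integral, ← mul_div_assoc, div_mul_eq_mul_div]
    rw [integral_div, integral_div]
    congr 1
    simp_rw [← integral_const_mul, ← integral_mul_const]
    rw [integral_integral_swap h3]
    congr with y
    congr with z
    rw [← hS, hSs y z]; ring

lemma integrable_avg {N : ℕ} (t : Fin N → ℝ) (k : ℤ) {h : (Fin N → ℝ) → ℝ} (hh : Integrable h) :
    Integrable (avg (fun _ => t) k h) :=
  (integral_avg_mul_swap t k (g := 0) (A := 0) hh measurable_zero (by simp)).1

lemma integrable_mdiff {N : ℕ} (t : Fin N → ℝ) (k : ℤ) {h : (Fin N → ℝ) → ℝ} (hh : Integrable h) :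
    Integrable (mdiff (fun _ => t) k h) := (integrable_avg t (k-1) hh).sub (integrable_avg t k hh)

lemma setIntegral_cube_avg {N : ℕ} (t : Fin N → ℝ) {k m : ℤ} (hkm : k ≤ m) (κ : Fin N → ℤ)
    {h : (Fin N → ℝ) → ℝ} (hh : Integrable h) :
    ∫ z in cube t m κ, avg (fun _ => t) k h z = ∫ z in cube t m κ, h z := by
  have := (integral_avg_mul_swap t k (g := (cube t m κ).indicator 1) (A := 1) hh
    (measurable_one.indicator (measurableSet_cube _ _ _)) (fun z => by
      by_cases hz : z ∈ cube t m κ <;> simp [hz])).2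
  have e : ∀ z, avg (fun _ => t) k ((cube t m κ).indicator 1) z = (cube t m κ).indicator 1 z := by
    intro z
    refine avg_of_const fun y hy => ?_
    have := idx_eq_of_le hkm hy
    simp [Set.indicator, mem_cube, this]
  simp_rw [e] at this
  rw [← integral_indicator (measurableSet_cube _ _ _), ← integral_indicator
      (measurableSet_cube _ _ _)]
  calc _ = _ := by congr with z; by_cases hz : z ∈ cube t m κ <;> simp [hz]
    _ = _ := this
    _ = _ := by congr with z; by_cases hz : z ∈ cube t m κ <;> simp [hz]

lemma setIntegral_cube_mdiff {N : ℕ} (t : Fin N → ℝ) (m : ℤ) (κ : Fin N → ℤ)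
    {h : (Fin N → ℝ) → ℝ} (hh : Integrable h) :
    ∫ z in cube t m κ, mdiff (fun _ => t) m h z = 0 := by
  simp only [mdiff]
  rw [integral_sub (integrable_avg t _ hh).integrableOn (integrable_avg t _ hh).integrableOn,
    setIntegral_cube_avg t (by linarith) κ hh, setIntegral_cube_avg t le_rfl κ hh, sub_self]

/-! ### Estimates for a single scale -/

lemma sq_lintegral_mul_le {α : Type*} [MeasurableSpace α] (μ : Measure α) {f g : α → ℝ≥0∞}
    (hf : AEMeasurable f μ) (hg : AEMeasurable g μ) :
    (∫⁻ a, f a * g a ∂μ) ^ 2 ≤ (∫⁻ a, f a ^ 2 ∂μ) * ∫⁻ a, g a ^ 2 ∂μ := by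
  have h := ENNReal.lintegral_mul_le_Lp_mul_Lq μ (p := 2) (q := 2)
    (Real.holderConjugate_iff.2 (by norm_num)) hf hg
  simp only [Pi.mul_apply, ENNReal.rpow_two] at h
  calc _ ≤ _ := pow_le_pow_left' h 2
    _ = _ := by
      rw [mul_pow, ← ENNReal.rpow_two, ← ENNReal.rpow_two, ← ENNReal.rpow_mul,
        ← ENNReal.rpow_mul]
      norm_num

lemma sq_lintegral_mul_le' {α : Type*} [MeasurableSpace α] (μ : Measure α) {w f : α → ℝ≥0∞}
    (hw : AEMeasurable w μ) (hf : AEMeasurable f μ) :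
    (∫⁻ a, w a * f a ∂μ) ^ 2 ≤ (∫⁻ a, w a ∂μ) * ∫⁻ a, w a * f a ^ 2 ∂μ := by
  have e : ∀ a : ℝ≥0∞, a ^ (1/2 : ℝ) * a ^ (1/2 : ℝ) = a := fun a => by
    rw [← ENNReal.rpow_add_of_nonneg _ _ (by norm_num) (by norm_num)]; norm_num
  have h := sq_lintegral_mul_le μ (f := fun a => w a ^ (1/2 : ℝ))
    (g := fun a => w a ^ (1/2 : ℝ) * f a) (hw.pow_const _) ((hw.pow_const _).mul hf)
  simpa only [mul_pow, pow_two (_ ^ (1/2 : ℝ)), ← mul_assoc, e] using h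

/-- Schur's test for convolution operators. -/
lemma lintegral_conv_sq_le {N : ℕ} {w f : (Fin N → ℝ) → ℝ≥0∞} (hw : Measurable w)
    (hf : Measurable f) :
    ∫⁻ x, (∫⁻ z, w (x - z) * f z) ^ 2 ≤ (∫⁻ v, w v) ^ 2 * ∫⁻ z, f z ^ 2 := by
  have hw2 : Measurable fun p : (Fin N → ℝ) × (Fin N → ℝ) => w (p.1 - p.2) :=
    hw.comp (measurable_fst.sub measurable_snd)
  calc _ ≤ ∫⁻ x, (∫⁻ v, w v) * ∫⁻ z, w (x - z) * f z ^ 2 := by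
        refine lintegral_mono fun x => ?_
        refine (sq_lintegral_mul_le' volume (w := fun z => w (x - z)) (by fun_prop)
            hf.aemeasurable).trans ?_
        rw [lintegral_sub_left_eq_self w x]
    _ = (∫⁻ v, w v) * ∫⁻ z, ∫⁻ x, w (x - z) * f z ^ 2 := by
        rw [lintegral_const_mul, lintegral_lintegral_swap]
        · exact (hw2.mul ((hf.pow_const 2).comp measurable_snd)).aemeasurable
        · exact (hw2.mul ((hf.pow_const 2).comp measurable_snd)).lintegral_prod_right'
    _ = _ := by
        rw [pow_two, mul_assoc]
        congr 1
        rw [← lintegral_const_mul _ (hf.pow_const 2)]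
        refine lintegral_congr fun z => ?_
        rw [lintegral_mul_const _ (by fun_prop), lintegral_sub_right_eq_self w z]

/-- Convolution with the gradient of the Poisson kernel. -/
def Tk {N : ℕ} (d : Fin (N + 1)) (s : ℝ) (b : (Fin N → ℝ) → ℝ) (x : Fin N → ℝ) : ℝ :=
  ∫ z, kd d (x - z) s * b z

lemma wt_le_of_zero {N : ℕ} {β : ℝ} (hβ : 0 ≤ β) {s : ℝ} (hs : 0 < s) (v : Fin N → ℝ) :
    wt β s v ≤ wt β s (0 : Fin N → ℝ) := by
  unfold wt
  refine Real.rpow_le_rpow_of_nonpos ?_ ?_ ?_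
  · simpa using hs
  · simp
  · have : (0:ℝ) ≤ N := by positivity
    linarith

lemma measurable_kd_sub {N : ℕ} (d : Fin (N + 1)) {s : ℝ} (hs : 0 < s) (x : Fin N → ℝ) :
    Measurable fun z => kd d (x - z) s :=
  (continuous_kd d hs).measurable.comp (measurable_const.sub measurable_id)

lemma exists_kd_bound (N : ℕ) {s : ℝ} (hs : 0 < s) :
    ∃ A : ℝ, ∀ (d : Fin (N + 1)) (v : Fin N → ℝ), |kd d v s| ≤ A := by
  obtain ⟨C, hC, h⟩ := abs_kd_le_wt N
  exact ⟨C * wt 1 s (0 : Fin N → ℝ), fun d v => (h d v s hs).trans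
    (mul_le_mul_of_nonneg_left (wt_le_of_zero zero_le_one hs v) hC.le)⟩

lemma integrable_kd_mul {N : ℕ} (d : Fin (N + 1)) {s : ℝ} (hs : 0 < s) (x : Fin N → ℝ)
    {b : (Fin N → ℝ) → ℝ} (hb : Integrable b) : Integrable fun z => kd d (x - z) s * b z := by
  obtain ⟨A, hA⟩ := exists_kd_bound N hs
  exact hb.bdd_mul (c := A) (measurable_kd_sub d hs x).aestronglyMeasurable
    (ae_of_all _ fun z => hA d _)

lemma abs_avg_le_of_bound {N : ℕ} (t : Fin N → ℝ) (k : ℤ) {g : (Fin N → ℝ) → ℝ} {A : ℝ}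
    (hA : ∀ z, |g z| ≤ A) (x : Fin N → ℝ) : |avg (fun _ => t) k g x| ≤ A := by
  have h2 : (0 : ℝ) < ((2 : ℝ) ^ k) ^ N := by positivity
  have hfin : volume (cube t k (idx t k x)) < ∞ := by rw [volume_cube]; exact ENNReal.ofReal_lt_top
  have := norm_setIntegral_le_of_norm_le_const (f := g) hfin (fun y _ => hA y)
  rw [Measure.real, volume_cube, ENNReal.toReal_ofReal h2.le] at this
  rw [avg_eq, abs_div, abs_of_pos h2, div_le_iff₀ h2]
  exact this

lemma measurable_avg_single {N : ℕ} (t : Fin N → ℝ) (m : ℤ) {g : (Fin N → ℝ) → ℝ}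
    (hg : Measurable g) : Measurable (avg (fun _ => t) m g) := by
  have h1 := measurable_avg t m (Ω := Unit) (h := fun _ => g) (hg.comp measurable_snd)
  have h2 : Measurable fun z : Fin N → ℝ => ((), z) := measurable_const.prodMk measurable_id
  have h3 := h1.comp h2
  simp only [Function.comp_def] at h3
  exact h3

lemma abs_integral_mul_le_of_cancel {N : ℕ} (t : Fin N → ℝ) (m : ℤ) {g b K : (Fin N → ℝ) → ℝ}
    {A : ℝ} (hgm : Measurable g) (hA : ∀ z, |g z| ≤ A) (hb : Integrable b)
    (hb0 : ∀ κ, ∫ z in cube t m κ, b z = 0) (hK : ∀ z, 0 ≤ K z)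
    (h : ∀ z, b z ≠ 0 → ∀ y, idx t m y = idx t m z → |g y - g z| ≤ K z) :
    ENNReal.ofReal |∫ z, g z * b z| ≤ ∫⁻ z, ENNReal.ofReal (K z) * ENNReal.ofReal |b z| := by
  have hb1 : ∀ z, avg (fun _ => t) m b z = 0 := fun z => by rw [avg_eq, hb0, zero_div]
  have hsw := (integral_avg_mul_swap t m hb hgm hA).2
  simp only [hb1, mul_zero, integral_zero] at hsw
  have hgb : Integrable fun z => g z * b z :=
    hb.bdd_mul (c := A) hgm.aestronglyMeasurable (ae_of_all _ fun z => hA z)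
  have ham := measurable_avg_single t m hgm
  have hagb : Integrable fun z => avg (fun _ => t) m g z * b z :=
    hb.bdd_mul (c := A) ham.aestronglyMeasurable
      (ae_of_all _ fun z => abs_avg_le_of_bound t m hA z)
  have hdiff : Integrable fun z => (g z - avg (fun _ => t) m g z) * b z := by
    simp only [sub_mul]; exact hgb.sub hagb
  have hT : ∫ z, g z * b z = ∫ z, (g z - avg (fun _ => t) m g z) * b z := by
    simp only [sub_mul]
    rw [integral_sub hgb hagb, ← hsw, sub_zero]
  have hle : |∫ z, g z * b z| ≤ ∫ z, |(g z - avg (fun _ => t) m g z) * b z| := by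
    rw [hT]; exact abs_integral_le_integral_abs
  refine (ENNReal.ofReal_le_ofReal hle).trans ?_
  rw [ofReal_integral_eq_lintegral_ofReal hdiff.abs (ae_of_all _ fun z => abs_nonneg _)]
  refine lintegral_mono fun z => ?_
  rw [← ENNReal.ofReal_mul (hK z)]
  refine ENNReal.ofReal_le_ofReal ?_
  rw [abs_mul]
  by_cases hz : b z = 0
  · simp [hz]
  refine mul_le_mul_of_nonneg_right ?_ (abs_nonneg _)
  rw [abs_sub_comm]
  have hfin : volume (cube t m (idx t m z)) < ∞ := by
    rw [volume_cube]; exact ENNReal.ofReal_lt_top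
  refine abs_avg_sub_le ?_ (h z hz)
  exact Measure.integrableOn_of_bounded (M := A) hfin.ne hgm.aestronglyMeasurable
    (ae_of_all _ fun z => hA z)

/-- The gain coming from the cancellation of `b` on the cubes of scale `2^m`. -/
lemma abs_Tk_le_of_far (N : ℕ) : ∃ C : ℝ, 0 < C ∧ ∀ (d : Fin (N + 1)) (t : Fin N → ℝ) (m : ℤ)
    (s : ℝ) (x : Fin N → ℝ) (b : (Fin N → ℝ) → ℝ), 0 < s → Integrable b →
    (∀ κ, ∫ z in cube t m κ, b z = 0) → (∀ z, b z ≠ 0 → 2 * (2 : ℝ) ^ m ≤ s + ‖x - z‖) →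
    ENNReal.ofReal |Tk d s b x| ≤
      ∫⁻ z, ENNReal.ofReal (C * (2 : ℝ) ^ m * wt 2 s (x - z)) * ENNReal.ofReal |b z| := by
  obtain ⟨C, hC, h⟩ := abs_kd_sub_le N
  refine ⟨C, hC, fun d t m s x b hs hb hb0 hfar => ?_⟩
  obtain ⟨A, hA⟩ := exists_kd_bound N hs
  refine abs_integral_mul_le_of_cancel t m (measurable_kd_sub d hs x) (fun z => hA d _) hb hb0
    (fun z => ?_) fun z hz y hy => ?_
  · have := wt_nonneg 2 hs (x - z)
    positivity
  · have h1 : ‖(x - y) - (x - z)‖ ≤ 2 ^ m := by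
      have := norm_sub_le_of_idx_eq hy.symm
      simpa using this
    refine (h d (x - z) (x - y) s hs (by linarith [hfar z hz])).trans ?_
    have := wt_nonneg 2 hs (x - z)
    gcongr

lemma ofReal_sq_eq (r : ℝ) : ENNReal.ofReal (r ^ 2) = ENNReal.ofReal |r| ^ 2 := by
  rw [← ENNReal.ofReal_pow (abs_nonneg _), sq_abs]

lemma lintegral_Tk_sq_le_large (N : ℕ) : ∃ C : ℝ, 0 < C ∧
    ∀ (d : Fin (N + 1)) (t : Fin N → ℝ) (m : ℤ)
    (s : ℝ) (b : (Fin N → ℝ) → ℝ), 2 * (2 : ℝ) ^ m ≤ s → Measurable b → Integrable b →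
    (∀ κ, ∫ z in cube t m κ, b z = 0) →
    ∫⁻ x, ENNReal.ofReal (Tk d s b x ^ 2) ≤
      ENNReal.ofReal (C * ((2 : ℝ) ^ m / s) ^ 2 * s ^ (-2 : ℝ)) * ∫⁻ z,
          ENNReal.ofReal (b z ^ 2) := by
  obtain ⟨C, hC, h⟩ := abs_Tk_le_of_far N
  have hW := wtI_lt_top N (β := 2) two_pos
  refine ⟨C ^ 2 * (wtI N 2).toReal ^ 2 + 1, by positivity, fun d t m s b hms hbm hb hb0 => ?_⟩
  have h2 : (0 : ℝ) < 2 ^ m := by positivity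
  have hs : 0 < s := by linarith
  calc _ ≤ ∫⁻ x, (∫⁻ z, ENNReal.ofReal (C * (2 : ℝ) ^ m * wt 2 s (x - z)) *
      ENNReal.ofReal |b z|) ^ 2 := by
        refine lintegral_mono fun x => ?_
        rw [ofReal_sq_eq]
        exact pow_le_pow_left' (h d t m s x b hs hb hb0 fun z _ => by
          linarith [norm_nonneg (x - z)]) 2
    _ ≤ (∫⁻ v : Fin N → ℝ, ENNReal.ofReal (C * (2 : ℝ) ^ m * wt 2 s v)) ^ 2 * ∫⁻ z,
        ENNReal.ofReal |b z| ^ 2 :=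
        lintegral_conv_sq_le (w := fun v => ENNReal.ofReal (C * (2 : ℝ) ^ m * wt 2 s v))
          (((measurable_wt_right 2 s).const_mul _).ennreal_ofReal) hbm.abs.ennreal_ofReal
    _ ≤ _ := by
        simp_rw [ofReal_sq_eq (b _)]
        refine mul_le_mul_left ?_ _
        have e : ∫⁻ v : Fin N → ℝ, ENNReal.ofReal (C * (2 : ℝ) ^ m * wt 2 s v) =
            ENNReal.ofReal (C * 2 ^ m * (s ^ (-2 : ℝ) * (wtI N 2).toReal)) := by
          simp_rw [ENNReal.ofReal_mul (show 0 ≤ C * (2 : ℝ) ^ m by positivity)]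
          rw [lintegral_const_mul _ (measurable_wt_right 2 s).ennreal_ofReal, lintegral_wt 2 hs,
            ENNReal.ofReal_mul (p := s ^ (-2 : ℝ)) (by positivity), ENNReal.ofReal_toReal hW.ne]
        rw [e, ← ENNReal.ofReal_pow (by positivity)]
        refine ENNReal.ofReal_le_ofReal ?_
        have e2 : s ^ (-2 : ℝ) = 1 / s ^ 2 := by
          rw [Real.rpow_neg hs.le, Real.rpow_two, one_div]
        rw [e2]
        have : C ^ 2 * (wtI N 2).toReal ^ 2 ≤ C ^ 2 * (wtI N 2).toReal ^ 2 + 1 := by linarith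
        calc _ = C ^ 2 * (wtI N 2).toReal ^ 2 * (2 ^ m / s) ^ 2 * (1 / s ^ 2) := by
              field_simp
          _ ≤ _ := by gcongr

lemma volume_Ico_diff_shift_le {a ℓ v r : ℝ} (hv : |v| ≤ r) :
    volume {x | x ∈ Set.Ico a (a + ℓ) ∧ x - v ∉ Set.Ico a (a + ℓ)} ≤ ENNReal.ofReal (2 * r) := by
  have hr : 0 ≤ r := (abs_nonneg v).trans hv
  have hsub : {x | x ∈ Set.Ico a (a + ℓ) ∧ x - v ∉ Set.Ico a (a + ℓ)} ⊆
      Set.Icc a (a + r) ∪ Set.Icc (a + ℓ - r) (a + ℓ) := by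
    rintro x ⟨⟨h1, h2⟩, h3⟩
    rw [abs_le] at hv
    by_cases h4 : x ≤ a + r
    · exact Or.inl ⟨h1, h4⟩
    · refine Or.inr ⟨?_, h2.le⟩
      by_contra! h5
      exact h3 ⟨by linarith, by linarith⟩
  refine (measure_mono hsub).trans ((measure_union_le _ _).trans ?_)
  rw [Real.volume_Icc, Real.volume_Icc, ← ENNReal.ofReal_add (by linarith) (by linarith)]
  exact ENNReal.ofReal_le_ofReal (by linarith)

/-- The measure of the set of points of a cube that are translated out of it. -/
lemma volume_cube_shift_le {N : ℕ} (t : Fin N → ℝ) (m : ℤ) (κ : Fin N → ℤ) (v : Fin N → ℝ) :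
    volume {x | idx t m x = κ ∧ idx t m (x - v) ≠ κ} ≤
      ENNReal.ofReal ((2 * N + 1) * ((2 : ℝ) ^ m) ^ N * (‖v‖ / 2 ^ m) ^ (1 / 2 : ℝ)) := by
  have h2 : (0 : ℝ) < 2 ^ m := by positivity
  set ℓ : ℝ := 2 ^ m with hℓ
  rcases le_total ℓ ‖v‖ with hv | hv
  · refine (measure_mono (t := cube t m κ) fun x hx => hx.1).trans ?_
    rw [volume_cube, ← hℓ]
    refine ENNReal.ofReal_le_ofReal ?_
    have h1 : 1 ≤ (‖v‖ / ℓ) ^ (1 / 2 : ℝ) :=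
      Real.one_le_rpow ((one_le_div h2).2 hv) (by norm_num)
    have h3 : 0 < ℓ ^ N := by positivity
    have h4 : (0 : ℝ) ≤ N := by positivity
    calc ℓ ^ N = 1 * ℓ ^ N * 1 := by ring
      _ ≤ _ := by gcongr; linarith
  · set A : Fin N → Fin N → Set ℝ := fun i j =>
      if j = i then {x | x ∈ Set.Ico (t j + κ j * ℓ) (t j + κ j * ℓ + ℓ) ∧
        x - v j ∉ Set.Ico (t j + κ j * ℓ) (t j + κ j * ℓ + ℓ)}
      else Set.Ico (t j + κ j * ℓ) (t j + κ j * ℓ + ℓ) with hA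
    have e : ∀ j, t j + (κ j + 1) * ℓ = t j + κ j * ℓ + ℓ := fun j => by ring
    have hsub : {x | idx t m x = κ ∧ idx t m (x - v) ≠ κ} ⊆ ⋃ i, Set.univ.pi (A i) := by
      rintro x ⟨hx, hxv⟩
      rw [← mem_cube, cube_eq_pi, Set.mem_univ_pi] at hx
      obtain ⟨i, hi⟩ := Function.ne_iff.1 hxv
      rw [Set.mem_iUnion]
      refine ⟨i, fun j _ => ?_⟩
      have hxj := hx j
      rw [← hℓ, e] at hxj
      by_cases hj : j = i
      · subst hj
        simp only [hA, if_true, Set.mem_ofPred_eq]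
        refine ⟨hxj, fun hc => hi ?_⟩
        rw [← e, ← floor_eq_iff_mem_Ico h2] at hc
        exact hc
      · simp only [hA, if_neg hj]; exact hxj
    have hvol : ∀ i, volume (Set.univ.pi (A i)) ≤ ENNReal.ofReal (2 * (‖v‖ / ℓ) * ℓ ^ N) := by
      intro i
      rw [volume_pi_pi]
      calc ∏ j, volume (A i j) ≤ ∏ j, (if j = i then ENNReal.ofReal (2 * (‖v‖ / ℓ)) else 1) *
            ENNReal.ofReal ℓ := by
            refine Finset.prod_le_prod' fun j _ => ?_
            by_cases hj : j = i
            · simp only [hA, if_pos hj]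
              refine (volume_Ico_diff_shift_le (norm_le_pi_norm v j)).trans ?_
              rw [← ENNReal.ofReal_mul (by positivity)]
              refine ENNReal.ofReal_le_ofReal (le_of_eq ?_)
              field_simp
            · simp only [hA, if_neg hj, one_mul, Real.volume_Ico]
              refine ENNReal.ofReal_le_ofReal (le_of_eq ?_)
              ring
        _ = _ := by
            rw [Finset.prod_mul_distrib, Finset.prod_ite_eq' Finset.univ i]
            simp only [Finset.mem_univ, if_true, Finset.prod_const, Finset.card_univ,
              Fintype.card_fin]
            rw [← ENNReal.ofReal_pow h2.le,
              ← ENNReal.ofReal_mul (p := 2 * (‖v‖ / ℓ)) (by positivity)]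
    refine (measure_mono hsub).trans ((measure_iUnion_le _).trans ?_)
    rw [tsum_fintype]
    refine (Finset.sum_le_sum fun i _ => hvol i).trans ?_
    rw [Finset.sum_const, Finset.card_univ, Fintype.card_fin, nsmul_eq_mul,
      ← ENNReal.ofReal_natCast, ← ENNReal.ofReal_mul (by positivity)]
    refine ENNReal.ofReal_le_ofReal ?_
    have hr : 0 ≤ ‖v‖ / ℓ := by positivity
    have hr1 : ‖v‖ / ℓ ≤ 1 := (div_le_one h2).2 hv
    have h1 : ‖v‖ / ℓ ≤ (‖v‖ / ℓ) ^ (1 / 2 : ℝ) := by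
      conv_lhs => rw [← Real.rpow_one (‖v‖ / ℓ)]
      rcases hr.eq_or_lt with h0 | h0
      · rw [← h0]; simp
      · exact Real.rpow_le_rpow_of_exponent_ge h0 hr1 (by norm_num)
    have h3 : 0 < ℓ ^ N := by positivity
    calc (N : ℝ) * (2 * (‖v‖ / ℓ) * ℓ ^ N) = (2 * N) * ℓ ^ N * (‖v‖ / ℓ) := by ring
      _ ≤ _ := by gcongr; linarith

/-- The part of the convolution with `wt 1 s` coming from outside of the cube, averaged over
the cube. -/
lemma lintegral_cube_wt_le (N : ℕ) : ∃ C : ℝ, 0 < C ∧ ∀ (t : Fin N → ℝ) (m : ℤ) (κ : Fin N → ℤ)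
    (s : ℝ), 0 < s →
    ∫⁻ x in cube t m κ, ∫⁻ z, ENNReal.ofReal (wt 1 s (x - z)) *
        {z | idx t m z ≠ idx t m x}.indicator 1 z ≤
      ENNReal.ofReal (C * ((2 : ℝ) ^ m) ^ N * (s ^ (-(1/2) : ℝ) * (2 ^ m) ^ (-(1/2) : ℝ))) := by
  have hW := wtI_lt_top N (β := 1 / 2) (by norm_num)
  refine ⟨(2 * N + 1) * (wtI N (1/2)).toReal + 1, by positivity, fun t m κ s hs => ?_⟩
  have h2 : (0 : ℝ) < 2 ^ m := by positivity
  have hmS : MeasurableSet {p : (Fin N → ℝ) × (Fin N → ℝ) | idx t m p.1 = κ ∧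
      idx t m (p.1 - p.2) ≠ κ} := by
    refine MeasurableSet.inter ?_ (MeasurableSet.compl ?_)
    · exact (measurable_idx t m).comp measurable_fst (measurableSet_singleton κ)
    · exact (measurable_idx t m).comp (measurable_fst.sub measurable_snd)
          (measurableSet_singleton κ)
  set S := {p : (Fin N → ℝ) × (Fin N → ℝ) | idx t m p.1 = κ ∧ idx t m (p.1 - p.2) ≠ κ} with hS
  have hmeas : Measurable fun p : (Fin N → ℝ) × (Fin N → ℝ) => ENNReal.ofReal (wt 1 s p.2) *
        S.indicator 1 p :=
    ((measurable_wt_right 1 s).comp measurable_snd).ennreal_ofReal.mul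
      (measurable_one.indicator hmS)
  calc _ = ∫⁻ x, ∫⁻ v, ENNReal.ofReal (wt 1 s v) * S.indicator 1 (x, v) := by
        rw [← lintegral_indicator (measurableSet_cube _ _ _)]
        refine lintegral_congr fun x => ?_
        by_cases hx : idx t m x = κ
        · rw [Set.indicator_of_mem (mem_cube.2 hx)]
          rw [← lintegral_sub_left_eq_self _ x]
          refine lintegral_congr fun v => ?_
          simp only [sub_sub_cancel]
          congr 1
          by_cases hv : idx t m (x - v) = κ <;> simp [Set.indicator, hS, hx, hv]
        · rw [Set.indicator_of_notMem (fun h => hx (mem_cube.1 h))]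
          simp [hS, hx]
    _ = ∫⁻ v, ∫⁻ x, ENNReal.ofReal (wt 1 s v) * S.indicator 1 (x, v) :=
        lintegral_lintegral_swap hmeas.aemeasurable
    _ ≤ ∫⁻ v : Fin N → ℝ, ENNReal.ofReal ((2 * N + 1) * ((2 : ℝ) ^ m) ^ N *
        (2 ^ m) ^ (-(1/2) : ℝ)) *
          ENNReal.ofReal (wt (1/2) s v) := by
        refine lintegral_mono fun v => ?_
        have hmv : MeasurableSet {x | idx t m x = κ ∧ idx t m (x - v) ≠ κ} :=
          (measurable_id.prodMk measurable_const : Measurable fun x : Fin N → ℝ => (x, v)) hmS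
        have e : ∫⁻ x, S.indicator 1 (x, v) = volume {x | idx t m x = κ ∧ idx t m (x - v) ≠ κ} := by
          rw [← lintegral_indicator_one hmv]
          refine lintegral_congr fun x => ?_
          by_cases hv : idx t m x = κ ∧ idx t m (x - v) ≠ κ <;> simp [Set.indicator, hS, hv]
        have hm1 : Measurable fun x => S.indicator (1 : (Fin N → ℝ) × (Fin N → ℝ) → ℝ≥0∞) (x, v) :=
          (measurable_one.indicator hmS).comp (measurable_id.prodMk measurable_const)
        dsimp only
        rw [lintegral_const_mul _ hm1, e]
        have hw := wt_nonneg 1 hs v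
        refine (mul_le_mul_right (volume_cube_shift_le t m κ v) _).trans ?_
        rw [← ENNReal.ofReal_mul hw, ← ENNReal.ofReal_mul (by positivity)]
        refine ENNReal.ofReal_le_ofReal ?_
        have h3 : wt 1 s v * ‖v‖ ^ (1/2 : ℝ) ≤ wt (1/2) s v := by
          have hp : 0 < s + ‖v‖ := by positivity
          calc _ ≤ wt 1 s v * (s + ‖v‖) ^ (1/2 : ℝ) := by
                gcongr; linarith
            _ = _ := by
                unfold wt
                rw [← Real.rpow_add hp]; congr 1; ring
        rw [Real.div_rpow (norm_nonneg _) h2.le, Real.rpow_neg h2.le]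
        calc _ = (2 * N + 1) * ((2 : ℝ) ^ m) ^ N * (((2 : ℝ) ^ m) ^ (1/2 : ℝ))⁻¹ *
              (wt 1 s v * ‖v‖ ^ (1/2 : ℝ)) := by ring
          _ ≤ _ := by gcongr
    _ ≤ _ := by
        rw [lintegral_const_mul _ (measurable_wt_right _ _).ennreal_ofReal, lintegral_wt _ hs,
          ← ENNReal.ofReal_toReal hW.ne, ← ENNReal.ofReal_mul (by positivity),
          ← ENNReal.ofReal_mul (by positivity)]
        refine ENNReal.ofReal_le_ofReal ?_
        rw [ENNReal.toReal_ofReal ENNReal.toReal_nonneg]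
        calc _ = ((2 * N + 1) * (wtI N (1/2)).toReal) * ((2 : ℝ) ^ m) ^ N *
              (s ^ (-(1/2) : ℝ) * (2 ^ m) ^ (-(1/2) : ℝ)) := by ring
          _ ≤ _ := by gcongr; linarith

lemma integrable_kd_sub {N : ℕ} (d : Fin (N + 1)) (x : Fin N → ℝ) {s : ℝ} (hs : 0 < s) :
    Integrable fun z => kd d (x - z) s := by
  obtain ⟨C, hC, h⟩ := abs_kd_le_wt N
  have h1 : Integrable fun z : Fin N → ℝ => C * wt 1 s (x - z) :=
    ((integrable_wt N one_pos hs).const_mul C).comp_sub_left x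
  refine h1.mono' (measurable_kd_sub d hs x).aestronglyMeasurable (ae_of_all _ fun z => h d _ s hs)

/-- If `b` is constant on cubes, the integral of `b²` against a weight depends only on the
averages of the weight. -/
lemma lintegral_mul_le_of_const {N : ℕ} (t : Fin N → ℝ) (k : ℤ) {B φ : (Fin N → ℝ) → ℝ≥0∞}
    (hB : Measurable B) (hφ : Measurable φ) (hc : ∀ x y, idx t k x = idx t k y → B x = B y)
    {A : ℝ} (hA : ∀ κ, ∫⁻ x in cube t k κ, φ x ≤ ENNReal.ofReal (((2 : ℝ) ^ k) ^ N) *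
        ENNReal.ofReal A) :
    ∫⁻ x, B x * φ x ≤ ENNReal.ofReal A * ∫⁻ x, B x := by
  have h2 : (0 : ℝ) < ((2 : ℝ) ^ k) ^ N := by positivity
  set V := ENNReal.ofReal (((2 : ℝ) ^ k) ^ N) with hV
  have hV0 : V ≠ 0 := by rw [hV]; simpa using h2
  have hVt : V ≠ ∞ := ENNReal.ofReal_ne_top
  have h1 : ∀ x, ∫⁻ y in cube t k (idx t k x), B y = V * B x := by
    intro x
    rw [setLIntegral_congr_fun (g := fun _ => B x) (measurableSet_cube _ _ _) fun y hy => hc _ _ hy,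
      setLIntegral_const, volume_cube, mul_comm]
  have h3 := lintegral_mul_cube_swap t k hφ hB
  have h4 : V * ∫⁻ x, B x * φ x ≤ V * (ENNReal.ofReal A * ∫⁻ x, B x) := by
    calc V * ∫⁻ x, B x * φ x = ∫⁻ z, φ z * ∫⁻ y in cube t k (idx t k z), B y := by
          rw [← lintegral_const_mul' _ _ hVt]
          refine lintegral_congr fun x => ?_
          rw [h1]; ring
      _ = _ := h3
      _ ≤ ∫⁻ y, B y * (V * ENNReal.ofReal A) := by
          refine lintegral_mono fun y => ?_
          exact mul_le_mul_right (hA _) _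
      _ = _ := by rw [lintegral_mul_const _ hB]; ring
  exact (ENNReal.mul_le_mul_iff_right hV0 hVt).1 h4

lemma abs_Tk_le_osc (N : ℕ) : ∃ C : ℝ, 0 < C ∧ ∀ (d : Fin (N + 1)) (s : ℝ) (x : Fin N → ℝ)
    (b : (Fin N → ℝ) → ℝ), 0 < s → Integrable b →
    ENNReal.ofReal |Tk d s b x| ≤
      ∫⁻ z, ENNReal.ofReal (C * wt 1 s (x - z)) * ENNReal.ofReal |b z - b x| := by
  obtain ⟨C, hC, h⟩ := abs_kd_le_wt N
  refine ⟨C, hC, fun d s x b hs hb => ?_⟩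
  have h1 := integrable_kd_mul d hs x hb
  have h2 := (integrable_kd_sub d x hs).mul_const (b x)
  have e : Tk d s b x = ∫ z, kd d (x - z) s * (b z - b x) := by
    simp only [mul_sub]
    rw [integral_sub h1 h2, integral_mul_const, integral_kd d x hs, zero_mul, sub_zero, Tk]
  have h3 : Integrable fun z => kd d (x - z) s * (b z - b x) := by
    simp only [mul_sub]; exact h1.sub h2
  rw [e]
  refine (ENNReal.ofReal_le_ofReal abs_integral_le_integral_abs).trans ?_
  rw [ofReal_integral_eq_lintegral_ofReal h3.abs (ae_of_all _ fun z => abs_nonneg _)]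
  refine lintegral_mono fun z => ?_
  have hw := wt_nonneg 1 hs (x - z)
  rw [← ENNReal.ofReal_mul (by positivity), abs_mul]
  refine ENNReal.ofReal_le_ofReal ?_
  gcongr
  exact h d _ s hs

/-- The indicator function of the pairs of points which lie in different cubes. -/
def sep {N : ℕ} (t : Fin N → ℝ) (k : ℤ) (x z : Fin N → ℝ) : ℝ≥0∞ :=
  {z | idx t k z ≠ idx t k x}.indicator 1 z

lemma sep_of_eq {N : ℕ} {t : Fin N → ℝ} {k : ℤ} {x z : Fin N → ℝ} (h : idx t k z = idx t k x) :
    sep t k x z = 0 := by simp [sep, h]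

lemma sep_of_ne {N : ℕ} {t : Fin N → ℝ} {k : ℤ} {x z : Fin N → ℝ} (h : idx t k z ≠ idx t k x) :
    sep t k x z = 1 := by simp [sep, h]

lemma sep_comm {N : ℕ} (t : Fin N → ℝ) (k : ℤ) (x z : Fin N → ℝ) : sep t k x z = sep t k z x := by
  by_cases h : idx t k z = idx t k x
  · rw [sep_of_eq h, sep_of_eq h.symm]
  · rw [sep_of_ne h, sep_of_ne (Ne.symm h)]

lemma measurable_sep {N : ℕ} (t : Fin N → ℝ) (k : ℤ) :
    Measurable fun p : (Fin N → ℝ) × (Fin N → ℝ) => sep t k p.1 p.2 := by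
  have h : (fun p : (Fin N → ℝ) × (Fin N → ℝ) => sep t k p.1 p.2) =
      {p : (Fin N → ℝ) × (Fin N → ℝ) | idx t k p.2 = idx t k p.1}ᶜ.indicator 1 := by
    ext p
    by_cases h : idx t k p.2 = idx t k p.1
    · simp [sep_of_eq h, h]
    · simp [sep_of_ne h, h]
  rw [h]
  exact measurable_one.indicator (measurableSet_idx_eq t k).compl

lemma measurable_sep_right {N : ℕ} (t : Fin N → ℝ) (k : ℤ) (x : Fin N → ℝ) :
    Measurable (sep t k x) := (measurable_sep t k).of_uncurry_left (x := x) (f := sep t k)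

/-- The symmetrized oscillation of a function which is constant on cubes. -/
lemma lintegral_osc_le {N : ℕ} (t : Fin N → ℝ) (k : ℤ) {w : (Fin N → ℝ) → ℝ≥0∞} (hwm : Measurable w)
    (hwn : ∀ v, w (-v) = w v) {b : (Fin N → ℝ) → ℝ} (hbm : Measurable b)
    (hc : ∀ x y, idx t k x = idx t k y → b x = b y) :
    ∫⁻ x, ∫⁻ z, w (x - z) * ENNReal.ofReal |b z - b x| ^ 2 ≤
      4 * ∫⁻ x, ENNReal.ofReal (b x ^ 2) * ∫⁻ z, w (x - z) * sep t k x z := by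
  set B : (Fin N → ℝ) → ℝ≥0∞ := fun z => ENNReal.ofReal (b z ^ 2) with hB
  have hBm : Measurable B := (hbm.pow_const 2).ennreal_ofReal
  have hsep := measurable_sep t k
  have hW : Measurable fun p : (Fin N → ℝ) × (Fin N → ℝ) => w (p.1 - p.2) := by fun_prop
  have hBs : Measurable fun p : (Fin N → ℝ) × (Fin N → ℝ) => B p.2 := by fun_prop
  have hosc : ∀ x z, ENNReal.ofReal |b z - b x| ^ 2 ≤ 2 * (B z + B x) * sep t k x z := by
    intro x z
    by_cases h : idx t k z = idx t k x
    · simp [hc _ _ h]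
    · rw [sep_of_ne h, ← ofReal_sq_eq, mul_one, hB,
        ← ENNReal.ofReal_add (sq_nonneg _) (sq_nonneg _), ← ENNReal.ofReal_ofNat,
        ← ENNReal.ofReal_mul (by norm_num)]
      exact ENNReal.ofReal_le_ofReal (by nlinarith [sq_nonneg (b z + b x)])
  have hws : ∀ x, Measurable fun z => w (x - z) * sep t k x z := fun x =>
    (hwm.comp (measurable_const.sub measurable_id)).mul (measurable_sep_right t k x)
  have hwB : ∀ x, Measurable fun z => w (x - z) * (B z * sep t k x z) := fun x =>
    (hwm.comp (measurable_const.sub measurable_id)).mul (hBm.mul (measurable_sep_right t k x))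
  have hsymm : ∫⁻ x, ∫⁻ z, w (x - z) * (B z * sep t k x z) =
      ∫⁻ x, B x * ∫⁻ z, w (x - z) * sep t k x z := by
    rw [lintegral_lintegral_swap (hW.mul (hBs.mul hsep)).aemeasurable]
    refine lintegral_congr fun z => ?_
    rw [← lintegral_const_mul _ (hws z)]
    refine lintegral_congr fun x => ?_
    rw [← hwn (x - z), neg_sub, sep_comm]; ring
  have hφm : Measurable fun x => ∫⁻ z, w (x - z) * sep t k x z :=
    (hW.mul hsep).lintegral_prod_right'
  calc _ ≤ ∫⁻ x, 2 * ((∫⁻ z, w (x - z) * (B z * sep t k x z)) +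
          B x * ∫⁻ z, w (x - z) * sep t k x z) := by
        refine lintegral_mono fun x => ?_
        rw [← lintegral_const_mul _ (hws x), ← lintegral_add_left (hwB x),
          ← lintegral_const_mul' _ _ (by simp)]
        refine lintegral_mono fun z => ?_
        refine (mul_le_mul_right (hosc x z) _).trans (le_of_eq ?_)
        ring
    _ = 2 * (2 * ∫⁻ x, B x * ∫⁻ z, w (x - z) * sep t k x z) := by
        have hBφ : Measurable fun x => B x * ∫⁻ z, w (x - z) * sep t k x z := hBm.mul hφm
        rw [lintegral_const_mul' _ _ (by simp), lintegral_add_right _ hBφ, hsymm, ← two_mul]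
    _ = 4 * ∫⁻ x, B x * ∫⁻ z, w (x - z) * sep t k x z := by rw [← mul_assoc]; norm_num

lemma lintegral_Tk_sq_le_small (N : ℕ) : ∃ C : ℝ, 0 < C ∧
    ∀ (d : Fin (N + 1)) (t : Fin N → ℝ) (k : ℤ)
    (s : ℝ) (b : (Fin N → ℝ) → ℝ), 0 < s → Measurable b → Integrable b →
    (∀ x y, idx t k x = idx t k y → b x = b y) →
    ∫⁻ x, ENNReal.ofReal (Tk d s b x ^ 2) ≤
      ENNReal.ofReal (C * (s ^ (-1 : ℝ) * (s ^ (-(1/2) : ℝ) * (2 ^ k) ^ (-(1/2) : ℝ)))) *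
        ∫⁻ z, ENNReal.ofReal (b z ^ 2) := by
  obtain ⟨C₁, hC₁, h₁⟩ := abs_Tk_le_osc N
  obtain ⟨C₂, hC₂, h₂⟩ := lintegral_cube_wt_le N
  have hW := wtI_lt_top N (β := 1) one_pos
  refine ⟨C₁ ^ 2 * ((wtI N 1).toReal + 1) * (4 * C₂), by positivity,
    fun d t k s b hs hbm hb hc => ?_⟩
  set w : (Fin N → ℝ) → ℝ≥0∞ := fun v => ENNReal.ofReal (C₁ * wt 1 s v) with hw
  have hwm : Measurable w := ((measurable_wt_right 1 s).const_mul _).ennreal_ofReal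
  have hwI : ∫⁻ v, w v = ENNReal.ofReal (C₁ * s ^ (-1 : ℝ)) * wtI N 1 := by
    simp_rw [hw, ENNReal.ofReal_mul hC₁.le]
    rw [lintegral_const_mul _ (measurable_wt_right 1 s).ennreal_ofReal, lintegral_wt 1 hs,
        mul_assoc]
  have hwt : (∫⁻ v, w v) ≠ ∞ := by
    rw [hwI]; exact ENNReal.mul_ne_top ENNReal.ofReal_ne_top hW.ne
  have hφB : ∫⁻ x, ENNReal.ofReal (b x ^ 2) * ∫⁻ z, w (x - z) * sep t k x z ≤
      ENNReal.ofReal (C₁ * C₂ * (s ^ (-(1/2) : ℝ) * (2 ^ k) ^ (-(1/2) : ℝ))) *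
        ∫⁻ x, ENNReal.ofReal (b x ^ 2) := by
    refine lintegral_mul_le_of_const t k (hbm.pow_const 2).ennreal_ofReal ?_
      (fun x y h => by rw [hc x y h]) fun κ => ?_
    · have h1 : Measurable fun p : (Fin N → ℝ) × (Fin N → ℝ) => w (p.1 - p.2) := by fun_prop
      exact (h1.mul (measurable_sep t k)).lintegral_prod_right'
    have e : ∀ x, ∫⁻ z, w (x - z) * sep t k x z = ENNReal.ofReal C₁ *
        ∫⁻ z, ENNReal.ofReal (wt 1 s (x - z)) * {z | idx t k z ≠ idx t k x}.indicator 1 z := by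
      intro x
      rw [← lintegral_const_mul' _ _ ENNReal.ofReal_ne_top]
      refine lintegral_congr fun z => ?_
      rw [← mul_assoc, ← ENNReal.ofReal_mul hC₁.le]
      rfl
    simp_rw [e]
    rw [lintegral_const_mul' _ _ ENNReal.ofReal_ne_top]
    refine (mul_le_mul_right (h₂ t k κ s hs) _).trans (le_of_eq ?_)
    rw [← ENNReal.ofReal_mul hC₁.le, ← ENNReal.ofReal_mul (by positivity)]
    congr 1; ring
  calc _ ≤ ∫⁻ x, (∫⁻ v, w v) * ∫⁻ z, w (x - z) * ENNReal.ofReal |b z - b x| ^ 2 := by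
        refine lintegral_mono fun x => ?_
        rw [ofReal_sq_eq]
        refine (pow_le_pow_left' (h₁ d s x b hs hb) 2).trans ?_
        refine (sq_lintegral_mul_le' volume (w := fun z => w (x - z)) (by fun_prop)
          ((hbm.sub_const _).abs.ennreal_ofReal).aemeasurable).trans ?_
        rw [lintegral_sub_left_eq_self w x]
    _ ≤ (ENNReal.ofReal (C₁ * s ^ (-1 : ℝ)) * wtI N 1) * (4 * (ENNReal.ofReal
          (C₁ * C₂ * (s ^ (-(1/2) : ℝ) * (2 ^ k) ^ (-(1/2) : ℝ))) *
            ∫⁻ x, ENNReal.ofReal (b x ^ 2))) := by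
        rw [lintegral_const_mul' _ _ hwt, hwI]
        refine mul_le_mul_right ?_ _
        refine (lintegral_osc_le t k hwm (fun v => by simp [hw, wt_neg]) hbm hc).trans ?_
        exact mul_le_mul_right hφB _
    _ = ENNReal.ofReal (C₁ * s ^ (-1 : ℝ) * (wtI N 1).toReal * 4 *
          (C₁ * C₂ * (s ^ (-(1/2) : ℝ) * (2 ^ k) ^ (-(1/2) : ℝ)))) *
            ∫⁻ x, ENNReal.ofReal (b x ^ 2) := by
        rw [ENNReal.ofReal_mul (p := C₁ * s ^ (-1 : ℝ) * (wtI N 1).toReal * 4) (by positivity),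
          ENNReal.ofReal_mul (p := C₁ * s ^ (-1 : ℝ) * (wtI N 1).toReal) (by positivity),
          ENNReal.ofReal_mul (p := C₁ * s ^ (-1 : ℝ)) (by positivity),
          ENNReal.ofReal_toReal hW.ne, show ENNReal.ofReal 4 = 4 by norm_num]
        ring
    _ ≤ _ := by
        refine mul_le_mul_left (ENNReal.ofReal_le_ofReal ?_) _
        calc _ = C₁ ^ 2 * (wtI N 1).toReal * (4 * C₂) *
              (s ^ (-1 : ℝ) * (s ^ (-(1/2) : ℝ) * (2 ^ k) ^ (-(1/2) : ℝ))) := by ring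
          _ ≤ _ := by gcongr; linarith

/-! ### Almost orthogonality and cones -/

/-- The almost orthogonality factor between the scales `s` and `a`. -/
def kap (s a : ℝ) : ℝ := (min (s / a) (a / s)) ^ (1 / 4 : ℝ)

lemma kap_pos {s a : ℝ} (hs : 0 < s) (ha : 0 < a) : 0 < kap s a :=
  Real.rpow_pos_of_pos (lt_min (div_pos hs ha) (div_pos ha hs)) _

lemma measurable_kap : Measurable fun p : ℝ × ℝ => kap p.1 p.2 := by
  unfold kap; fun_prop

lemma kap_sq {s a : ℝ} (hs : 0 < s) (ha : 0 < a) :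
    kap s a ^ 2 = (min (s / a) (a / s)) ^ (1 / 2 : ℝ) := by
  have := (lt_min (div_pos hs ha) (div_pos ha hs)).le
  rw [kap, ← Real.rpow_natCast, ← Real.rpow_mul this]; norm_num

lemma lintegral_Tk_sq_le (N : ℕ) : ∃ C : ℝ, 0 < C ∧ ∀ (d : Fin (N + 1)) (t : Fin N → ℝ) (m : ℤ)
    (s : ℝ) (b : (Fin N → ℝ) → ℝ), 0 < s → Measurable b → Integrable b →
    (∀ x y, idx t (m - 1) x = idx t (m - 1) y → b x = b y) → (∀ κ, ∫ z in cube t m κ, b z = 0) →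
    ∫⁻ x, ENNReal.ofReal (Tk d s b x ^ 2) ≤
      ENNReal.ofReal (C * (kap s (2 ^ m) ^ 2 * s ^ (-2 : ℝ))) * ∫⁻ z, ENNReal.ofReal (b z ^ 2) := by
  obtain ⟨C₁, hC₁, h₁⟩ := lintegral_Tk_sq_le_large N
  obtain ⟨C₂, hC₂, h₂⟩ := lintegral_Tk_sq_le_small N
  refine ⟨C₁ + 4 * C₂, by positivity, fun d t m s b hs hbm hb hc h0 => ?_⟩
  have ha : (0 : ℝ) < 2 ^ m := by positivity
  rw [kap_sq hs ha]
  set a : ℝ := 2 ^ m with hadef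
  have hr : 0 < min (s / a) (a / s) := lt_min (div_pos hs ha) (div_pos ha hs)
  rcases le_or_gt (2 * a) s with h | h
  · refine (h₁ d t m s b h hbm hb h0).trans (mul_le_mul_left (ENNReal.ofReal_le_ofReal ?_) _)
    have hle : a / s ≤ 1 := by rw [div_le_one hs]; linarith
    have e : min (s / a) (a / s) = a / s := by
      refine min_eq_right (hle.trans ?_)
      rw [le_div_iff₀ ha]; linarith
    rw [e]
    have : (a / s) ^ 2 ≤ (a / s) ^ (1 / 2 : ℝ) := by
      rw [← Real.rpow_natCast]
      exact Real.rpow_le_rpow_of_exponent_ge (by positivity) hle (by norm_num)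
    have hp : 0 < (a / s) ^ (1 / 2 : ℝ) := by positivity
    calc C₁ * (a / s) ^ 2 * s ^ (-2 : ℝ) ≤ (C₁ + 4 * C₂) * (a / s) ^ (1 / 2 : ℝ) *
        s ^ (-2 : ℝ) := by
          gcongr; linarith
      _ = _ := by ring
  · refine (h₂ d t (m - 1) s b hs hbm hb hc).trans (mul_le_mul_left (ENNReal.ofReal_le_ofReal ?_) _)
    have hk : (2 : ℝ) ^ (m - 1) = a / 2 := by rw [zpow_sub₀ two_ne_zero, zpow_one]
    have e : s ^ (-1 : ℝ) * (s ^ (-(1/2) : ℝ) * (2 ^ (m - 1)) ^ (-(1/2) : ℝ)) =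
        (2 * (s / a)) ^ (1 / 2 : ℝ) * s ^ (-2 : ℝ) := by
      have : (2 * (s / a)) = s * (a / 2)⁻¹ := by field_simp
      rw [hk, this, Real.mul_rpow hs.le (by positivity), Real.inv_rpow (by positivity),
        ← Real.rpow_neg (by positivity), ← mul_assoc, ← Real.rpow_add hs, mul_right_comm,
        ← Real.rpow_add hs]
      norm_num
    rw [e]
    have hq : (2 * (s / a)) ^ (1 / 2 : ℝ) ≤ 4 * (min (s / a) (a / s)) ^ (1 / 2 : ℝ) := by
      have h4 : (4 : ℝ) = 16 ^ (1 / 2 : ℝ) := by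
        rw [show (16 : ℝ) = 4 ^ (2 : ℝ) by norm_num, ← Real.rpow_mul (by norm_num)]; norm_num
      rw [h4, ← Real.mul_rpow (by norm_num) hr.le]
      refine Real.rpow_le_rpow (by positivity) ?_ (by norm_num)
      have h2 : s / a < 2 := by rw [div_lt_iff₀ ha]; exact h
      have h3 : 1 / 2 < a / s := by rw [lt_div_iff₀ hs]; linarith
      rcases min_choice (s / a) (a / s) with h | h <;> rw [h] <;> nlinarith [div_pos hs ha]
    calc _ ≤ C₂ * (4 * (min (s / a) (a / s)) ^ (1 / 2 : ℝ) * s ^ (-2 : ℝ)) := by gcongr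
      _ = (4 * C₂) * ((min (s / a) (a / s)) ^ (1 / 2 : ℝ) * s ^ (-2 : ℝ)) := by ring
      _ ≤ _ := by gcongr; linarith

lemma tsum_kap_le : ∃ K : ℝ≥0∞, K ≠ ∞ ∧ ∀ s : ℝ, 0 < s →
    ∑' m : ℤ, ENNReal.ofReal (kap s (2 ^ m)) ≤ K := by
  set θ : ℝ := (1 / 2) ^ (1 / 4 : ℝ) with hθ
  have hθ0 : 0 < θ := by positivity
  have hθ1 : θ < 1 := Real.rpow_lt_one (by norm_num) (by norm_num) (by norm_num)
  have hsum : Summable fun m : ℤ => θ⁻¹ * θ ^ m.natAbs := by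
    refine Summable.mul_left _ (summable_int_iff_summable_nat_and_neg.2 ⟨?_, ?_⟩) <;>
    simpa using summable_geometric_of_lt_one hθ0.le hθ1
  refine ⟨∑' m : ℤ, ENNReal.ofReal (θ⁻¹ * θ ^ m.natAbs), hsum.tsum_ofReal_ne_top, fun s hs => ?_⟩
  set m₀ := Int.log 2 s with hm₀
  rw [← (Equiv.addRight m₀).tsum_eq]
  refine ENNReal.tsum_le_tsum fun m => ENNReal.ofReal_le_ofReal ?_
  have h1 : (2 : ℝ) ^ m₀ ≤ s := by exact_mod_cast Int.zpow_log_le_self (b := 2) (by norm_num) hs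
  have h2 : s < (2 : ℝ) ^ (m₀ + 1) := by
    exact_mod_cast Int.lt_zpow_succ_log_self (b := 2) (by norm_num) s
  have ha : (0 : ℝ) < 2 ^ m₀ := by positivity
  have key : θ⁻¹ * θ ^ m.natAbs = (2 * (1 / 2) ^ m.natAbs) ^ (1 / 4 : ℝ) := by
    rw [Real.mul_rpow (by norm_num) (by positivity), hθ, ← Real.inv_rpow (by norm_num),
      ← Real.rpow_natCast, ← Real.rpow_natCast, ← Real.rpow_mul (by norm_num),
      ← Real.rpow_mul (by norm_num)]
    congr 2 <;> ring_nf
  rw [key, kap, Equiv.coe_addRight]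
  have hA : (0 : ℝ) < 2 ^ (m + m₀) := by positivity
  refine Real.rpow_le_rpow (lt_min (div_pos hs hA) (div_pos hA hs)).le ?_ (by norm_num)
  rcases le_total 0 m with h | h
  · obtain ⟨k, rfl⟩ := Int.eq_ofNat_of_zero_le h
    refine (min_le_left _ _).trans ?_
    rw [zpow_add₀ two_ne_zero, zpow_natCast, Int.natAbs_natCast, div_le_iff₀ (by positivity)]
    rw [zpow_add₀ two_ne_zero, zpow_one] at h2
    calc s ≤ 2 * 2 ^ m₀ := by linarith
      _ = 2 * ((1 / 2) ^ k * 2 ^ k) * 2 ^ m₀ := by rw [← mul_pow]; norm_num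
      _ = _ := by ring
  · obtain ⟨k, rfl⟩ := Int.exists_eq_neg_ofNat h
    refine (min_le_right _ _).trans ?_
    rw [zpow_add₀ two_ne_zero, zpow_neg, zpow_natCast, Int.natAbs_neg, Int.natAbs_natCast,
      div_le_iff₀ hs, ← inv_pow, ← one_div]
    have : (0 : ℝ) < (1 / 2) ^ k := by positivity
    nlinarith

lemma lintegral_kap_div_le : ∃ K : ℝ≥0∞, K ≠ ∞ ∧ ∀ a : ℝ, 0 < a →
    ∫⁻ s in Set.Ioi (0 : ℝ), ENNReal.ofReal (kap s a * s ^ (-1 : ℝ)) ≤ K := by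
  refine ⟨ENNReal.ofReal 4 + ENNReal.ofReal 4, by simp, fun a ha => ?_⟩
  rw [← Set.Ioc_union_Ioi_eq_Ioi ha.le]
  refine (lintegral_union_le _ _ _).trans (add_le_add ?_ ?_)
  · have hi : IntegrableOn (fun s : ℝ => a ^ (-(1/4) : ℝ) * s ^ (-(3/4) : ℝ)) (Set.Ioc 0 a) := by
      refine Integrable.const_mul ?_ _
      have := intervalIntegral.intervalIntegrable_rpow' (a := 0) (b := a) (r := -(3/4))
        (by norm_num)
      rwa [intervalIntegrable_iff_integrableOn_Ioc_of_le ha.le] at this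
    have hv : ∫ s in Set.Ioc 0 a, a ^ (-(1/4) : ℝ) * s ^ (-(3/4) : ℝ) = 4 := by
      rw [← intervalIntegral.integral_of_le ha.le, intervalIntegral.integral_const_mul,
        integral_rpow (Or.inl (by norm_num)), Real.zero_rpow (by norm_num), sub_zero,
        mul_div_assoc', ← Real.rpow_add ha]
      norm_num
    rw [← hv, ofReal_integral_eq_lintegral_ofReal hi]
    · refine setLIntegral_mono' measurableSet_Ioc fun s hs => ENNReal.ofReal_le_ofReal ?_
      have h0 : 0 < s := hs.1
      calc kap s a * s ^ (-1 : ℝ) ≤ (s / a) ^ (1 / 4 : ℝ) * s ^ (-1 : ℝ) := by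
            unfold kap
            gcongr
            exact min_le_left _ _
        _ = _ := by
          rw [Real.div_rpow h0.le ha.le, div_eq_mul_inv, ← Real.rpow_neg ha.le, mul_right_comm,
            ← Real.rpow_add h0, mul_comm]
          norm_num
    · exact (ae_restrict_mem measurableSet_Ioc).mono fun s hs => by
        have := hs.1; positivity
  · have hi : IntegrableOn (fun s : ℝ => a ^ (1/4 : ℝ) * s ^ (-(5/4) : ℝ)) (Set.Ioi a) :=
      (integrableOn_Ioi_rpow_of_lt (by norm_num) ha).const_mul _
    have hv : ∫ s in Set.Ioi a, a ^ (1/4 : ℝ) * s ^ (-(5/4) : ℝ) = 4 := by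
      rw [integral_const_mul, integral_Ioi_rpow_of_lt (by norm_num) ha, mul_div_assoc',
        mul_neg, ← Real.rpow_add ha]
      norm_num
    rw [← hv, ofReal_integral_eq_lintegral_ofReal hi]
    · refine setLIntegral_mono' measurableSet_Ioi fun s hs => ENNReal.ofReal_le_ofReal ?_
      have h0 : 0 < s := ha.trans hs
      calc kap s a * s ^ (-1 : ℝ) ≤ (a / s) ^ (1 / 4 : ℝ) * s ^ (-1 : ℝ) := by
            unfold kap
            gcongr
            exact min_le_right _ _
        _ = _ := by
          rw [Real.div_rpow ha.le h0.le, div_eq_mul_inv, ← Real.rpow_neg h0.le, mul_assoc,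
            ← Real.rpow_add h0]
          norm_num
    · exact (ae_restrict_mem measurableSet_Ioi).mono fun s hs => by
        have := ha.trans hs; positivity

section

lemma sq_tsum_mul_le (w f : ℤ → ℝ≥0∞) :
    (∑' m, w m * f m) ^ 2 ≤ (∑' m, w m) * ∑' m, w m * f m ^ 2 := by
  have := sq_lintegral_mul_le' Measure.count (w := w) (f := f) (by fun_prop) (by fun_prop)
  simpa only [lintegral_count] using this

lemma sq_tsum_le_of_weight {w : ℤ → ℝ≥0∞} (h0 : ∀ m, w m ≠ 0) (ht : ∀ m, w m ≠ ∞) (u : ℤ → ℝ≥0∞) :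
    (∑' m, u m) ^ 2 ≤ (∑' m, w m) * ∑' m, (w m)⁻¹ * u m ^ 2 := by
  have := sq_tsum_mul_le w fun m => (w m)⁻¹ * u m
  have e1 : ∀ m, w m * ((w m)⁻¹ * u m) = u m := fun m => by
    rw [← mul_assoc, ENNReal.mul_inv_cancel (h0 m) (ht m), one_mul]
  have e2 : ∀ m, w m * ((w m)⁻¹ * u m) ^ 2 = (w m)⁻¹ * u m ^ 2 := fun m => by
    rw [pow_two, ← mul_assoc, e1]; ring
  simpa only [e1, e2] using this

lemma coneSet_subset {N : ℕ} {q : (Fin N → ℝ) × ℝ} (hq : q ∈ coneSet N) : ‖q.1‖ < q.2 := by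
  have hq' : √(∑ i, q.1 i ^ 2) < q.2 := hq
  refine (pi_norm_le_iff_of_nonneg (Real.sqrt_nonneg _)).2 (fun i => ?_) |>.trans_lt hq'
  rw [Real.norm_eq_abs, ← Real.sqrt_sq_eq_abs]
  exact Real.sqrt_le_sqrt
    (Finset.single_le_sum (f := fun i => q.1 i ^ 2) (fun i _ => sq_nonneg _) (Finset.mem_univ i))

/-- The reference measure on the index space of the Lusin square function. -/
def coneMeas (N : ℕ) : Measure (((Fin N → ℝ) × ℝ) × Fin (N + 1)) :=
  (volume.restrict (coneSet N)).prod Measure.count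

lemma measurableSet_coneSet (N : ℕ) : MeasurableSet (coneSet N) := by
  have h1 : Measurable fun q : (Fin N → ℝ) × ℝ => √(∑ i, q.1 i ^ 2) := by fun_prop
  exact measurableSet_lt h1 measurable_snd

instance (N : ℕ) : SFinite (coneMeas N) := by unfold coneMeas; infer_instance

lemma lintegral_coneMeas_le {N : ℕ} {φ : ℝ → ℝ≥0∞} (hφ : Measurable φ)
    {Ψ : ((Fin N → ℝ) × ℝ) × Fin (N + 1) → ℝ≥0∞}
    (h : ∀ y s d, ‖y‖ < s → Ψ ((y, s), d) ≤ ENNReal.ofReal (s ^ (1 - (N : ℝ))) * φ s) :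
    ∫⁻ q, Ψ q ∂coneMeas N ≤
      ENNReal.ofReal (2 ^ N * (N + 1)) * ∫⁻ s in Set.Ioi (0 : ℝ), ENNReal.ofReal s * φ s := by
  set φ' : ℝ → ℝ≥0∞ := fun s => ENNReal.ofReal (s ^ (1 - (N : ℝ))) * φ s with hφ'
  have hφm : Measurable φ' := by fun_prop
  have hB : MeasurableSet {q : (Fin N → ℝ) × ℝ | ‖q.1‖ < q.2} :=
    measurableSet_lt measurable_fst.norm measurable_snd
  set S : (Fin N → ℝ) × ℝ → ℝ≥0∞ := {q : (Fin N → ℝ) × ℝ | ‖q.1‖ < q.2}.indicator fun q => φ' q.2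
  have hS : Measurable S := (hφm.comp measurable_snd).indicator hB
  have hSd : Measurable fun q : ((Fin N → ℝ) × ℝ) × Fin (N + 1) => S q.1 := hS.comp measurable_fst
  calc ∫⁻ q, Ψ q ∂coneMeas N ≤ ∫⁻ q, S q.1 ∂coneMeas N := by
        refine lintegral_mono_ae ?_
        have : ∀ᵐ q ∂coneMeas N, q.1 ∈ coneSet N := by
          have h1 : ∀ᵐ q ∂(volume.restrict (coneSet N)), q ∈ coneSet N :=
            ae_restrict_mem (measurableSet_coneSet N)
          exact Measure.quasiMeasurePreserving_fst.ae h1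
        filter_upwards [this] with q hq
        have hq' := coneSet_subset hq
        rw [show S q.1 = φ' q.1.2 from Set.indicator_of_mem
            (s := {q : (Fin N → ℝ) × ℝ | ‖q.1‖ < q.2}) hq' _]
        exact h q.1.1 q.1.2 q.2 hq'
    _ = ∫⁻ q in coneSet N, (N + 1) * S q := by
        rw [coneMeas, lintegral_prod _ hSd.aemeasurable]
        refine lintegral_congr fun q => ?_
        simp [Measure.count_univ]
        rw [mul_comm]
    _ ≤ ∫⁻ q, (N + 1) * S q := setLIntegral_le_lintegral _ _
    _ = (N + 1) * ∫⁻ q, S q := lintegral_const_mul _ hS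
    _ = (N + 1) * ∫⁻ s, ∫⁻ y, S (y, s) := by
        rw [Measure.volume_eq_prod, lintegral_prod_symm' _ hS]
    _ ≤ (N + 1) * ∫⁻ s, (Set.Ioi (0 : ℝ)).indicator
          (fun s => ENNReal.ofReal (2 ^ N) * (ENNReal.ofReal s * φ s)) s := by
        refine mul_le_mul_right (lintegral_mono fun s => ?_) _
        have e : ∀ y : Fin N → ℝ, S (y, s) = (Metric.ball (0 : Fin N → ℝ) s).indicator
            (fun _ => φ' s) y := by
          intro y
          by_cases hy : ‖y‖ < s
          · rw [Set.indicator_of_mem (by simpa using hy)]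
            exact Set.indicator_of_mem (s := {q : (Fin N → ℝ) × ℝ | ‖q.1‖ < q.2}) hy _
          · rw [Set.indicator_of_notMem (by simpa using hy)]
            exact Set.indicator_of_notMem (s := {q : (Fin N → ℝ) × ℝ | ‖q.1‖ < q.2}) hy _
        simp_rw [e]
        rw [lintegral_indicator_const Metric.isOpen_ball.measurableSet]
        by_cases hs : 0 < s
        · rw [Set.indicator_of_mem (Set.mem_Ioi.2 hs), Real.volume_pi_ball _ hs, Fintype.card_fin,
              hφ']
          refine le_of_eq ?_
          have : ENNReal.ofReal (s ^ (1 - (N : ℝ))) * ENNReal.ofReal ((2 * s) ^ N) =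
              ENNReal.ofReal (2 ^ N) * ENNReal.ofReal s := by
            rw [← ENNReal.ofReal_mul (by positivity), ← ENNReal.ofReal_mul (by positivity)]
            congr 1
            rw [Real.rpow_sub hs, Real.rpow_one, Real.rpow_natCast, mul_pow]
            field_simp
          rw [← mul_assoc (ENNReal.ofReal (2 ^ N)), ← this]; ring
        · rw [Metric.ball_eq_empty.2 (not_lt.1 hs)]; simp
    _ = _ := by
        rw [lintegral_indicator measurableSet_Ioi, lintegral_const_mul' _ _ ENNReal.ofReal_ne_top,
          ENNReal.ofReal_mul (by positivity), ← mul_assoc,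
          show ENNReal.ofReal ((N : ℝ) + 1) = N + 1 by
            rw [ENNReal.ofReal_add (by positivity) zero_le_one]; simp]
        ring

/-- The square of a conical square function of a family of functions. -/
def coneSq {N : ℕ} {Ω : Type*} [MeasurableSpace Ω] (μ : Measure Ω)
    (W : Fin (N + 1) → ℝ → Ω → (Fin N → ℝ) → ℝ≥0∞) (x : Fin N → ℝ) : ℝ≥0∞ :=
  ∫⁻ q, ∫⁻ ω, (ENNReal.ofReal (q.1.2 ^ ((1 - (N : ℝ)) / 2)) * W q.2 q.1.2 ω (x + q.1.1)) ^ 2 ∂μ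
    ∂coneMeas N

lemma ofReal_rpow_half_sq {s : ℝ} (hs : 0 < s) (e : ℝ) :
    ENNReal.ofReal (s ^ (e / 2)) ^ 2 = ENNReal.ofReal (s ^ e) := by
  rw [← ENNReal.ofReal_pow (by positivity), ← Real.rpow_natCast, ← Real.rpow_mul hs.le]
  congr 2; push_cast; ring

variable {N : ℕ} {Ω : Type*} [MeasurableSpace Ω]

lemma coneSq_le (μ : Measure Ω) {W : Fin (N + 1) → ℝ → Ω → (Fin N → ℝ) → ℝ≥0∞} (x : Fin N → ℝ)
    {φ : ℝ → ℝ≥0∞} (hφ : Measurable φ)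
    (h : ∀ y s d, ‖y‖ < s → ∫⁻ ω, W d s ω (x + y) ^ 2 ∂μ ≤ φ s) :
    coneSq μ W x ≤
      ENNReal.ofReal (2 ^ N * (N + 1)) * ∫⁻ s in Set.Ioi (0 : ℝ), ENNReal.ofReal s * φ s := by
  refine lintegral_coneMeas_le hφ fun y s d hy => ?_
  have hs : 0 < s := (norm_nonneg y).trans_lt hy
  simp_rw [mul_pow, ofReal_rpow_half_sq hs]
  rw [lintegral_const_mul' _ _ ENNReal.ofReal_ne_top]
  exact mul_le_mul_right (h y s d hy) _

/-- Joint measurability of a family of functions on the index space. -/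
def JMeas (W : Fin (N + 1) → ℝ → Ω → (Fin N → ℝ) → ℝ≥0∞) : Prop :=
  Measurable fun p : Fin (N + 1) × ℝ × Ω × (Fin N → ℝ) => W p.1 p.2.1 p.2.2.1 p.2.2.2

lemma JMeas.integrand {W : Fin (N + 1) → ℝ → Ω → (Fin N → ℝ) → ℝ≥0∞} (hW : JMeas W) :
    Measurable fun p : ((Fin N → ℝ) × (((Fin N → ℝ) × ℝ) × Fin (N + 1))) × Ω =>
      (ENNReal.ofReal (p.1.2.1.2 ^ ((1 - (N : ℝ)) / 2)) *
        W p.1.2.2 p.1.2.1.2 p.2 (p.1.1 + p.1.2.1.1)) ^ 2 := by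
  have h1 : Measurable fun p : ((Fin N → ℝ) × (((Fin N → ℝ) × ℝ) × Fin (N + 1))) × Ω =>
      (p.1.2.2, p.1.2.1.2, p.2, p.1.1 + p.1.2.1.1) := by fun_prop
  have h2 := Measurable.comp hW h1
  have h3 : Measurable fun p : ((Fin N → ℝ) × (((Fin N → ℝ) × ℝ) × Fin (N + 1))) × Ω =>
      ENNReal.ofReal (p.1.2.1.2 ^ ((1 - (N : ℝ)) / 2)) := by fun_prop
  exact (h3.mul h2).pow_const 2

lemma measurable_coneSq (μ : Measure Ω) [SFinite μ] {W : Fin (N + 1) → ℝ → Ω → (Fin N → ℝ) → ℝ≥0∞}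
    (hW : JMeas W) : Measurable (coneSq μ W) :=
  (hW.integrand.lintegral_prod_right' (ν := μ)).lintegral_prod_right' (ν := coneMeas N)

lemma lintegral_coneSq_le (μ : Measure Ω) [SFinite μ]
    {W : Fin (N + 1) → ℝ → Ω → (Fin N → ℝ) → ℝ≥0∞} (hW : JMeas W)
    {φ : ℝ → ℝ≥0∞} (hφ : Measurable φ)
    (h : ∀ s d, 0 < s → ∫⁻ ω, (∫⁻ x, W d s ω x ^ 2) ∂μ ≤ φ s) :
    ∫⁻ x, coneSq μ W x ≤
      ENNReal.ofReal (2 ^ N * (N + 1)) * ∫⁻ s in Set.Ioi (0 : ℝ), ENNReal.ofReal s * φ s := by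
  have hm := hW.integrand
  unfold coneSq
  rw [lintegral_lintegral_swap (hm.lintegral_prod_right' (ν := μ)).aemeasurable]
  refine lintegral_coneMeas_le hφ fun y s d hy => ?_
  have hs : 0 < s := (norm_nonneg y).trans_lt hy
  have hm2 : Measurable fun p : (Fin N → ℝ) × Ω =>
      (ENNReal.ofReal (s ^ ((1 - (N : ℝ)) / 2)) * W d s p.2 (p.1 + y)) ^ 2 :=
    hm.comp (f := fun p : (Fin N → ℝ) × Ω => ((p.1, ((y, s), d)), p.2)) (by fun_prop)
  dsimp only
  rw [lintegral_lintegral_swap hm2.aemeasurable]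
  simp_rw [mul_pow, ofReal_rpow_half_sq hs]
  simp_rw [lintegral_const_mul' _ _ (ENNReal.ofReal_ne_top (r := s ^ (1 - (N : ℝ))))]
  refine mul_le_mul_right ?_ _
  refine (le_of_eq ?_).trans (h s d hs)
  refine lintegral_congr fun ω => ?_
  exact lintegral_add_right_eq_self (fun x => W d s ω x ^ 2) y

end

/-! ### Atoms -/

section

variable {N : ℕ} {Ω : Type*} [MeasurableSpace Ω]

/-- Martingale difference sequences living below the cube of scale `p` and index `κ`. -/
structure AtomFam (t : Fin N → ℝ) (p : ℤ) (κ : Fin N → ℤ) (b : ℤ → Ω → (Fin N → ℝ) → ℝ) : Prop where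
  meas : ∀ m, Measurable fun q : Ω × (Fin N → ℝ) => b m q.1 q.2
  int : ∀ m ω, Integrable (b m ω)
  step : ∀ m ω x y, idx t (m - 1) x = idx t (m - 1) y → b m ω x = b m ω y
  mean : ∀ m ω κ', ∫ z in cube t m κ', b m ω z = 0
  supp : ∀ m ω z, b m ω z ≠ 0 → m ≤ p ∧ idx t p z = κ

/-- The sum of the absolute values of the extensions of a family of functions. -/
def TW (b : ℤ → Ω → (Fin N → ℝ) → ℝ) (d : Fin (N + 1)) (s : ℝ) (ω : Ω) (x : Fin N → ℝ) : ℝ≥0∞ :=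
  ∑' m, ENNReal.ofReal |Tk d s (b m ω) x|

/-- The energy of a vector-valued function. -/
def energy (μ : Measure Ω) (b : Ω → (Fin N → ℝ) → ℝ) : ℝ≥0∞ :=
  ∫⁻ ω, (∫⁻ z, ENNReal.ofReal (b ω z ^ 2)) ∂μ

lemma measurable_Tk {b : Ω → (Fin N → ℝ) → ℝ}
    (hb : Measurable fun q : Ω × (Fin N → ℝ) => b q.1 q.2) :
    Measurable fun q : Fin (N + 1) × ℝ × Ω × (Fin N → ℝ) => Tk q.1 q.2.1 (b q.2.2.1) q.2.2.2 := by
  have h1 : Measurable fun q : (Fin (N + 1) × ℝ × Ω × (Fin N → ℝ)) × (Fin N → ℝ) =>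
      kd q.1.1 (q.1.2.2.2 - q.2) q.1.2.1 * b q.1.2.2.1 q.2 := by
    refine Measurable.mul ?_ ?_
    · exact measurable_kd.comp
        (f := fun q : (Fin (N + 1) × ℝ × Ω × (Fin N → ℝ)) × (Fin N → ℝ) =>
          (q.1.1, q.1.2.2.2 - q.2, q.1.2.1)) (by fun_prop)
    · exact hb.comp (f := fun q : (Fin (N + 1) × ℝ × Ω × (Fin N → ℝ)) × (Fin N → ℝ) =>
          (q.1.2.2.1, q.2)) (by fun_prop)
  exact (h1.stronglyMeasurable.integral_prod_right' (ν := volume)).measurable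

lemma jmeas_Tk {b : Ω → (Fin N → ℝ) → ℝ} (hb : Measurable fun q : Ω × (Fin N → ℝ) => b q.1 q.2) :
    JMeas fun d s ω x => ENNReal.ofReal |Tk d s (b ω) x| :=
  (measurable_Tk hb).abs.ennreal_ofReal

lemma JMeas.tsum {ι : Type*} [Countable ι] {W : ι → Fin (N + 1) → ℝ → Ω → (Fin N → ℝ) → ℝ≥0∞}
    (h : ∀ i, JMeas (W i)) : JMeas fun d s ω x => ∑' i, W i d s ω x :=
  Measurable.tsum h

lemma jmeas_TW {b : ℤ → Ω → (Fin N → ℝ) → ℝ}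
    (hb : ∀ m, Measurable fun q : Ω × (Fin N → ℝ) => b m q.1 q.2) : JMeas (TW b) :=
  JMeas.tsum fun m => jmeas_Tk (hb m)

lemma JMeas.slice {W : Fin (N + 1) → ℝ → Ω → (Fin N → ℝ) → ℝ≥0∞} (h : JMeas W) (d : Fin (N + 1))
    (s : ℝ) : Measurable fun q : Ω × (Fin N → ℝ) => W d s q.1 q.2 :=
  Measurable.comp h (f := fun q : Ω × (Fin N → ℝ) => (d, s, q.1, q.2)) (by fun_prop)

lemma lintegral_coneSq_TW_le (N : ℕ) : ∃ C : ℝ≥0∞, C ≠ ∞ ∧ ∀ {Ω : Type} [MeasurableSpace Ω]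
    (μ : Measure Ω) [SFinite μ] (t : Fin N → ℝ) (p : ℤ) (κ : Fin N → ℤ)
    (b : ℤ → Ω → (Fin N → ℝ) → ℝ), AtomFam t p κ b →
    ∫⁻ x, coneSq μ (TW b) x ≤ C * ∑' m, energy μ (b m) := by
  obtain ⟨C, hC, h⟩ := lintegral_Tk_sq_le N
  obtain ⟨K, hK, hKs⟩ := tsum_kap_le
  obtain ⟨K', hK', hKi⟩ := lintegral_kap_div_le
  refine ⟨ENNReal.ofReal (2 ^ N * (N + 1)) * (K * (ENNReal.ofReal C * K')),
    by finiteness, fun {Ω} _ μ _ t p κ b hb => ?_⟩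
  have hkm : ∀ m : ℤ, Measurable fun s => kap s (2 ^ m) := fun m =>
    measurable_kap.comp (f := fun s : ℝ => (s, (2 : ℝ) ^ m)) (by fun_prop)
  set φ : ℝ → ℝ≥0∞ := fun s =>
    K * ∑' m : ℤ, ENNReal.ofReal (C * (kap s (2 ^ m) * s ^ (-2 : ℝ))) * energy μ (b m) with hφ
  have hφm : Measurable φ := by
    refine Measurable.const_mul (Measurable.tsum fun m => ?_) _
    have := hkm m
    fun_prop
  refine (lintegral_coneSq_le μ (jmeas_TW hb.meas) hφm fun s d hs => ?_).trans ?_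
  · have hW : ∀ m, Measurable fun q : Ω × (Fin N → ℝ) => ENNReal.ofReal |Tk d s (b m q.1) q.2| :=
      fun m => (jmeas_Tk (hb.meas m)).slice d s
    set w : ℤ → ℝ≥0∞ := fun m => ENNReal.ofReal (kap s (2 ^ m)) with hw
    have hk : ∀ m : ℤ, 0 < kap s (2 ^ m) := fun m => kap_pos hs (by positivity)
    have hw0 : ∀ m, w m ≠ 0 := fun m => by simpa [hw] using hk m
    have hwt : ∀ m, w m ≠ ∞ := fun m => ENNReal.ofReal_ne_top
    have hWw : ∀ m, Measurable fun q : Ω × (Fin N → ℝ) =>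
        (w m)⁻¹ * ENNReal.ofReal |Tk d s (b m q.1) q.2| ^ 2 := fun m =>
      ((hW m).pow_const 2).const_mul _
    calc ∫⁻ ω, (∫⁻ x, TW b d s ω x ^ 2) ∂μ
        ≤ ∫⁻ ω, (∫⁻ x, K * ∑' m, (w m)⁻¹ * ENNReal.ofReal |Tk d s (b m ω) x| ^ 2) ∂μ := by
          refine lintegral_mono fun ω => lintegral_mono fun x => ?_
          exact (sq_tsum_le_of_weight hw0 hwt _).trans (mul_le_mul_left (hKs s hs) _)
      _ = K * ∑' m, (w m)⁻¹ * ∫⁻ ω, (∫⁻ x, ENNReal.ofReal |Tk d s (b m ω) x| ^ 2) ∂μ := by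
          simp_rw [lintegral_const_mul' _ _ hK]
          congr 1
          have : ∀ ω, ∫⁻ x, ∑' m, (w m)⁻¹ * ENNReal.ofReal |Tk d s (b m ω) x| ^ 2 =
              ∑' m, (w m)⁻¹ * ∫⁻ x, ENNReal.ofReal |Tk d s (b m ω) x| ^ 2 := by
            intro ω
            rw [lintegral_tsum fun m => ((hWw m).of_uncurry_left (x := ω)
              (f := fun ω x => (w m)⁻¹ * ENNReal.ofReal |Tk d s (b m ω) x| ^ 2)).aemeasurable]
            exact tsum_congr fun m => lintegral_const_mul' _ _ (ENNReal.inv_ne_top.2 (hw0 m))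
          simp_rw [this]
          rw [lintegral_tsum]
          · exact tsum_congr fun m => lintegral_const_mul' _ _ (ENNReal.inv_ne_top.2 (hw0 m))
          · intro m
            exact ((((hW m).pow_const 2).lintegral_prod_right' (ν := volume)).const_mul
                _).aemeasurable
      _ ≤ φ s := by
          refine mul_le_mul_right (ENNReal.tsum_le_tsum fun m => ?_) _
          have h1 : ∫⁻ ω, (∫⁻ x, ENNReal.ofReal |Tk d s (b m ω) x| ^ 2) ∂μ ≤
              ENNReal.ofReal (C * (kap s (2 ^ m) ^ 2 * s ^ (-2 : ℝ))) * energy μ (b m) := by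
            rw [energy, ← lintegral_const_mul' _ _ ENNReal.ofReal_ne_top]
            refine lintegral_mono fun ω => ?_
            simp_rw [← ofReal_sq_eq]
            exact h d t m s (b m ω) hs ((hb.meas m).of_uncurry_left (x := ω)) (hb.int m ω)
              (hb.step m ω) (hb.mean m ω)
          refine (mul_le_mul_right h1 _).trans (le_of_eq ?_)
          rw [← mul_assoc, hw]
          congr 1
          dsimp only
          rw [← ENNReal.ofReal_inv_of_pos (hk m), ← ENNReal.ofReal_mul (inv_nonneg.2 (hk m).le)]
          congr 1
          field_simp [(hk m).ne']
  · rw [mul_assoc]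
    refine mul_le_mul_right ?_ _
    have hm : ∀ m : ℤ, Measurable fun s : ℝ =>
        ENNReal.ofReal s * (ENNReal.ofReal (C * (kap s (2 ^ m) * s ^ (-2 : ℝ))) *
            energy μ (b m)) := by
      intro m
      have := hkm m
      fun_prop
    have e : ∀ s, ENNReal.ofReal s * φ s = K * ∑' m : ℤ,
        ENNReal.ofReal s * (ENNReal.ofReal (C * (kap s (2 ^ m) * s ^ (-2 : ℝ))) *
            energy μ (b m)) := by
      intro s
      rw [hφ, ENNReal.tsum_mul_left]; ring
    simp_rw [e]
    rw [lintegral_const_mul' _ _ hK, lintegral_tsum fun m => (hm m).aemeasurable, mul_assoc]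
    refine mul_le_mul_right ?_ _
    rw [← ENNReal.tsum_mul_left]
    refine ENNReal.tsum_le_tsum fun m => ?_
    have e2 : ∀ s ∈ Set.Ioi (0 : ℝ),
        ENNReal.ofReal s * (ENNReal.ofReal (C * (kap s (2 ^ m) * s ^ (-2 : ℝ))) * energy μ (b m)) =
        (ENNReal.ofReal C * ENNReal.ofReal (kap s (2 ^ m) * s ^ (-1 : ℝ))) * energy μ (b m) := by
      intro s hs
      have hs : 0 < s := hs
      rw [← mul_assoc, ← ENNReal.ofReal_mul hs.le, ← ENNReal.ofReal_mul hC.le]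
      congr 2
      rw [show (-1 : ℝ) = 1 + -2 by norm_num, Real.rpow_add hs, Real.rpow_one]; ring
    rw [setLIntegral_congr_fun measurableSet_Ioi e2, lintegral_mul_const, lintegral_const_mul' _ _
      ENNReal.ofReal_ne_top]
    · exact mul_le_mul_left (mul_le_mul_right (hKi _ (by positivity)) _) _
    · have := hkm m
      fun_prop

lemma mul_wt_sq_le (N : ℕ) {s : ℝ} (hs : 0 < s) {v : Fin N → ℝ} (hv : 0 < ‖v‖) :
    s * wt 2 s v ^ 2 ≤ (‖v‖ ^ (N + 1))⁻¹ ^ 2 * (kap s ‖v‖ * s ^ (-1 : ℝ)) := by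
  set r := ‖v‖
  have hsr : 0 < s + r := by positivity
  have e : wt 2 s v = ((s + r) ^ (N + 2))⁻¹ := by
    rw [wt, Real.rpow_neg hsr.le]; norm_cast
  have hρ : 0 < min (s / r) (r / s) := lt_min (div_pos hs hv) (div_pos hv hs)
  have hρ1 : min (s / r) (r / s) ≤ 1 := by
    rcases le_total s r with h | h
    · exact (min_le_left _ _).trans ((div_le_one hv).2 h)
    · exact (min_le_right _ _).trans ((div_le_one hs).2 h)
  have h1 : (s * r / (s + r) ^ 2) ≤ min (s / r) (r / s) := by
    refine le_min ?_ ?_ <;> rw [div_le_div_iff₀ (by positivity) (by positivity)]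
    · nlinarith [mul_pos hs hv, mul_pos hs (pow_pos hs 2), mul_pos (mul_pos hs hs) hv]
    · nlinarith [mul_pos hs hv, mul_pos hv (pow_pos hv 2), mul_pos (mul_pos hv hs) hv]
  have h2 : (s * r / (s + r) ^ 2) ^ 2 ≤ kap s r := by
    refine (pow_le_pow_left₀ (by positivity) h1 2).trans ?_
    rw [kap, ← Real.rpow_natCast]
    exact Real.rpow_le_rpow_of_exponent_ge hρ hρ1 (by norm_num)
  have h3 : (r / (s + r)) ^ (2 * N) ≤ 1 :=
    pow_le_one₀ (by positivity) ((div_le_one hsr).2 (by linarith))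
  rw [e, Real.rpow_neg_one]
  calc s * ((s + r) ^ (N + 2))⁻¹ ^ 2
      = (r ^ (N + 1))⁻¹ ^ 2 * (((s * r / (s + r) ^ 2) ^ 2 * (r / (s + r)) ^ (2 * N)) * s⁻¹) := by
        have hv' : r ≠ 0 := hv.ne'
        generalize s + r = u at hsr
        have hu : u ≠ 0 := hsr.ne'
        rw [div_pow r u (2 * N)]
        field_simp
        ring
    _ ≤ (r ^ (N + 1))⁻¹ ^ 2 * ((kap s r * 1) * s⁻¹) := by
        have := (kap_pos hs hv).le
        gcongr
    _ = _ := by rw [mul_one]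

end

section

variable {N : ℕ}

lemma tsum_two_zpow_le (p : ℤ) :
    ∑' m : ℤ, (if m ≤ p then ENNReal.ofReal (2 ^ m) else 0) = 2 * ENNReal.ofReal (2 ^ p) := by
  have hinj : Function.Injective fun n : ℕ => p - (n : ℤ) := fun a b h => by
    simpa using h
  rw [← hinj.tsum_eq]
  · have e : ∀ n : ℕ, (if p - (n : ℤ) ≤ p then ENNReal.ofReal ((2 : ℝ) ^ (p - (n : ℤ))) else 0) =
        ENNReal.ofReal (2 ^ p) * (2⁻¹) ^ n := by
      intro n
      rw [if_pos (by omega), zpow_sub₀ two_ne_zero, zpow_natCast, div_eq_mul_inv,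
        ENNReal.ofReal_mul (by positivity), ← inv_pow, ENNReal.ofReal_pow (by positivity),
        ENNReal.ofReal_inv_of_pos two_pos, ENNReal.ofReal_ofNat]
    simp_rw [e]
    rw [ENNReal.tsum_mul_left, ENNReal.tsum_geometric, ENNReal.one_sub_inv_two, inv_inv, mul_comm]
  · intro m hm
    have : m ≤ p := by
      by_contra h
      simp [h] at hm
    exact ⟨(p - m).toNat, by simp; omega⟩

lemma le_rpow_half {a b : ℝ≥0∞} (h : a ^ 2 ≤ b) : a ≤ b ^ (1 / 2 : ℝ) := by
  have := ENNReal.rpow_le_rpow h (z := 1 / 2) (by norm_num)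
  rwa [← ENNReal.rpow_natCast, ← ENNReal.rpow_mul, show ((2 : ℕ) : ℝ) * (1 / 2) = 1 by norm_num,
    ENNReal.rpow_one] at this

lemma rpow_half_sq (a : ℝ≥0∞) : (a ^ (1 / 2 : ℝ)) ^ 2 = a := by
  rw [← ENNReal.rpow_natCast, ← ENNReal.rpow_mul]; norm_num

lemma sq_rpow_half (a : ℝ≥0∞) : (a ^ 2) ^ (1 / 2 : ℝ) = a := by
  rw [← ENNReal.rpow_natCast, ← ENNReal.rpow_mul]; norm_num

lemma sq_lintegral_abs_le_of_supp {t : Fin N → ℝ} {p : ℤ} {κ : Fin N → ℤ} {g : (Fin N → ℝ) → ℝ}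
    (hg : Measurable g) (hs : ∀ z, g z ≠ 0 → idx t p z = κ) :
    (∫⁻ z, ENNReal.ofReal |g z|) ^ 2 ≤
      ENNReal.ofReal (((2 : ℝ) ^ p) ^ N) * ∫⁻ z, ENNReal.ofReal (g z ^ 2) := by
  have hw : Measurable ((cube t p κ).indicator (1 : (Fin N → ℝ) → ℝ≥0∞)) :=
    measurable_one.indicator (measurableSet_cube t p κ)
  have h := sq_lintegral_mul_le' volume hw.aemeasurable
    (f := fun z => ENNReal.ofReal |g z|) (by fun_prop)
  have e : ∀ z (f : ℝ → ℝ≥0∞), f 0 = 0 →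
      (cube t p κ).indicator (1 : (Fin N → ℝ) → ℝ≥0∞) z * f (g z) = f (g z) := by
    intro z f hf
    by_cases hz : g z = 0
    · rw [hz, hf, mul_zero]
    · rw [Set.indicator_of_mem (mem_cube.2 (hs z hz))]; simp
  simp_rw [← ofReal_sq_eq] at h
  simp_rw [e _ (fun r => ENNReal.ofReal |r|) (by simp), e _ (fun r => ENNReal.ofReal (r ^ 2))
      (by simp)] at h
  rwa [lintegral_indicator_one (measurableSet_cube t p κ), volume_cube] at h

lemma coneSq_TW_le_far (N : ℕ) : ∃ C : ℝ≥0∞, C ≠ ∞ ∧ ∀ {Ω : Type} [MeasurableSpace Ω]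
    (μ : Measure Ω) [SFinite μ] (t : Fin N → ℝ) (p : ℤ) (c : Fin N → ℝ)
    (b : ℤ → Ω → (Fin N → ℝ) → ℝ), AtomFam t p (idx t p c) b →
    ∀ x : Fin N → ℝ, 4 * 2 ^ p ≤ ‖x - c‖ →
    coneSq μ (TW b) x ≤ C * (ENNReal.ofReal (2 ^ p) * ENNReal.ofReal (wt 1 (2 ^ p) (x - c))) ^ 2 *
      (ENNReal.ofReal (((2 : ℝ) ^ p) ^ N) * ∑' m, energy μ (b m)) := by
  obtain ⟨C, hC, h⟩ := abs_Tk_le_of_far N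
  obtain ⟨K', hK', hKi⟩ := lintegral_kap_div_le
  set C' : ℝ := C * 3 ^ ((N : ℝ) + 2) with hC'
  have hC'0 : 0 < C' := by positivity
  refine ⟨ENNReal.ofReal (2 ^ N * (N + 1)) * (2 * ENNReal.ofReal C' ^ 2 * K' *
    ENNReal.ofReal (2 ^ (N + 1)) ^ 2), by finiteness, fun {Ω} _ μ _ t p c b hb x hx => ?_⟩
  set a : ℝ := 2 ^ p with ha
  have ha0 : 0 < a := by positivity
  have hr : 0 < ‖x - c‖ := by linarith
  set V := ENNReal.ofReal (a ^ N) with hV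
  set EE := ∑' m, energy μ (b m) with hEE
  set Z : ℝ≥0∞ := 2 * ENNReal.ofReal a ^ 2 * (V * EE) with hZ
  set φ : ℝ → ℝ≥0∞ :=
    fun s => ENNReal.ofReal C' ^ 2 * ENNReal.ofReal (wt 2 s (x - c) ^ 2) * Z with hφ
  have hwm : Measurable fun s : ℝ => wt 2 s (x - c) := by unfold wt; fun_prop
  have hφm : Measurable φ := by fun_prop
  have hm1 : ∀ m, Measurable fun ω => ∫⁻ z, ENNReal.ofReal (b m ω z ^ 2) := fun m =>
    (((hb.meas m).pow_const 2).ennreal_ofReal).lintegral_prod_right' (ν := volume)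
  refine (coneSq_le μ x hφm fun y s d hy => ?_).trans ?_
  · have hs : 0 < s := (norm_nonneg y).trans_lt hy
    have hw0 := wt_nonneg 2 hs (x - c)
    have hz : ∀ z, idx t p z = idx t p c → ‖x - c‖ - a ≤ s + ‖x + y - z‖ := by
      intro z hz
      have h1 : ‖z - c‖ ≤ a := norm_sub_le_of_idx_eq hz
      have h2 : ‖x - c‖ ≤ ‖x + y - z‖ + ‖y‖ + ‖z - c‖ := by
        calc ‖x - c‖ = ‖(x + y - z) - y + (z - c)‖ := by congr 1; abel
          _ ≤ ‖(x + y - z) - y‖ + ‖z - c‖ := norm_add_le _ _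
          _ ≤ _ := by gcongr; exact norm_sub_le _ _
      linarith
    set A := ENNReal.ofReal C' * ENNReal.ofReal (wt 2 s (x - c)) with hA
    set v : ℤ → ℝ≥0∞ := fun m => if m ≤ p then ENNReal.ofReal (2 ^ m) else 0 with hv
    have hT : ∀ m ω, ENNReal.ofReal |Tk d s (b m ω) (x + y)| ≤
        A * (v m * ∫⁻ z, ENNReal.ofReal |b m ω z|) := by
      intro m ω
      by_cases hmp : m ≤ p
      · have h2m : (2 : ℝ) ^ m ≤ a := zpow_le_zpow_right₀ (by norm_num) hmp
        refine (h d t m s (x + y) (b m ω) hs (hb.int m ω) (hb.mean m ω) fun z hbz => ?_).trans ?_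
        · have := hz z (hb.supp m ω z hbz).2
          linarith
        · rw [hv, hA]
          simp only [hmp, if_true]
          rw [← mul_assoc, ← ENNReal.ofReal_mul hC'0.le, ← ENNReal.ofReal_mul (by positivity),
            ← lintegral_const_mul' _ _ ENNReal.ofReal_ne_top]
          refine lintegral_mono fun z => ?_
          by_cases hbz : b m ω z = 0
          · simp [hbz]
          · refine mul_le_mul_left (ENNReal.ofReal_le_ofReal ?_) _
            have h3 : s + ‖x - c‖ ≤ 3 * (s + ‖x + y - z‖) := by
              have := hz z (hb.supp m ω z hbz).2
              have := norm_nonneg (x + y - z)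
              linarith
            have := wt_le_of_le (β := 2) (by norm_num) hs (by norm_num) h3
            calc C * 2 ^ m * wt 2 s (x + y - z)
                ≤ C * 2 ^ m * (3 ^ ((N : ℝ) + 2) * wt 2 s (x - c)) := by gcongr
              _ = _ := by ring
      · have : b m ω = 0 := by
          funext z
          by_contra hne
          exact hmp (hb.supp m ω z hne).1
        simp [this, Tk]
    have hTW : ∀ ω, TW b d s ω (x + y) ^ 2 ≤ A ^ 2 * (2 * ENNReal.ofReal a ^ 2 *
        (V * ∑' m, ∫⁻ z, ENNReal.ofReal (b m ω z ^ 2))) := by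
      intro ω
      have h1 : TW b d s ω (x + y) ≤ A * ∑' m, v m * ∫⁻ z, ENNReal.ofReal |b m ω z| := by
        rw [← ENNReal.tsum_mul_left]
        exact ENNReal.tsum_le_tsum fun m => hT m ω
      refine (pow_le_pow_left' h1 2).trans ?_
      rw [mul_pow]
      refine mul_le_mul_right ((sq_tsum_mul_le _ _).trans ?_) _
      rw [hv, tsum_two_zpow_le, pow_two (ENNReal.ofReal a), ← mul_assoc 2, mul_assoc (2 * _)]
      refine mul_le_mul_right ?_ _
      rw [← ENNReal.tsum_mul_left, ← ENNReal.tsum_mul_left]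
      refine ENNReal.tsum_le_tsum fun m => mul_le_mul' ?_ ?_
      · dsimp only
        split_ifs with hmp
        · exact ENNReal.ofReal_le_ofReal (zpow_le_zpow_right₀ (by norm_num) hmp)
        · exact zero_le
      · exact sq_lintegral_abs_le_of_supp ((hb.meas m).of_uncurry_left (x := ω))
          fun z hz => (hb.supp m ω z hz).2
    calc ∫⁻ ω, TW b d s ω (x + y) ^ 2 ∂μ
        ≤ ∫⁻ ω, A ^ 2 * (2 * ENNReal.ofReal a ^ 2 *
          (V * ∑' m, ∫⁻ z, ENNReal.ofReal (b m ω z ^ 2))) ∂μ := lintegral_mono hTW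
      _ = A ^ 2 * Z := by
        rw [lintegral_const_mul' _ _ (by finiteness), lintegral_const_mul' _ _ (by finiteness),
          lintegral_const_mul' _ _ (by finiteness), lintegral_tsum fun m => (hm1 m).aemeasurable]
        rfl
      _ = φ s := by
        simp only [hφ, hA, mul_pow, ENNReal.ofReal_pow hw0]
  · rw [mul_assoc (ENNReal.ofReal (2 ^ N * (N + 1))), mul_assoc (ENNReal.ofReal (2 ^ N * (N + 1)))]
    refine mul_le_mul_right ?_ _
    set R := ENNReal.ofReal ((‖x - c‖ ^ (N + 1))⁻¹) with hR
    have h1 : ∀ s ∈ Set.Ioi (0 : ℝ), ENNReal.ofReal s * φ s ≤ (ENNReal.ofReal C' ^ 2 * R ^ 2 *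
        ENNReal.ofReal (kap s ‖x - c‖ * s ^ (-1 : ℝ))) * Z := by
      intro s hs
      have hs : 0 < s := hs
      have h2 := ENNReal.ofReal_le_ofReal (mul_wt_sq_le N hs hr)
      rw [ENNReal.ofReal_mul hs.le, ENNReal.ofReal_mul (by positivity),
        ENNReal.ofReal_pow (p := (‖x - c‖ ^ (N + 1))⁻¹) (by positivity)] at h2
      calc ENNReal.ofReal s * φ s = ENNReal.ofReal C' ^ 2 *
            (ENNReal.ofReal s * ENNReal.ofReal (wt 2 s (x - c) ^ 2)) * Z := by rw [hφ]; ring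
        _ ≤ ENNReal.ofReal C' ^ 2 * (R ^ 2 * ENNReal.ofReal (kap s ‖x - c‖ * s ^ (-1 : ℝ))) * Z :=
            mul_le_mul_left (mul_le_mul_right h2 _) _
        _ = _ := by ring
    have hkm : Measurable fun s : ℝ => kap s ‖x - c‖ :=
      measurable_kap.comp (f := fun s : ℝ => (s, ‖x - c‖)) (by fun_prop)
    refine (setLIntegral_mono' measurableSet_Ioi h1).trans ?_
    rw [lintegral_mul_const _ (by fun_prop), lintegral_const_mul' _ _ (by finiteness)]
    have hR2 : R ≤ ENNReal.ofReal (2 ^ (N + 1)) * ENNReal.ofReal (wt 1 a (x - c)) := by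
      rw [← ENNReal.ofReal_mul (by positivity)]
      refine ENNReal.ofReal_le_ofReal ?_
      have e : wt 1 a (x - c) = ((a + ‖x - c‖) ^ (N + 1))⁻¹ := by
        rw [wt, Real.rpow_neg (by positivity)]; norm_cast
      rw [e, ← div_eq_mul_inv, inv_eq_one_div, div_le_div_iff₀ (by positivity) (by positivity),
        one_mul, ← mul_pow]
      gcongr
      linarith
    calc _ ≤ ENNReal.ofReal C' ^ 2 *
          (ENNReal.ofReal (2 ^ (N + 1)) * ENNReal.ofReal (wt 1 a (x - c))) ^ 2 * K' * Z := by
          gcongr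
          exact hKi _ hr
      _ = _ := by rw [hZ]; ring

lemma exists_idx_eq (t : Fin N → ℝ) (p : ℤ) (κ : Fin N → ℤ) : ∃ c, idx t p c = κ := by
  by_contra! h
  have : cube t p κ = ∅ := Set.eq_empty_of_forall_notMem fun y hy => h y hy
  have h2 := volume_cube t p κ
  rw [this, measure_empty, eq_comm, ENNReal.ofReal_eq_zero] at h2
  exact absurd h2 (not_le.2 (by positivity))

lemma setLIntegral_rpow_half_le {α : Type*} [MeasurableSpace α] (μ : Measure α) {G : α → ℝ≥0∞}
    (hG : Measurable G) {B : Set α} :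
    ∫⁻ x in B, G x ^ (1 / 2 : ℝ) ∂μ ≤ (μ B * ∫⁻ x, G x ∂μ) ^ (1 / 2 : ℝ) := by
  refine le_rpow_half ?_
  have h := sq_lintegral_mul_le (μ.restrict B) (f := fun _ => (1 : ℝ≥0∞))
    (g := fun x => G x ^ (1 / 2 : ℝ)) (by fun_prop) (by fun_prop)
  simp only [one_mul, one_pow, lintegral_const, Measure.restrict_apply_univ, rpow_half_sq] at h
  exact h.trans (mul_le_mul_right (setLIntegral_le_lintegral _ _) _)

/-- The Lusin area integral of a martingale difference sequence living below a cube. -/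
lemma lintegral_coneSq_atom_le (N : ℕ) : ∃ C : ℝ≥0∞, C ≠ ∞ ∧ ∀ {Ω : Type} [MeasurableSpace Ω]
    (μ : Measure Ω) [SFinite μ] (t : Fin N → ℝ) (p : ℤ) (κ : Fin N → ℤ)
    (b : ℤ → Ω → (Fin N → ℝ) → ℝ), AtomFam t p κ b →
    ∫⁻ x, coneSq μ (TW b) x ^ (1 / 2 : ℝ) ≤
      C * (volume (cube t p κ) * ∑' m, energy μ (b m)) ^ (1 / 2 : ℝ) := by
  obtain ⟨C₁, hC₁, h₁⟩ := lintegral_coneSq_TW_le N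
  obtain ⟨C₂, hC₂, h₂⟩ := coneSq_TW_le_far N
  have hW := wtI_lt_top N (β := 1) one_pos
  refine ⟨(ENNReal.ofReal (8 ^ N) * C₁) ^ (1 / 2 : ℝ) + C₂ ^ (1 / 2 : ℝ) * wtI N 1,
    by finiteness, fun {Ω} _ μ _ t p κ b hb => ?_⟩
  obtain ⟨c, rfl⟩ := exists_idx_eq t p κ
  rw [volume_cube]
  have hm := measurable_coneSq μ (jmeas_TW hb.meas)
  set a : ℝ := 2 ^ p with ha
  have ha0 : 0 < a := by positivity
  set Z := ENNReal.ofReal (a ^ N) * ∑' m, energy μ (b m)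
  rw [← lintegral_add_compl _ (Metric.isOpen_ball (x := c) (ε := 4 * a)).measurableSet, add_mul]
  refine add_le_add ?_ ?_
  · refine (setLIntegral_rpow_half_le volume hm).trans ?_
    rw [← ENNReal.mul_rpow_of_nonneg _ _ (by norm_num)]
    refine ENNReal.rpow_le_rpow ?_ (by norm_num)
    rw [Real.volume_pi_ball _ (by positivity), Fintype.card_fin, show 2 * (4 * a) = 8 * a by ring,
      mul_pow, ENNReal.ofReal_mul (by positivity)]
    refine (mul_le_mul_right (h₁ μ t p _ b hb) _).trans (le_of_eq ?_)
    ring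
  · have h3 : ∀ x ∈ (Metric.ball c (4 * a))ᶜ, coneSq μ (TW b) x ^ (1 / 2 : ℝ) ≤
        C₂ ^ (1 / 2 : ℝ) * ENNReal.ofReal a * Z ^ (1 / 2 : ℝ) *
            ENNReal.ofReal (wt 1 a (x - c)) := by
      intro x hx
      have hx' : 4 * a ≤ ‖x - c‖ := by simpa [dist_eq_norm] using hx
      refine (ENNReal.rpow_le_rpow (h₂ μ t p c b hb x hx') (by norm_num)).trans (le_of_eq ?_)
      rw [ENNReal.mul_rpow_of_nonneg _ _ (by norm_num), ENNReal.mul_rpow_of_nonneg _ _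
          (by norm_num),
        sq_rpow_half]
      ring
    refine (setLIntegral_mono' Metric.isOpen_ball.measurableSet.compl h3).trans ?_
    refine (setLIntegral_le_lintegral _ _).trans ?_
    have hwm : Measurable fun x : Fin N → ℝ => ENNReal.ofReal (wt 1 a (x - c)) :=
      ((measurable_wt_right 1 a).comp (measurable_id.sub_const c)).ennreal_ofReal
    rw [lintegral_const_mul _ hwm,
      lintegral_sub_right_eq_self (fun v => ENNReal.ofReal (wt 1 a v)) c, lintegral_wt 1 ha0]
    refine le_of_eq ?_
    have : ENNReal.ofReal a * ENNReal.ofReal (a ^ (-1 : ℝ)) = 1 := by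
      rw [← ENNReal.ofReal_mul ha0.le, Real.rpow_neg_one, mul_inv_cancel₀ ha0.ne',
          ENNReal.ofReal_one]
    calc _ = C₂ ^ (1 / 2 : ℝ) * (ENNReal.ofReal a * ENNReal.ofReal (a ^ (-1 : ℝ))) *
          wtI N 1 * Z ^ (1 / 2 : ℝ) := by ring
      _ = _ := by rw [this, mul_one]

end

/-! ### Convergence of the martingale decomposition -/

section

variable {N : ℕ} {Ω : Type*} [MeasurableSpace Ω]

lemma tendsto_Tk_avg_zero (hN : 0 < N) (d : Fin (N + 1)) {s : ℝ} (hs : 0 < s) (t : Fin N → ℝ)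
    {h : (Fin N → ℝ) → ℝ} (hh : Integrable h) (x : Fin N → ℝ) :
    Tendsto (fun n : ℕ => Tk d s (avg (fun _ => t) n h) x) atTop (𝓝 0) := by
  have hb : ∀ n : ℕ, |Tk d s (avg (fun _ => t) n h) x| ≤
      (∫ z, |kd d (x - z) s|) * (∫ y, |h y|) * (1 / 2) ^ n := by
    intro n
    have h2 : ∀ z, |avg (fun _ => t) n h z| ≤ (∫ y, |h y|) * (1 / 2) ^ n := fun z => by
      refine (abs_avg_le t n hh z).trans ?_
      rw [div_eq_mul_inv, one_div, inv_pow, zpow_natCast]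
      have h0 : 0 ≤ ∫ y, |h y| := integral_nonneg fun _ => abs_nonneg _
      have h1 : (2 : ℝ) ^ n ≤ ((2 : ℝ) ^ n) ^ N :=
        le_self_pow₀ (one_le_pow₀ (by norm_num)) hN.ne'
      gcongr
    have hk := (integrable_kd_sub d x hs).abs
    calc |Tk d s (avg (fun _ => t) n h) x| ≤ ∫ z, |kd d (x - z) s * avg (fun _ => t) n h z| :=
          abs_integral_le_integral_abs
      _ ≤ ∫ z, |kd d (x - z) s| * ((∫ y, |h y|) * (1 / 2) ^ n) := by
          refine integral_mono (integrable_kd_mul d hs x (integrable_avg t n hh)).abs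
            (hk.mul_const _) fun z => ?_
          simp only [abs_mul]
          exact mul_le_mul_of_nonneg_left (h2 z) (abs_nonneg _)
      _ = _ := by rw [integral_mul_const]; ring
  refine squeeze_zero_norm hb ?_
  have := tendsto_pow_atTop_nhds_zero_of_lt_one (r := (1 / 2 : ℝ)) (by norm_num) (by norm_num)
  simpa using this.const_mul ((∫ z, |kd d (x - z) s|) * (∫ y, |h y|))

lemma tendsto_Tk_avg (d : Fin (N + 1)) {s : ℝ} (hs : 0 < s) (t : Fin N → ℝ)
    {h : (Fin N → ℝ) → ℝ} (hh : Integrable h) (x : Fin N → ℝ) :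
    Tendsto (fun n : ℕ => Tk d s (avg (fun _ => t) (-(n : ℤ)) h) x) atTop (𝓝 (Tk d s h x)) := by
  obtain ⟨C, hC, hlip⟩ := abs_kd_sub_le N
  obtain ⟨A, hA⟩ := exists_kd_bound N hs
  set w0 := wt 2 s (0 : Fin N → ℝ)
  have hgm := measurable_kd_sub d hs x
  have hpow : ∀ n : ℕ, (2 : ℝ) ^ (-(n : ℤ)) = (1 / 2) ^ n := fun n => by
    rw [zpow_neg, zpow_natCast, one_div, inv_pow]
  have hb : ∀ n : ℕ, (1 / 2 : ℝ) ^ n ≤ s / 2 →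
      ‖Tk d s (avg (fun _ => t) (-(n : ℤ)) h) x - Tk d s h x‖ ≤
      C * w0 * (∫ y, |h y|) * (1 / 2) ^ n := by
    intro n hn
    have hsw := (integral_avg_mul_swap t (-(n : ℤ)) hh hgm fun z => hA d _).2
    have ham := measurable_avg_single t (-(n : ℤ)) hgm
    have hagb : Integrable fun z => avg (fun _ => t) (-(n : ℤ)) (fun z => kd d (x - z) s) z * h z :=
      hh.bdd_mul (c := A) ham.aestronglyMeasurable
        (ae_of_all _ fun z => abs_avg_le_of_bound t _ (fun z => hA d _) z)
    have hkb := integrable_kd_mul d hs x hh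
    rw [Tk, Tk, hsw, ← integral_sub hagb hkb]
    have hpt : ∀ z, |avg (fun _ => t) (-(n : ℤ)) (fun z => kd d (x - z) s) z - kd d (x - z) s| ≤
        C * w0 * (1 / 2) ^ n := by
      intro z
      refine abs_avg_sub_le (integrable_kd_sub d x hs).integrableOn fun y hy => ?_
      have h1 : ‖(x - y) - (x - z)‖ ≤ (1 / 2) ^ n := by
        rw [sub_sub_sub_cancel_left, ← hpow]
        exact norm_sub_le_of_idx_eq hy.symm
      refine (hlip d (x - z) (x - y) s hs ?_).trans ?_
      · have := norm_nonneg (x - z)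
        linarith
      · calc C * ‖(x - y) - (x - z)‖ * wt 2 s (x - z) ≤ C * (1 / 2) ^ n * w0 := by
              have := wt_nonneg 2 hs (x - z)
              gcongr
              exact wt_le_of_zero (by norm_num) hs _
          _ = _ := by ring
    calc _ ≤ ∫ z, ‖avg (fun _ => t) (-(n : ℤ)) (fun z => kd d (x - z) s) z * h z -
          kd d (x - z) s * h z‖ := norm_integral_le_integral_norm _
      _ ≤ ∫ z, C * w0 * (1 / 2) ^ n * |h z| := by
          refine integral_mono (hagb.sub hkb).norm (hh.abs.const_mul _) fun z => ?_
          simp only [← sub_mul, Real.norm_eq_abs, abs_mul]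
          exact mul_le_mul_of_nonneg_right (hpt z) (abs_nonneg _)
      _ = _ := by rw [integral_const_mul]; ring
  have hlim := tendsto_pow_atTop_nhds_zero_of_lt_one (r := (1 / 2 : ℝ)) (by norm_num) (by norm_num)
  have hlim' := hlim.const_mul (C * w0 * (∫ y, |h y|))
  rw [mul_zero] at hlim'
  rw [tendsto_iff_norm_sub_tendsto_zero]
  refine squeeze_zero' (Eventually.of_forall fun _ => norm_nonneg _) ?_ hlim'
  filter_upwards [hlim.eventually_le_const (show 0 < s / 2 by positivity)] with n hn
  exact hb n hn

lemma abs_Tk_le_tsum_mdiff (hN : 0 < N) (d : Fin (N + 1)) {s : ℝ} (hs : 0 < s) (t : Fin N → ℝ)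
    {h : (Fin N → ℝ) → ℝ} (hh : Integrable h) (x : Fin N → ℝ) :
    ENNReal.ofReal |Tk d s h x| ≤
      ∑' m : ℤ, ENNReal.ofReal |Tk d s (mdiff (fun _ => t) m h) x| := by
  set a : ℤ → ℝ := fun k => Tk d s (avg (fun _ => t) k h) x with ha
  have hlim : Tendsto (fun n : ℕ => ENNReal.ofReal |a (-(n : ℤ)) - a n|) atTop
      (𝓝 (ENNReal.ofReal |Tk d s h x|)) := by
    have := (tendsto_Tk_avg d hs t hh x).sub (tendsto_Tk_avg_zero hN d hs t hh x)
    rw [sub_zero] at this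
    exact (ENNReal.continuous_ofReal.tendsto _).comp this.abs
  refine le_of_tendsto' hlim fun n => ?_
  have hstep : ∀ m : ℤ, Tk d s (mdiff (fun _ => t) m h) x = a (m - 1) - a m := by
    intro m
    simp only [ha, Tk, mdiff, mul_sub]
    exact integral_sub (integrable_kd_mul d hs x (integrable_avg t _ hh))
      (integrable_kd_mul d hs x (integrable_avg t _ hh))
  have hinj : Function.Injective fun i : ℕ => -(n : ℤ) + i + 1 := fun i j hij => by
    simpa using hij
  have hsum : a (-(n : ℤ)) - a n = ∑ i ∈ Finset.range (2 * n),
      (a (-(n : ℤ) + i) - a (-(n : ℤ) + ((i + 1 : ℕ) : ℤ))) := by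
    rw [Finset.sum_range_sub' fun i : ℕ => a (-(n : ℤ) + i)]
    congr 2 <;> push_cast <;> ring
  calc ENNReal.ofReal |a (-(n : ℤ)) - a n|
      ≤ ∑ i ∈ Finset.range (2 * n),
        ENNReal.ofReal |a (-(n : ℤ) + i) - a (-(n : ℤ) + ((i + 1 : ℕ) : ℤ))| := by
        rw [hsum, ← ENNReal.ofReal_sum_of_nonneg fun _ _ => abs_nonneg _]
        exact ENNReal.ofReal_le_ofReal (Finset.abs_sum_le_sum_abs _ _)
    _ = ∑ i ∈ Finset.range (2 * n),
        ENNReal.ofReal |Tk d s (mdiff (fun _ => t) (-(n : ℤ) + i + 1) h) x| := by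
        refine Finset.sum_congr rfl fun i _ => ?_
        rw [hstep]
        congr 4 <;> push_cast <;> ring
    _ ≤ ∑' i : ℕ, ENNReal.ofReal |Tk d s (mdiff (fun _ => t) (-(n : ℤ) + i + 1) h) x| :=
        ENNReal.sum_le_tsum _
    _ ≤ _ := ENNReal.tsum_comp_le_tsum_of_injective hinj
        fun m => ENNReal.ofReal |Tk d s (mdiff (fun _ => t) m h) x|

lemma lintegral_tsum_sq_rpow_half_le {α ι : Type*} [MeasurableSpace α] [Countable ι] (ν : Measure α)
    {g : ι → α → ℝ≥0∞} (hg : ∀ i, Measurable (g i)) :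
    (∫⁻ a, (∑' i, g i a) ^ 2 ∂ν) ^ (1 / 2 : ℝ) ≤ ∑' i, (∫⁻ a, g i a ^ 2 ∂ν) ^ (1 / 2 : ℝ) := by
  have hexp : ∀ u : ι → ℝ≥0∞, (∑' i, u i) ^ 2 = ∑' i, ∑' j, u i * u j := fun u => by
    rw [pow_two, ← ENNReal.tsum_mul_right]
    exact tsum_congr fun i => ENNReal.tsum_mul_left.symm
  rw [← sq_rpow_half (∑' i, _)]
  refine ENNReal.rpow_le_rpow ?_ (by norm_num)
  simp_rw [hexp]
  have hgg : ∀ i j, Measurable fun a => g i a * g j a := fun i j => (hg i).mul (hg j)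
  rw [lintegral_tsum fun i => (Measurable.tsum fun j => hgg i j).aemeasurable]
  refine ENNReal.tsum_le_tsum fun i => ?_
  rw [lintegral_tsum fun j => (hgg i j).aemeasurable]
  refine ENNReal.tsum_le_tsum fun j => ?_
  rw [← ENNReal.mul_rpow_of_nonneg _ _ (by norm_num)]
  exact le_rpow_half (sq_lintegral_mul_le ν (hg i).aemeasurable (hg j).aemeasurable)

lemma coneSq_eq_prod (μ : Measure Ω) [SFinite μ] {W : Fin (N + 1) → ℝ → Ω → (Fin N → ℝ) → ℝ≥0∞}
    (hW : JMeas W) (x : Fin N → ℝ) :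
    coneSq μ W x = ∫⁻ r, (ENNReal.ofReal (r.1.1.2 ^ ((1 - (N : ℝ)) / 2)) *
      W r.1.2 r.1.1.2 r.2 (x + r.1.1.1)) ^ 2 ∂((coneMeas N).prod μ) := by
  have hm := hW.integrand.comp
    (f := fun r : (((Fin N → ℝ) × ℝ) × Fin (N + 1)) × Ω => ((x, r.1), r.2)) (by fun_prop)
  simp only [Function.comp_def] at hm
  rw [lintegral_prod _ hm.aemeasurable]
  rfl

lemma coneSq_tsum_rpow_le {ι : Type*} [Countable ι] (μ : Measure Ω) [SFinite μ]
    {W : ι → Fin (N + 1) → ℝ → Ω → (Fin N → ℝ) → ℝ≥0∞} (hW : ∀ i, JMeas (W i)) (x : Fin N → ℝ) :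
    coneSq μ (fun d s ω x => ∑' i, W i d s ω x) x ^ (1 / 2 : ℝ) ≤
      ∑' i, coneSq μ (W i) x ^ (1 / 2 : ℝ) := by
  rw [coneSq_eq_prod μ (JMeas.tsum hW)]
  simp_rw [← ENNReal.tsum_mul_left]
  refine (lintegral_tsum_sq_rpow_half_le _ fun i => ?_).trans (le_of_eq ?_)
  · have h1 : Measurable fun r : (((Fin N → ℝ) × ℝ) × Fin (N + 1)) × Ω =>
        (r.1.2, r.1.1.2, r.2, x + r.1.1.1) := by fun_prop
    have h2 := Measurable.comp (hW i) h1
    have h3 : Measurable fun r : (((Fin N → ℝ) × ℝ) × Fin (N + 1)) × Ω =>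
        ENNReal.ofReal (r.1.1.2 ^ ((1 - (N : ℝ)) / 2)) := by fun_prop
    exact h3.mul h2
  · exact tsum_congr fun i => by rw [coneSq_eq_prod μ (hW i)]

lemma coneSq_mono (μ : Measure Ω) {W W' : Fin (N + 1) → ℝ → Ω → (Fin N → ℝ) → ℝ≥0∞}
    (h : ∀ᵐ ω ∂μ, ∀ d s x, 0 < s → W d s ω x ≤ W' d s ω x) (x : Fin N → ℝ) :
    coneSq μ W x ≤ coneSq μ W' x := by
  refine lintegral_mono_ae ?_
  have : ∀ᵐ q ∂coneMeas N, q.1 ∈ coneSet N := by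
    have h1 : ∀ᵐ q ∂(volume.restrict (coneSet N)), q ∈ coneSet N :=
      ae_restrict_mem (measurableSet_coneSet N)
    exact Measure.quasiMeasurePreserving_fst.ae h1
  filter_upwards [this] with q hq
  have hs : 0 < q.1.2 := (norm_nonneg _).trans_lt (coneSet_subset hq)
  refine lintegral_mono_ae ?_
  filter_upwards [h] with ω hω
  exact pow_le_pow_left' (mul_le_mul_right (hω _ _ _ hs) _) 2

lemma abs_integral_le_tsum {α ι : Type*} [MeasurableSpace α] [Countable ι] {ν : Measure α}
    {g : α → ℝ} {f : ι → α → ℝ} (hg : Integrable g ν) (hf : ∀ i, AEStronglyMeasurable (f i) ν)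
    (h : ∀ z, ∃ i, f i z = g z ∧ ∀ j ≠ i, f j z = 0) :
    ENNReal.ofReal |∫ z, g z ∂ν| ≤ ∑' i, ENNReal.ofReal |∫ z, f i z ∂ν| := by
  have h1 : ∀ z, ∑' i, f i z = g z := fun z => by
    obtain ⟨i, hi, hj⟩ := h z
    rw [tsum_eq_single i hj, hi]
  have h2 : ∀ z, ∑' i, ‖f i z‖ₑ = ‖g z‖ₑ := fun z => by
    obtain ⟨i, hi, hj⟩ := h z
    rw [tsum_eq_single i fun j hji => by rw [hj j hji, enorm_zero], hi]
  have h3 : ∑' i, ∫⁻ z, ‖f i z‖ₑ ∂ν ≠ ∞ := by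
    rw [← lintegral_tsum fun i => (hf i).enorm]
    simp_rw [h2]
    exact hg.2.ne
  simp_rw [← h1]
  rw [integral_tsum hf h3]
  have e : ∀ r : ℝ, ENNReal.ofReal |r| = ‖r‖ₑ := fun r => by
    rw [← Real.norm_eq_abs, ofReal_norm]
  simp_rw [e]
  exact enorm_tsum_le_tsum_enorm

end

/-! ### Stopping times -/

section

variable {N : ℕ} {Ω : Type*} [MeasurableSpace Ω]

/-- The part of the square function coming from scales at least `2^k`. -/
def tailS (D : ℤ → (Fin N → ℝ) → ℝ≥0∞) (k : ℤ) (y : Fin N → ℝ) : ℝ≥0∞ :=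
  ∑' l, if k ≤ l then D l y else 0

/-- Some ancestor of scale at least `2^m` of `x` has a child on which the truncated square function
exceeds `2^j`. -/
def Bad (t : Fin N → ℝ) (D : ℤ → (Fin N → ℝ) → ℝ≥0∞) (j m : ℤ) (x : Fin N → ℝ) : Prop :=
  ∃ k, m ≤ k ∧ ∃ y, idx t k y = idx t k x ∧ ENNReal.ofReal (2 ^ j) ^ 2 < tailS D k y

/-- The cube of scale `2^p` containing `x` is a maximal bad cube. -/
def MaxBad (t : Fin N → ℝ) (D : ℤ → (Fin N → ℝ) → ℝ≥0∞) (j p : ℤ) (x : Fin N → ℝ) : Prop :=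
  Bad t D j p x ∧ ¬ Bad t D j (p + 1) x

variable {t : Fin N → ℝ} {D : ℤ → (Fin N → ℝ) → ℝ≥0∞} {j j' m m' p p' : ℤ} {x y : Fin N → ℝ}

lemma tailS_le (D : ℤ → (Fin N → ℝ) → ℝ≥0∞) (k : ℤ) (y : Fin N → ℝ) : tailS D k y ≤ ∑' l, D l y :=
  ENNReal.tsum_le_tsum fun l => by split_ifs <;> simp

lemma le_tailS (D : ℤ → (Fin N → ℝ) → ℝ≥0∞) (k : ℤ) (y : Fin N → ℝ) : D k y ≤ tailS D k y := by
  refine le_trans ?_ (ENNReal.le_tsum k)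
  simp

lemma tailS_congr (hD : ∀ m x y, idx t (m - 1) x = idx t (m - 1) y → D m x = D m y)
    (h : idx t (m - 1) x = idx t (m - 1) y) : tailS D m x = tailS D m y := by
  refine tsum_congr fun l => ?_
  split_ifs with hl
  · exact hD l x y (idx_eq_of_le (by linarith) h)
  · rfl

lemma Bad.anti (h : Bad t D j m' x) (hm : m ≤ m') : Bad t D j m x := by
  obtain ⟨k, hk, h⟩ := h
  exact ⟨k, hm.trans hk, h⟩

lemma Bad.congr (h : Bad t D j m x) (hxy : idx t m x = idx t m y) : Bad t D j m y := by
  obtain ⟨k, hk, z, hz, h⟩ := h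
  exact ⟨k, hk, z, hz.trans (idx_eq_of_le hk hxy), h⟩

lemma Bad.mono (h : Bad t D j' m x) (hj : j ≤ j') : Bad t D j m x := by
  obtain ⟨k, hk, z, hz, h⟩ := h
  refine ⟨k, hk, z, hz, lt_of_le_of_lt ?_ h⟩
  gcongr
  norm_num

lemma MaxBad.congr (h : MaxBad t D j p x) (hxy : idx t p x = idx t p y) : MaxBad t D j p y :=
  ⟨h.1.congr hxy, fun h' => h.2 (h'.congr (idx_eq_of_le (by linarith) hxy).symm)⟩

lemma MaxBad.unique (h : MaxBad t D j p x) (h' : MaxBad t D j p' x) : p = p' := by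
  by_contra hne
  rcases lt_or_gt_of_ne hne with hlt | hlt
  · exact h.2 (h'.1.anti hlt)
  · exact h'.2 (h.1.anti hlt)

lemma bad_step_unique (h : Bad t D j m x ∧ ¬ Bad t D (j + 1) m x)
    (h' : Bad t D j' m x ∧ ¬ Bad t D (j' + 1) m x) : j = j' := by
  by_contra hne
  rcases lt_or_gt_of_ne hne with hlt | hlt
  · exact h.2 (h'.1.mono hlt)
  · exact h'.2 (h.1.mono hlt)

lemma volume_cube_mul_le (hD : ∀ m x y, idx t (m - 1) x = idx t (m - 1) y → D m x = D m y)
    (h : ENNReal.ofReal (2 ^ j) ^ 2 < tailS D m y) :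
    ENNReal.ofReal (2 ^ j) * ENNReal.ofReal ((2 ^ (m - 1)) ^ N) ≤
      ∫⁻ x, (∑' m, D m x) ^ (1 / 2 : ℝ) := by
  rw [← volume_cube t (m - 1) (idx t (m - 1) y), ← setLIntegral_const]
  refine (setLIntegral_mono' (measurableSet_cube _ _ _) fun z hz => ?_).trans
    (setLIntegral_le_lintegral _ _)
  rw [mem_cube] at hz
  rw [← tailS_congr hD hz] at h
  exact le_rpow_half (h.le.trans (tailS_le _ _ _))

lemma Bad.mul_le (hD : ∀ m x y, idx t (m - 1) x = idx t (m - 1) y → D m x = D m y)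
    (h : Bad t D j m x) : ENNReal.ofReal (2 ^ j) * ENNReal.ofReal ((2 ^ (m - 1)) ^ N) ≤
      ∫⁻ x, (∑' m, D m x) ^ (1 / 2 : ℝ) := by
  obtain ⟨k, hk, z, hz, h⟩ := h
  refine le_trans ?_ (volume_cube_mul_le hD h)
  gcongr
  norm_num

lemma exists_lt_ofReal_two_zpow {a : ℝ≥0∞} (ha : a ≠ ∞) : ∃ n : ℕ,
    a < ENNReal.ofReal (2 ^ (n : ℤ)) := by
  obtain ⟨n, hn⟩ := pow_unbounded_of_one_lt a.toReal (one_lt_two)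
  exact ⟨n, by rwa [zpow_natCast, ENNReal.lt_ofReal_iff_toReal_lt ha]⟩

lemma exists_max_int {P : ℤ → Prop} (hanti : ∀ a b, a ≤ b → P b → P a) {a b : ℤ} (ha : P a)
    (hb : ¬ P b) : ∃ c, a ≤ c ∧ P c ∧ ¬ P (c + 1) := by
  have hab : a ≤ b := le_of_not_ge fun h => hb (hanti _ _ h ha)
  obtain ⟨n, rfl⟩ := Int.le.dest hab
  clear hab
  induction n with
  | zero => exact absurd ha (by simpa using hb)
  | succ n ih =>
    by_cases h : P (a + n)
    · exact ⟨a + n, by linarith, h, by convert hb using 2; push_cast; ring⟩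
    · exact ih h

lemma Bad.exists_maxBad (hN : 0 < N)
    (hD : ∀ m x y, idx t (m - 1) x = idx t (m - 1) y → D m x = D m y)
    (hR : ∫⁻ x, (∑' m, D m x) ^ (1 / 2 : ℝ) ≠ ∞) (h : Bad t D j m x) :
    ∃ p, m ≤ p ∧ MaxBad t D j p x := by
  have hj : (0 : ℝ) < 2 ^ j := by positivity
  obtain ⟨n, hn⟩ := exists_lt_ofReal_two_zpow (ENNReal.div_ne_top hR (ENNReal.ofReal_pos.2 hj).ne')
  refine exists_max_int (P := fun k => Bad t D j k x) (fun a b hab hb => hb.anti hab) h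
    (b := n + 1) fun hb => ?_
  have h1 := hb.mul_le hD
  rw [ENNReal.div_lt_iff (Or.inl (ENNReal.ofReal_pos.2 hj).ne') (Or.inl (by finiteness))] at hn
  refine (hn.trans_le ((le_of_eq (mul_comm _ _)).trans ((mul_le_mul_right ?_ _).trans h1))).false
  refine ENNReal.ofReal_le_ofReal ?_
  rw [add_sub_cancel_right, zpow_natCast]
  exact le_self_pow₀ (one_le_pow₀ (by norm_num)) hN.ne'

lemma exists_bad_step (hD : ∀ m x y, idx t (m - 1) x = idx t (m - 1) y → D m x = D m y)
    (hR : ∫⁻ x, (∑' m, D m x) ^ (1 / 2 : ℝ) ≠ ∞) (h : D m x ≠ 0) :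
    ∃ j, Bad t D j m x ∧ ¬ Bad t D (j + 1) m x := by
  have hj : (0 : ℝ) < (2 ^ (m - 1)) ^ N := by positivity
  obtain ⟨n, hn⟩ := exists_lt_ofReal_two_zpow (ENNReal.div_ne_top hR (ENNReal.ofReal_pos.2 hj).ne')
  obtain ⟨n', hn'⟩ := exists_lt_ofReal_two_zpow
    (ENNReal.inv_ne_top.2 ((ENNReal.rpow_pos_of_nonneg (p := (1 / 2 : ℝ)) (pos_iff_ne_zero.2 h)
      (by norm_num)).ne'))
  have hlow : Bad t D (-n') m x := by
    refine ⟨m, le_rfl, x, rfl, lt_of_lt_of_le ?_ (le_tailS D m x)⟩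
    have h2 : (0 : ℝ) < 2 ^ (n' : ℤ) := by positivity
    rw [zpow_neg, ENNReal.ofReal_inv_of_pos h2, ← rpow_half_sq (D m x)]
    refine ENNReal.pow_lt_pow_left two_ne_zero ?_
    rwa [ENNReal.inv_lt_iff_inv_lt]
  have hhigh : ¬ Bad t D n m x := fun hb => by
    rw [ENNReal.div_lt_iff (Or.inl (ENNReal.ofReal_pos.2 hj).ne') (Or.inl (by finiteness))] at hn
    exact (hn.trans_le (hb.mul_le hD)).false
  obtain ⟨c, -, hc⟩ := exists_max_int (P := fun j => Bad t D j m x)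
    (fun a b hab hb => hb.mono hab) hlow hhigh
  exact ⟨c, hc⟩

lemma tsum_not_bad_le (t : Fin N → ℝ) (D : ℤ → (Fin N → ℝ) → ℝ≥0∞) (j : ℤ) (x : Fin N → ℝ)
    [DecidablePred fun m => ¬ Bad t D j m x] :
    ∑' m, (if ¬ Bad t D j m x then D m x else 0) ≤ ENNReal.ofReal (2 ^ j) ^ 2 := by
  rw [ENNReal.tsum_eq_iSup_sum]
  refine iSup_le fun s => ?_
  rw [← Finset.sum_filter]
  rcases (s.filter fun m => ¬ Bad t D j m x).eq_empty_or_nonempty with hs | hs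
  · simp [hs]
  · have hmin := Finset.min'_mem _ hs
    set m0 := Finset.min' _ hs
    have h1 : tailS D m0 x ≤ ENNReal.ofReal (2 ^ j) ^ 2 := by
      by_contra! hlt
      exact (Finset.mem_filter.1 hmin).2 ⟨m0, le_rfl, x, rfl, hlt⟩
    refine le_trans ?_ h1
    refine le_trans (le_of_eq (Finset.sum_congr rfl fun m hm => ?_))
      (ENNReal.sum_le_tsum (s.filter fun m => ¬ Bad t D j m x))
    rw [if_pos (Finset.min'_le _ _ hm)]

lemma MaxBad.volume_le (hD : ∀ m x y, idx t (m - 1) x = idx t (m - 1) y → D m x = D m y)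
    (h : MaxBad t D j p x) : volume (cube t p (idx t p x)) ≤ ENNReal.ofReal (2 ^ N) *
      volume {z | idx t p z = idx t p x ∧ MaxBad t D j p z ∧
        ENNReal.ofReal (2 ^ j) < (∑' m, D m z) ^ (1 / 2 : ℝ)} := by
  obtain ⟨k, hk, y, hy, hlt⟩ := h.1
  obtain rfl : k = p := by
    by_contra hne
    exact h.2 ⟨k, by omega, y, hy, hlt⟩
  have h2 : (0 : ℝ) < 2 ^ N := by positivity
  have hv : volume (cube t k (idx t k x)) = ENNReal.ofReal (2 ^ N) *
      volume (cube t (k - 1) (idx t (k - 1) y)) := by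
    rw [volume_cube, volume_cube, ← ENNReal.ofReal_mul h2.le, ← mul_pow,
        ← zpow_one_add₀ two_ne_zero]
    congr 3
    ring
  rw [hv]
  gcongr
  intro z hz
  rw [mem_cube] at hz
  have hzx := (idx_eq_of_le (show k - 1 ≤ k by linarith) hz).trans hy
  refine ⟨hzx, h.congr hzx.symm, ?_⟩
  rw [← tailS_congr hD hz, ← rpow_half_sq (tailS D k z)] at hlt
  exact (lt_of_pow_lt_pow_left' 2 hlt).trans_le
    (ENNReal.rpow_le_rpow (tailS_le _ _ _) (by norm_num))

lemma measurableSet_of_idx {A : (Fin N → ℝ) → Prop} (m : ℤ)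
    (h : ∀ x y, idx t m x = idx t m y → A x → A y) : MeasurableSet {x | A x} := by
  have : {x | A x} = idx t m ⁻¹' {κ | ∃ x, idx t m x = κ ∧ A x} := by
    ext x
    exact ⟨fun hx => ⟨x, rfl, hx⟩, fun ⟨y, hy, hA⟩ => h y x hy hA⟩
  rw [this]
  exact measurable_idx t m (Set.to_countable _).measurableSet

lemma measurableSet_maxBad (t : Fin N → ℝ) (D : ℤ → (Fin N → ℝ) → ℝ≥0∞) (j m : ℤ) :
    MeasurableSet {x | MaxBad t D j m x} :=
  measurableSet_of_idx m fun _ _ h hb => hb.congr h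

lemma tsum_two_zpow_lt_le (v : ℝ≥0∞) [DecidablePred fun j : ℤ => ENNReal.ofReal (2 ^ j) < v] :
    ∑' j : ℤ, (if ENNReal.ofReal (2 ^ j) < v then ENNReal.ofReal (2 ^ (j + 1)) else 0) ≤ 4 * v := by
  rcases eq_or_ne v ∞ with rfl | hv
  · simp
  rcases eq_or_ne v 0 with rfl | hv0
  · simp
  have hv' : 0 < v.toReal := ENNReal.toReal_pos hv0 hv
  have hle : ENNReal.ofReal (2 ^ Int.log 2 v.toReal) ≤ v :=
    ENNReal.ofReal_le_of_le_toReal (by exact_mod_cast Int.zpow_log_le_self (b := 2) one_lt_two hv')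
  calc _ ≤ ∑' j : ℤ, 2 * (if j ≤ Int.log 2 v.toReal then ENNReal.ofReal (2 ^ j) else 0) := by
        refine ENNReal.tsum_le_tsum fun j => ?_
        split_ifs with h1 h2
        · rw [zpow_add_one₀ two_ne_zero, mul_comm, ENNReal.ofReal_mul zero_le_two,
              ENNReal.ofReal_ofNat]
        · exfalso
          apply h2
          rw [ENNReal.ofReal_lt_iff_lt_toReal (by positivity) hv] at h1
          have := (Int.zpow_le_iff_le_log (b := 2) one_lt_two hv' (x := j)).1
              (by exact_mod_cast h1.le)
          exact this
        · exact zero_le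
        · exact zero_le
    _ = 4 * ENNReal.ofReal (2 ^ Int.log 2 v.toReal) := by
        rw [ENNReal.tsum_mul_left, tsum_two_zpow_le, ← mul_assoc]; norm_num
    _ ≤ 4 * v := by gcongr

end

/-! ### The one-parameter inequality -/

section

variable {N : ℕ} {Ω : Type*} [MeasurableSpace Ω]

/-- The part of the cube of scale `2^p` and index `κ`, at scale `2^m`, that belongs to the atom at
level `2^j`. -/
def atomSet (t : Fin N → ℝ) (D : ℤ → (Fin N → ℝ) → ℝ≥0∞) (i : ℤ × ℤ × (Fin N → ℤ)) (m : ℤ) :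
    Set (Fin N → ℝ) :=
  {z | idx t i.2.1 z = i.2.2 ∧ m ≤ i.2.1 ∧ MaxBad t D i.1 i.2.1 z ∧ ¬ Bad t D (i.1 + 1) m z}

/-- The atoms of a vector-valued function. -/
def atomPart (t : Fin N → ℝ) (D : ℤ → (Fin N → ℝ) → ℝ≥0∞) (h : Ω → (Fin N → ℝ) → ℝ)
    (i : ℤ × ℤ × (Fin N → ℤ)) (m : ℤ) (ω : Ω) : (Fin N → ℝ) → ℝ :=
  (atomSet t D i m).indicator (mdiff (fun _ => t) m (h ω))

variable {t : Fin N → ℝ} {D : ℤ → (Fin N → ℝ) → ℝ≥0∞} {h : Ω → (Fin N → ℝ) → ℝ}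

lemma atomSet_congr {i : ℤ × ℤ × (Fin N → ℤ)} {m : ℤ} {x y : Fin N → ℝ}
    (hxy : idx t m x = idx t m y)
    (hx : x ∈ atomSet t D i m) : y ∈ atomSet t D i m :=
  ⟨(idx_eq_of_le hx.2.1 hxy).symm.trans hx.1, hx.2.1, hx.2.2.1.congr (idx_eq_of_le hx.2.1 hxy),
    fun hb => hx.2.2.2 (hb.congr hxy.symm)⟩

lemma measurableSet_atomSet (t : Fin N → ℝ) (D : ℤ → (Fin N → ℝ) → ℝ≥0∞)
    (i : ℤ × ℤ × (Fin N → ℤ)) (m : ℤ) : MeasurableSet (atomSet t D i m) :=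
  measurableSet_of_idx m fun _ _ => atomSet_congr

lemma measurable_atomPart (t : Fin N → ℝ) (D : ℤ → (Fin N → ℝ) → ℝ≥0∞)
    (hh : Measurable fun q : Ω × (Fin N → ℝ) => h q.1 q.2) (i : ℤ × ℤ × (Fin N → ℤ)) (m : ℤ) :
    Measurable fun q : Ω × (Fin N → ℝ) => atomPart t D h i m q.1 q.2 :=
  (measurable_mdiff t m hh).indicator (measurable_snd (measurableSet_atomSet t D i m))

lemma atomFam_atomPart (hh : Measurable fun q : Ω × (Fin N → ℝ) => h q.1 q.2)
    (hi : ∀ ω, Integrable (h ω)) (i : ℤ × ℤ × (Fin N → ℤ)) :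
    AtomFam t i.2.1 i.2.2 (atomPart t D h i) where
  meas := measurable_atomPart t D hh i
  int m ω := (integrable_mdiff t m (hi ω)).indicator (measurableSet_atomSet t D i m)
  step m ω x y hxy := by
    have h2 := idx_eq_of_le (show m - 1 ≤ m by linarith) hxy
    by_cases hx : x ∈ atomSet t D i m
    · rw [atomPart, Set.indicator_of_mem hx, Set.indicator_of_mem (atomSet_congr h2 hx),
        mdiff_congr hxy]
    · rw [atomPart, Set.indicator_of_notMem hx,
        Set.indicator_of_notMem fun hy => hx (atomSet_congr h2.symm hy)]
  mean m ω κ' := by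
    by_cases hx : ∃ x ∈ cube t m κ', x ∈ atomSet t D i m
    · obtain ⟨x, hxc, hx⟩ := hx
      rw [← setIntegral_cube_mdiff t m κ' (hi ω)]
      refine setIntegral_congr_fun (measurableSet_cube _ _ _) fun z hz => ?_
      rw [mem_cube] at hz hxc
      exact Set.indicator_of_mem (atomSet_congr (hxc.trans hz.symm) hx) _
    · push Not at hx
      exact setIntegral_eq_zero_of_forall_eq_zero fun z hz => Set.indicator_of_notMem (hx z hz) _
  supp m ω z hz := by
    have := Set.mem_of_indicator_ne_zero hz
    exact ⟨this.2.1, this.1⟩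

lemma tsum_energy_atomPart (μ : Measure Ω) [SFinite μ]
    (hh : Measurable fun q : Ω × (Fin N → ℝ) => h q.1 q.2)
    (hDh : ∀ m x, D m x = ∫⁻ ω, ENNReal.ofReal (mdiff (fun _ => t) m (h ω) x ^ 2) ∂μ)
    (i : ℤ × ℤ × (Fin N → ℤ)) :
    ∑' m, energy μ (atomPart t D h i m) = ∫⁻ z, ∑' m, (atomSet t D i m).indicator (D m) z := by
  have hDm : ∀ m, Measurable (D m) := fun m => by
    simp only [funext (hDh m)]
    exact (((measurable_mdiff t m hh).pow_const 2).ennreal_ofReal).lintegral_prod_left'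
  rw [lintegral_tsum fun m => ((hDm m).indicator (measurableSet_atomSet t D i m)).aemeasurable]
  refine tsum_congr fun m => ?_
  rw [energy, lintegral_lintegral_swap
    (((measurable_atomPart t D hh i m).pow_const 2).ennreal_ofReal).aemeasurable]
  refine lintegral_congr fun z => ?_
  by_cases hz : z ∈ atomSet t D i m
  · simp only [atomPart, Set.indicator_of_mem hz, hDh]
  · simp [atomPart, Set.indicator_of_notMem hz]

lemma atom_norm_le (μ : Measure Ω) [SFinite μ]
    (hh : Measurable fun q : Ω × (Fin N → ℝ) => h q.1 q.2)
    (hDh : ∀ m x, D m x = ∫⁻ ω, ENNReal.ofReal (mdiff (fun _ => t) m (h ω) x ^ 2) ∂μ)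
    (i : ℤ × ℤ × (Fin N → ℤ)) :
    (volume (cube t i.2.1 i.2.2) * ∑' m, energy μ (atomPart t D h i m)) ^ (1 / 2 : ℝ) ≤
      ENNReal.ofReal (2 ^ (i.1 + 1)) * (ENNReal.ofReal (2 ^ N) *
        volume {z | idx t i.2.1 z = i.2.2 ∧ MaxBad t D i.1 i.2.1 z ∧
          ENNReal.ofReal (2 ^ i.1) < (∑' m, D m z) ^ (1 / 2 : ℝ)}) := by
  classical
  have hD : ∀ m x y, idx t (m - 1) x = idx t (m - 1) y → D m x = D m y := fun m x y hxy => by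
    rw [hDh, hDh]
    exact lintegral_congr fun ω => by rw [mdiff_congr hxy]
  by_cases hx : ∃ x, idx t i.2.1 x = i.2.2 ∧ MaxBad t D i.1 i.2.1 x
  · obtain ⟨x, hxi, hx⟩ := hx
    have hE : ∑' m, energy μ (atomPart t D h i m) ≤
        ENNReal.ofReal (2 ^ (i.1 + 1)) ^ 2 * volume (cube t i.2.1 i.2.2) := by
      rw [tsum_energy_atomPart μ hh hDh, ← lintegral_indicator_const (measurableSet_cube _ _ _)]
      refine lintegral_mono fun z => ?_
      by_cases hz : z ∈ cube t i.2.1 i.2.2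
      · rw [Set.indicator_of_mem hz]
        refine le_trans (ENNReal.tsum_le_tsum fun m => ?_) (tsum_not_bad_le t D (i.1 + 1) z)
        by_cases hm : z ∈ atomSet t D i m
        · rw [Set.indicator_of_mem hm, if_pos hm.2.2.2]
        · rw [Set.indicator_of_notMem hm]; exact zero_le
      · refine le_trans (le_of_eq ?_) zero_le
        exact ENNReal.tsum_eq_zero.2 fun m => Set.indicator_of_notMem (fun hm => hz hm.1) _
    calc _ ≤ ((ENNReal.ofReal (2 ^ (i.1 + 1)) * volume (cube t i.2.1 i.2.2)) ^ 2) ^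
        (1 / 2 : ℝ) := by
          refine ENNReal.rpow_le_rpow ((mul_le_mul_right hE _).trans (le_of_eq ?_)) (by norm_num)
          ring
      _ = ENNReal.ofReal (2 ^ (i.1 + 1)) * volume (cube t i.2.1 i.2.2) := sq_rpow_half _
      _ ≤ _ := by
          gcongr
          rw [← hxi]
          exact hx.volume_le hD
  · rw [tsum_energy_atomPart μ hh hDh]
    refine le_trans (le_of_eq ?_) zero_le
    have : ∀ z, ∑' m, (atomSet t D i m).indicator (D m) z = 0 := fun z =>
      ENNReal.tsum_eq_zero.2 fun m =>
        Set.indicator_of_notMem (fun hm => hx ⟨z, hm.1, hm.2.2.1⟩) _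
    simp [this]

lemma tsum_atom_volume_le (t : Fin N → ℝ) {D : ℤ → (Fin N → ℝ) → ℝ≥0∞}
    (hDm : ∀ m, Measurable (D m)) :
    ∑' i : ℤ × ℤ × (Fin N → ℤ), ENNReal.ofReal (2 ^ (i.1 + 1)) *
        volume {z | idx t i.2.1 z = i.2.2 ∧ MaxBad t D i.1 i.2.1 z ∧
          ENNReal.ofReal (2 ^ i.1) < (∑' m, D m z) ^ (1 / 2 : ℝ)} ≤
      4 * ∫⁻ x, (∑' m, D m x) ^ (1 / 2 : ℝ) := by
  classical
  have hSm : Measurable fun z => (∑' m, D m z) ^ (1 / 2 : ℝ) := (Measurable.tsum hDm).pow_const _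
  set S : ℤ × ℤ × (Fin N → ℤ) → Set (Fin N → ℝ) := fun i =>
    {z | idx t i.2.1 z = i.2.2 ∧ MaxBad t D i.1 i.2.1 z ∧
          ENNReal.ofReal (2 ^ i.1) < (∑' m, D m z) ^ (1 / 2 : ℝ)} with hS
  have hSms : ∀ i, MeasurableSet (S i) := fun i =>
    (measurableSet_cube t i.2.1 i.2.2).inter ((measurableSet_maxBad t D i.1 i.2.1).inter
      (measurableSet_lt measurable_const hSm))
  calc _ = ∫⁻ z, ∑' i, (S i).indicator (fun _ => ENNReal.ofReal (2 ^ (i.1 + 1))) z := by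
        rw [lintegral_tsum fun i => (measurable_const.indicator (hSms i)).aemeasurable]
        exact tsum_congr fun i => (lintegral_indicator_const (hSms i) _).symm
    _ ≤ ∫⁻ z, 4 * (∑' m, D m z) ^ (1 / 2 : ℝ) := by
        refine lintegral_mono fun z => ?_
        refine le_trans ?_ (tsum_two_zpow_lt_le _)
        rw [ENNReal.tsum_prod']
        refine ENNReal.tsum_le_tsum fun j => ?_
        by_cases hp : ENNReal.ofReal (2 ^ j) < (∑' m, D m z) ^ (1 / 2 : ℝ) ∧ ∃ p, MaxBad t D j p z
        · obtain ⟨hj, p, hp⟩ := hp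
          rw [if_pos hj, tsum_eq_single (p, idx t p z)]
          · exact Set.indicator_le_self _ _ _
          · rintro ⟨p', κ⟩ hne
            refine Set.indicator_of_notMem (fun hz => hne ?_) _
            obtain rfl := hp.unique hz.2.1
            exact Prod.ext rfl hz.1.symm
        · refine le_trans (le_of_eq (ENNReal.tsum_eq_zero.2 fun q => ?_)) zero_le
          exact Set.indicator_of_notMem (fun hz => hp ⟨hz.2.2, _, hz.2.1⟩) _
    _ = _ := lintegral_const_mul _ hSm

lemma abs_Tk_le_tsum_TW (hN : 0 < N) (μ : Measure Ω) [SFinite μ]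
    (hh : Measurable fun q : Ω × (Fin N → ℝ) => h q.1 q.2) (hi : ∀ ω, Integrable (h ω))
    (hDh : ∀ m x, D m x = ∫⁻ ω, ENNReal.ofReal (mdiff (fun _ => t) m (h ω) x ^ 2) ∂μ)
    (hR : ∫⁻ x, (∑' m, D m x) ^ (1 / 2 : ℝ) ≠ ∞) :
    ∀ᵐ ω ∂μ, ∀ d s x, 0 < s → ENNReal.ofReal |Tk d s (h ω) x| ≤
      ∑' i, TW (atomPart t D h i) d s ω x := by
  have hD : ∀ m x y, idx t (m - 1) x = idx t (m - 1) y → D m x = D m y := fun m x y hxy => by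
    rw [hDh, hDh]
    exact lintegral_congr fun ω => by rw [mdiff_congr hxy]
  choose c hc using fun (m : ℤ) (κ : Fin N → ℤ) => exists_idx_eq t m κ
  have hgood : ∀ᵐ ω ∂μ, ∀ m κ, D m (c (m - 1) κ) = 0 → mdiff (fun _ => t) m (h ω)
      (c (m - 1) κ) = 0 := by
    rw [ae_all_iff]
    intro m
    rw [ae_all_iff]
    intro κ
    by_cases h0 : D m (c (m - 1) κ) = 0
    · have h1 := h0
      have hm : Measurable fun ω => ENNReal.ofReal (mdiff (fun _ => t) m (h ω) (c (m - 1) κ) ^ 2) :=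
        ((measurable_mdiff t m hh).comp
          (f := fun ω : Ω => (ω, c (m - 1) κ)) (by fun_prop)).pow_const 2 |>.ennreal_ofReal
      rw [hDh, lintegral_eq_zero_iff hm] at h1
      filter_upwards [h1] with ω hω _
      have h2 := ENNReal.ofReal_eq_zero.1 hω
      exact pow_eq_zero_iff two_ne_zero |>.1 (le_antisymm h2 (sq_nonneg _))
    · exact ae_of_all _ fun ω h' => absurd h' h0
  filter_upwards [hgood] with ω hω d s x hs
  refine (abs_Tk_le_tsum_mdiff hN d hs t (hi ω) x).trans ?_
  simp only [TW]
  rw [ENNReal.tsum_comm]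
  refine ENNReal.tsum_le_tsum fun m => ?_
  refine abs_integral_le_tsum (integrable_kd_mul d hs x (integrable_mdiff t m (hi ω)))
    (fun i => (integrable_kd_mul d hs x
      ((atomFam_atomPart hh hi i).int m ω)).aestronglyMeasurable) fun z => ?_
  by_cases hz : D m z = 0
  · have hz' : mdiff (fun _ => t) m (h ω) z = 0 := by
      rw [mdiff_congr (hc (m - 1) (idx t (m - 1) z)).symm]
      exact hω m _ (by rw [hD m _ z (hc _ _), hz])
    have hall : ∀ i, atomPart t D h i m ω z = 0 := fun i => by
      rw [atomPart, Set.indicator_apply_eq_zero]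
      exact fun _ => hz'
    exact ⟨0, by rw [hall, hz'], fun i _ => by rw [hall, mul_zero]⟩
  · obtain ⟨j, hj⟩ := exists_bad_step hD hR hz
    obtain ⟨p, hmp, hp⟩ := hj.1.exists_maxBad hN hD hR
    refine ⟨(j, p, idx t p z), ?_, ?_⟩
    · rw [atomPart, Set.indicator_of_mem]
      exact ⟨rfl, hmp, hp, hj.2⟩
    · rintro ⟨j', p', κ'⟩ hne
      rw [atomPart, Set.indicator_of_notMem, mul_zero]
      rintro ⟨h1, h2, h3, h4⟩
      obtain rfl := bad_step_unique hj ⟨h3.1.anti h2, h4⟩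
      obtain rfl := hp.unique h3
      exact hne (by rw [h1])

/-- The vector-valued one-parameter estimate: the cone square function is dominated in `L¹` by the
dyadic square function. -/
lemma lintegral_coneSq_le_dyadic (hN : 0 < N) : ∃ C : ℝ≥0∞, C ≠ ∞ ∧
    ∀ {Ω : Type} [MeasurableSpace Ω] (μ : Measure Ω) [SFinite μ] (t : Fin N → ℝ)
      (h : Ω → (Fin N → ℝ) → ℝ), (Measurable fun q : Ω × (Fin N → ℝ) => h q.1 q.2) →
      (∀ ω, Integrable (h ω)) →
      (∫⁻ x, (∑' m, ∫⁻ ω, ENNReal.ofReal (mdiff (fun _ => t) m (h ω) x ^ 2) ∂μ) ^ (1 / 2 : ℝ)) ≠ ∞ →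
      ∫⁻ x, coneSq μ (fun d s ω x => ENNReal.ofReal |Tk d s (h ω) x|) x ^ (1 / 2 : ℝ) ≤
        C * ∫⁻ x, (∑' m, ∫⁻ ω, ENNReal.ofReal (mdiff (fun _ => t) m (h ω) x ^ 2) ∂μ) ^
            (1 / 2 : ℝ) := by
  obtain ⟨C, hC, hat⟩ := lintegral_coneSq_atom_le N
  refine ⟨C * (ENNReal.ofReal (2 ^ N) * 4), by finiteness, fun {Ω} _ μ _ t h hh hi hR => ?_⟩
  set D : ℤ → (Fin N → ℝ) → ℝ≥0∞ :=
    fun m x => ∫⁻ ω, ENNReal.ofReal (mdiff (fun _ => t) m (h ω) x ^ 2) ∂μ with hDdef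
  have hDh : ∀ m x, D m x = ∫⁻ ω, ENNReal.ofReal (mdiff (fun _ => t) m (h ω) x ^ 2) ∂μ :=
    fun _ _ => rfl
  have hDm : ∀ m, Measurable (D m) := fun m =>
    (((measurable_mdiff t m hh).pow_const 2).ennreal_ofReal).lintegral_prod_left'
  have hJ : ∀ i, JMeas (TW (atomPart t D h i)) := fun i => jmeas_TW (measurable_atomPart t D hh i)
  calc _ ≤ ∫⁻ x, ∑' i, coneSq μ (TW (atomPart t D h i)) x ^ (1 / 2 : ℝ) := by
        refine lintegral_mono fun x => ?_
        refine (ENNReal.rpow_le_rpow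
          (coneSq_mono μ (abs_Tk_le_tsum_TW hN μ hh hi hDh hR) x) (by norm_num)).trans ?_
        exact coneSq_tsum_rpow_le μ hJ x
    _ = ∑' i, ∫⁻ x, coneSq μ (TW (atomPart t D h i)) x ^ (1 / 2 : ℝ) :=
        lintegral_tsum fun i => ((measurable_coneSq μ (hJ i)).pow_const _).aemeasurable
    _ ≤ ∑' i : ℤ × ℤ × (Fin N → ℤ), C * (ENNReal.ofReal (2 ^ N) * (ENNReal.ofReal (2 ^ (i.1 + 1)) *
          volume {z | idx t i.2.1 z = i.2.2 ∧ MaxBad t D i.1 i.2.1 z ∧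
            ENNReal.ofReal (2 ^ i.1) < (∑' m, D m z) ^ (1 / 2 : ℝ)})) := by
        refine ENNReal.tsum_le_tsum fun i => ?_
        refine (hat μ t i.2.1 i.2.2 _ (atomFam_atomPart hh hi i)).trans ?_
        refine mul_le_mul_right ((atom_norm_le μ hh hDh i).trans (le_of_eq ?_)) _
        ring
    _ ≤ _ := by
        rw [ENNReal.tsum_mul_left, ENNReal.tsum_mul_left, mul_assoc, mul_assoc]
        gcongr
        exact tsum_atom_volume_le t hDm

end

/-! ### Several variables -/

lemma measurable_update_left {n : ℕ} {Nd : Fin n → ℕ} (j : Fin n) :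
    Measurable fun p : X n Nd × (Fin (Nd j) → ℝ) => Function.update p.1 j p.2 :=
  measurable_update'

/-- Replacing one variable by an integrated one. -/
lemma lintegral_update_mul {n : ℕ} {Nd : Fin n → ℕ} (j : Fin n)
    {Φ : (Fin (Nd j) → ℝ) → (Fin (Nd j) → ℝ) → ℝ≥0∞}
    (hΦ : Measurable fun p : (Fin (Nd j) → ℝ) × (Fin (Nd j) → ℝ) => Φ p.1 p.2)
    {u : X n Nd → ℝ≥0∞} (hu : Measurable u) :
    ∫⁻ x : X n Nd, (∫⁻ z, Φ (x j) z * u (Function.update x j z)) =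
      ∫⁻ x : X n Nd, (u x * ∫⁻ w, Φ w (x j)) := by
  have key : ∀ G : X n Nd → ℝ≥0∞, Measurable G → ∫⁻ x, G x =
      (∫⋯∫⁻_(Finset.univ.erase j), (fun x => ∫⁻ w, G (Function.update x j w))
        ∂fun i : Fin n => (volume : Measure (Fin (Nd i) → ℝ))) 0 := fun G hG => by
    rw [volume_pi, lintegral_eq_lmarginal_univ 0, ← Finset.insert_erase (Finset.mem_univ j),
      lmarginal_insert' _ hG (Finset.notMem_erase j _), Finset.insert_erase (Finset.mem_univ j)]
  have hm1 : Measurable fun p : X n Nd × (Fin (Nd j) → ℝ) =>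
      Φ (p.1 j) p.2 * u (Function.update p.1 j p.2) := by
    refine Measurable.mul ?_ (hu.comp (measurable_update_left j))
    exact hΦ.comp (f := fun p : X n Nd × (Fin (Nd j) → ℝ) => (p.1 j, p.2)) (by fun_prop)
  have hm2 : Measurable fun x : X n Nd => ∫⁻ w, Φ w (x j) :=
    hΦ.lintegral_prod_left'.comp (measurable_pi_apply j)
  have hA : Measurable fun x : X n Nd => ∫⁻ z, Φ (x j) z * u (Function.update x j z) :=
    hm1.lintegral_prod_right'
  have hB : Measurable fun x : X n Nd => u x * ∫⁻ w, Φ w (x j) := hu.mul hm2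
  rw [key _ hA, key _ hB]
  congr 1
  funext x
  simp only [Function.update_self, Function.update_idem]
  have hux : Measurable fun z => u (Function.update x j z) :=
    hu.comp ((measurable_update_left j).comp (measurable_const.prodMk measurable_id))
  rw [lintegral_lintegral_swap]
  · refine lintegral_congr fun z => ?_
    have hw : Measurable fun w => Φ w z := hΦ.comp (measurable_id.prodMk measurable_const)
    rw [lintegral_mul_const _ hw, mul_comm]
  · exact (hΦ.mul (hux.comp measurable_snd)).aemeasurable

lemma ae_ae_update {n : ℕ} {Nd : Fin n → ℕ} (j : Fin n) {p : X n Nd → Prop} (hp : ∀ᵐ x, p x) :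
    ∀ᵐ x : X n Nd, ∀ᵐ z, p (Function.update x j z) := by
  have hT := measurableSet_toMeasurable (volume : Measure (X n Nd)) {x | ¬ p x}
  set T := toMeasurable (volume : Measure (X n Nd)) {x | ¬ p x} with hTdef
  have hT0 : volume T = 0 := by rw [hTdef, measure_toMeasurable]; exact hp
  have hu : Measurable (T.indicator (1 : X n Nd → ℝ≥0∞)) := measurable_one.indicator hT
  have h1 := lintegral_update_mul j (Φ := fun _ _ => 1) measurable_const hu
  have hae : ∀ᵐ x : X n Nd, x ∉ T := measure_eq_zero_iff_ae_notMem.1 hT0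
  have h2 : ∫⁻ x : X n Nd, (T.indicator (1 : X n Nd → ℝ≥0∞) x *
      ∫⁻ _ : Fin (Nd j) → ℝ, (1 : ℝ≥0∞)) = 0 := by
    have hm : Measurable fun x : X n Nd => T.indicator (1 : X n Nd → ℝ≥0∞) x *
        ∫⁻ _ : Fin (Nd j) → ℝ, (1 : ℝ≥0∞) := hu.mul measurable_const
    rw [lintegral_eq_zero_iff hm]
    filter_upwards [hae] with x hx
    simp [Set.indicator_of_notMem hx]
  have hm : Measurable fun q : X n Nd × (Fin (Nd j) → ℝ) =>
      1 * T.indicator (1 : X n Nd → ℝ≥0∞) (Function.update q.1 j q.2) :=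
    measurable_const.mul (hu.comp (measurable_update_left j))
  rw [h2, lintegral_eq_zero_iff hm.lintegral_prod_right'] at h1
  filter_upwards [h1] with x hx
  have hmx : Measurable fun z =>
      1 * T.indicator (1 : X n Nd → ℝ≥0∞) (Function.update x j z) :=
    hm.comp (measurable_const.prodMk measurable_id)
  rw [Pi.zero_apply, lintegral_eq_zero_iff hmx] at hx
  filter_upwards [hx] with z hz
  by_contra hpz
  have : Function.update x j z ∈ T := subset_toMeasurable _ _ hpz
  simp [Set.indicator_of_mem this] at hz

/-- Indices at which the components are given by honest integrals. -/
def Good {M : ℕ} : Idx M → Prop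
  | Sum.inl _ => True
  | Sum.inr q => 0 < q.1.2

/-- The components of the vectorized square functions, with the derivative of the Poisson extension
written as an integral against the derivative of the kernel. -/
def opK {n : ℕ} {Nd : Fin n → ℕ} (t : Π j : Fin n, Fin (Nd j) → ℝ) (j : Fin n)
    (a : Idx (Nd j)) (g : X n Nd → ℝ) (x : X n Nd) : ℝ :=
  match a with
  | Sum.inl m => mdiff (fun _ => t j) m (fun z => g (Function.update x j z)) (x j)
  | Sum.inr (q, d) => if 0 < q.2 then
      q.2 ^ ((1 - (Nd j : ℝ)) / 2) * Tk d q.2 (fun z => g (Function.update x j z)) (x j + q.1)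
      else 0

lemma opComp_congr {n : ℕ} {Nd : Fin n → ℕ} (t : Π j : Fin n, Fin (Nd j) → ℝ) (j : Fin n)
    (a : Idx (Nd j)) {g g' : X n Nd → ℝ} {x : X n Nd}
    (h : ∀ᵐ z, g (Function.update x j z) = g' (Function.update x j z)) :
    opComp n Nd t j a g x = opComp n Nd t j a g' x := by
  rcases a with m | ⟨q, d⟩
  · simp only [opComp, mdiff, avg]
    rw [integral_congr_ae (ae_restrict_of_ae h), integral_congr_ae (ae_restrict_of_ae h)]
  · simp only [opComp]
    congr 3
    funext w
    refine integral_congr_ae ?_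
    filter_upwards [h] with z hz
    rw [hz]

lemma opComp_eq_opK {n : ℕ} {Nd : Fin n → ℕ} (t : Π j : Fin n, Fin (Nd j) → ℝ) (j : Fin n)
    {a : Idx (Nd j)} (ha : Good a) {g : X n Nd → ℝ} {x : X n Nd}
    (hg : Integrable fun z => g (Function.update x j z)) :
    opComp n Nd t j a g x = opK t j a g x := by
  rcases a with m | ⟨q, d⟩
  · rfl
  · have hq : 0 < q.2 := ha
    simp only [opComp, opK, if_pos hq]
    congr 1
    have hw : Integrable fun z => g (Function.update x j z) * wt 1 1 z := by
      refine hg.mul_bdd (c := 1) (measurable_wt_right 1 1).aestronglyMeasurable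
          (ae_of_all _ fun z => ?_)
      rw [Real.norm_of_nonneg (wt_nonneg 1 zero_lt_one z)]
      exact Real.rpow_le_one_of_one_le_of_nonpos (by linarith [norm_nonneg z]) (by
        have : (0 : ℝ) ≤ Nd j := Nat.cast_nonneg _
        linarith)
    refine (fderiv_poisson hg.aestronglyMeasurable hw (x j + q.1) hq d).trans ?_
    simp only [Tk, mul_comm]

/-- The weighted maximal-type bound for all the components. -/
lemma abs_avg_le_wt {N : ℕ} (t : Fin N → ℝ) (k : ℤ) : ∃ C : ℝ≥0∞, C ≠ ∞ ∧
    ∀ (g : (Fin N → ℝ) → ℝ) (x : Fin N → ℝ), ENNReal.ofReal |avg (fun _ => t) k g x| ≤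
      C * ∫⁻ z, ENNReal.ofReal (wt 1 1 (x - z)) * ENNReal.ofReal |g z| := by
  have hV : (0 : ℝ) < ((2 : ℝ) ^ k) ^ N := by positivity
  have h2k : (0 : ℝ) < 2 ^ k := by positivity
  set K : ℝ := (1 + 2 ^ k) ^ ((N : ℝ) + 1)
  have hK : 0 ≤ K := by positivity
  refine ⟨(ENNReal.ofReal (((2 : ℝ) ^ k) ^ N))⁻¹ * ENNReal.ofReal K,
    ENNReal.mul_ne_top (ENNReal.inv_ne_top.2 (ENNReal.ofReal_pos.2 hV).ne') ENNReal.ofReal_ne_top,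
    fun g x => ?_⟩
  have hone : ∀ z ∈ cube t k (idx t k x), (1 : ℝ) ≤ K * wt 1 1 (x - z) := fun z hz => by
    have h0 : wt 1 1 (0 : Fin N → ℝ) = 1 := by simp [wt]
    refine h0.symm.le.trans (wt_le_of_le zero_le_one zero_lt_one (by positivity) ?_)
    have := norm_sub_le_of_idx_eq (mem_cube.1 hz).symm
    have h1 : (0 : ℝ) ≤ 2 ^ k * 1 := by positivity
    nlinarith [norm_zero (E := Fin N → ℝ)]
  rw [avg_eq, abs_div, abs_of_pos hV, ENNReal.ofReal_div_of_pos hV, div_eq_mul_inv, mul_comm,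
      mul_assoc]
  gcongr
  have hK' : ENNReal.ofReal K ≠ ∞ := ENNReal.ofReal_ne_top
  rw [← lintegral_const_mul' _ _ hK', ← Real.norm_eq_abs, ofReal_norm]
  refine (enorm_integral_le_lintegral_enorm _).trans ?_
  refine (setLIntegral_mono' (measurableSet_cube _ _ _) fun z hz => ?_).trans
    (setLIntegral_le_lintegral _ _)
  rw [← mul_assoc, ← ENNReal.ofReal_mul hK, ← Real.norm_eq_abs, ofReal_norm]
  refine le_mul_of_one_le_left zero_le ?_
  rw [← ENNReal.ofReal_one]
  exact ENNReal.ofReal_le_ofReal (hone z hz)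

lemma abs_Tk_le_wt {N : ℕ} (d : Fin (N + 1)) {s : ℝ} (hs : 0 < s) (y : Fin N → ℝ) :
    ∃ C : ℝ≥0∞, C ≠ ∞ ∧ ∀ (g : (Fin N → ℝ) → ℝ) (x : Fin N → ℝ),
      ENNReal.ofReal |Tk d s g (x + y)| ≤
        C * ∫⁻ z, ENNReal.ofReal (wt 1 1 (x - z)) * ENNReal.ofReal |g z| := by
  obtain ⟨A, hA, hk⟩ := abs_kd_le_wt N
  set K : ℝ := (1 + ‖y‖) / s + 1
  have hK : 0 < K := by positivity
  refine ⟨ENNReal.ofReal (A * K ^ ((N : ℝ) + 1)), ENNReal.ofReal_ne_top, fun g x => ?_⟩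
  rw [← lintegral_const_mul' _ _ ENNReal.ofReal_ne_top, Tk, ← Real.norm_eq_abs, ofReal_norm]
  refine (enorm_integral_le_lintegral_enorm _).trans (lintegral_mono fun z => ?_)
  rw [← mul_assoc, ← ENNReal.ofReal_mul (by positivity), enorm_mul, ← ofReal_norm, ← ofReal_norm,
    Real.norm_eq_abs, Real.norm_eq_abs]
  gcongr
  refine (hk d _ s hs).trans ?_
  rw [mul_assoc]
  gcongr
  refine wt_le_of_le zero_le_one zero_lt_one hK ?_
  have h1 : ‖x - z‖ ≤ ‖x + y - z‖ + ‖y‖ := by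
    have : x - z = (x + y - z) - y := by abel
    rw [this]
    exact norm_sub_le _ _
  have h2 : K * (s + ‖x + y - z‖) = (1 + ‖y‖) + s + (1 + ‖y‖) / s * ‖x + y - z‖ + ‖x + y - z‖ := by
    simp only [K]
    field_simp
    ring
  rw [h2]
  have : 0 ≤ (1 + ‖y‖) / s * ‖x + y - z‖ := by positivity
  linarith

lemma abs_opK_le {n : ℕ} {Nd : Fin n → ℕ} (t : Π j : Fin n, Fin (Nd j) → ℝ) (j : Fin n)
    (a : Idx (Nd j)) : ∃ C : ℝ≥0∞, C ≠ ∞ ∧ ∀ (g : X n Nd → ℝ) (x : X n Nd),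
      ENNReal.ofReal |opK t j a g x| ≤ C * ∫⁻ z, ENNReal.ofReal (wt 1 1 (x j - z)) *
        ENNReal.ofReal |g (Function.update x j z)| := by
  rcases a with m | ⟨q, d⟩
  · obtain ⟨C, hC, h⟩ := abs_avg_le_wt (t j) (m - 1)
    obtain ⟨C', hC', h'⟩ := abs_avg_le_wt (t j) m
    refine ⟨C + C', by finiteness, fun g x => ?_⟩
    rw [add_mul]
    refine le_trans ?_ (add_le_add (h _ (x j)) (h' _ (x j)))
    rw [← ENNReal.ofReal_add (abs_nonneg _) (abs_nonneg _)]
    exact ENNReal.ofReal_le_ofReal (abs_sub _ _)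
  · by_cases hq : 0 < q.2
    · obtain ⟨C, hC, h⟩ := abs_Tk_le_wt d hq q.1
      refine ⟨ENNReal.ofReal |q.2 ^ ((1 - (Nd j : ℝ)) / 2)| * C, by finiteness, fun g x => ?_⟩
      simp only [opK, if_pos hq]
      rw [abs_mul, ENNReal.ofReal_mul (abs_nonneg _), mul_assoc]
      gcongr
      exact h _ _
    · exact ⟨0, by simp, fun g x => by simp [opK, hq]⟩

section

variable {n : ℕ} {Nd : Fin n → ℕ}

/-- Successive application of the components over a list of variables. -/
def foldC (t : Π j : Fin n, Fin (Nd j) → ℝ) (ι : Π j, Idx (Nd j)) (f : X n Nd → ℝ)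
    (l : List (Fin n)) : X n Nd → ℝ :=
  l.foldr (fun j g => opComp n Nd t j (ι j) g) f

/-- Successive application of the integral forms of the components over a list of variables. -/
def foldK (t : Π j : Fin n, Fin (Nd j) → ℝ) (ι : Π j, Idx (Nd j)) (f : X n Nd → ℝ)
    (l : List (Fin n)) : X n Nd → ℝ :=
  l.foldr (fun j g => opK t j (ι j) g) f

/-- A common majorant for all the components. -/
def domF (f : X n Nd → ℝ) : List (Fin n) → X n Nd → ℝ≥0∞
  | [], x => ENNReal.ofReal |f x|
  | j :: l, x => ∫⁻ z, ENNReal.ofReal (wt 1 1 (x j - z)) * domF f l (Function.update x j z)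

lemma measurable_domF {f : X n Nd → ℝ} (hf : Measurable f) (l : List (Fin n)) :
    Measurable (domF f l) := by
  induction l with
  | nil => exact ENNReal.measurable_ofReal.comp (measurable_abs.comp hf)
  | cons j l ih =>
    have hm : Measurable fun p : X n Nd × (Fin (Nd j) → ℝ) =>
        ENNReal.ofReal (wt 1 1 (p.1 j - p.2)) * domF f l (Function.update p.1 j p.2) := by
      refine Measurable.mul ?_ (ih.comp (measurable_update_left j))
      refine ENNReal.measurable_ofReal.comp ((measurable_wt_right 1 1).comp
        (f := fun p : X n Nd × (Fin (Nd j) → ℝ) => p.1 j - p.2) (by fun_prop))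
    exact hm.lintegral_prod_right'

lemma lintegral_domF_lt_top {f : X n Nd → ℝ} (hf : Measurable f) (hfi : Integrable f)
    (l : List (Fin n)) : ∫⁻ x, domF f l x < ∞ := by
  induction l with
  | nil =>
    simpa only [domF, ← Real.norm_eq_abs, ofReal_norm] using hasFiniteIntegral_iff_enorm.1 hfi.2
  | cons j l ih =>
    have hΦ : Measurable fun p : (Fin (Nd j) → ℝ) × (Fin (Nd j) → ℝ) =>
        ENNReal.ofReal (wt 1 1 (p.1 - p.2)) :=
      ENNReal.measurable_ofReal.comp ((measurable_wt_right 1 1).comp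
        (f := fun p : (Fin (Nd j) → ℝ) × (Fin (Nd j) → ℝ) => p.1 - p.2) (by fun_prop))
    have h := lintegral_update_mul j (Φ := fun w z => ENNReal.ofReal (wt 1 1 (w - z))) hΦ
      (measurable_domF hf l)
    simp only [domF]
    rw [h]
    have hw : ∀ y : Fin (Nd j) → ℝ, ∫⁻ w, ENNReal.ofReal (wt 1 1 (w - y)) = wtI (Nd j) 1 :=
        fun y => by
      rw [lintegral_sub_right_eq_self (fun w => ENNReal.ofReal (wt 1 1 w)) y,
        lintegral_wt 1 zero_lt_one]
      simp
    simp only [hw]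
    rw [lintegral_mul_const _ (measurable_domF hf l)]
    exact ENNReal.mul_lt_top ih (wtI_lt_top _ zero_lt_one)

lemma foldK_le_domF (t : Π j : Fin n, Fin (Nd j) → ℝ) (ι : Π j, Idx (Nd j))
    (l : List (Fin n)) : ∃ C : ℝ≥0∞, C ≠ ∞ ∧ ∀ (f : X n Nd → ℝ) (x : X n Nd),
      ENNReal.ofReal |foldK t ι f l x| ≤ C * domF f l x := by
  induction l with
  | nil => exact ⟨1, by simp, fun f x => by simp [foldK, domF]⟩
  | cons j l ih =>
    obtain ⟨C, hC, h⟩ := ih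
    obtain ⟨C', hC', h'⟩ := abs_opK_le t j (ι j)
    refine ⟨C' * C, by finiteness, fun f x => (h' (foldK t ι f l) x).trans ?_⟩
    rw [mul_assoc, domF]
    gcongr
    rw [← lintegral_const_mul' _ _ hC]
    refine lintegral_mono fun z => ?_
    rw [mul_left_comm]
    gcongr
    exact h _ _

lemma measurable_opK {Ω : Type} [MeasurableSpace Ω] (t : Π j : Fin n, Fin (Nd j) → ℝ) (j : Fin n)
    {g : Ω → X n Nd → ℝ} (hg : Measurable fun p : Ω × X n Nd => g p.1 p.2) :
    Measurable fun p : Idx (Nd j) × Ω × X n Nd => opK t j p.1 (g p.2.1) p.2.2 := by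
  have hb : Measurable fun q : (Ω × X n Nd) × (Fin (Nd j) → ℝ) =>
      g q.1.1 (Function.update q.1.2 j q.2) :=
    hg.comp (f := fun q : (Ω × X n Nd) × (Fin (Nd j) → ℝ) =>
      (q.1.1, Function.update q.1.2 j q.2))
      ((measurable_fst.comp measurable_fst).prodMk ((measurable_update_left j).comp
        (f := fun q : (Ω × X n Nd) × (Fin (Nd j) → ℝ) => (q.1.2, q.2))
        ((measurable_snd.comp measurable_fst).prodMk measurable_snd)))
  have h1 : Measurable fun p : ℤ × Ω × X n Nd => opK t j (Sum.inl p.1) (g p.2.1) p.2.2 := by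
    refine measurable_from_prod_countable_right fun m => ?_
    exact (measurable_mdiff (t j) m
      (h := fun (q : Ω × X n Nd) z => g q.1 (Function.update q.2 j z)) hb).comp
      (f := fun p : Ω × X n Nd => ((p.1, p.2), p.2 j)) (by fun_prop)
  have h2 : Measurable fun p : (((Fin (Nd j) → ℝ) × ℝ) × Fin (Nd j + 1)) × Ω × X n Nd =>
      opK t j (Sum.inr p.1) (g p.2.1) p.2.2 := by
    simp only [opK]
    refine Measurable.ite (measurableSet_lt measurable_const (by fun_prop)) ?_ measurable_const
    refine Measurable.mul (by fun_prop) ?_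
    exact (measurable_Tk (b := fun (q : Ω × X n Nd) z => g q.1 (Function.update q.2 j z)) hb).comp
      (f := fun p : (((Fin (Nd j) → ℝ) × ℝ) × Fin (Nd j + 1)) × Ω × X n Nd =>
        (p.1.2, p.1.1.2, (p.2.1, p.2.2), p.2.2 j + p.1.1.1)) (by fun_prop)
  have h3 : Measurable (Sum.elim (fun p : ℤ × Ω × X n Nd => opK t j (Sum.inl p.1) (g p.2.1) p.2.2)
      fun p : (((Fin (Nd j) → ℝ) × ℝ) × Fin (Nd j + 1)) × Ω × X n Nd =>
        opK t j (Sum.inr p.1) (g p.2.1) p.2.2) := measurable_fun_sum h1 h2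
  convert h3.comp (MeasurableEquiv.sumProdDistrib ℤ
    (((Fin (Nd j) → ℝ) × ℝ) × Fin (Nd j + 1)) (Ω × X n Nd)).measurable using 1
  funext p
  rcases p with ⟨m | q, y⟩ <;> rfl

lemma measurable_foldK (t : Π j : Fin n, Fin (Nd j) → ℝ) {f : X n Nd → ℝ} (hf : Measurable f)
    (l : List (Fin n)) :
    Measurable fun p : (Π j, Idx (Nd j)) × X n Nd => foldK t p.1 f l p.2 := by
  induction l with
  | nil => exact hf.comp measurable_snd
  | cons j l ih =>
    exact (measurable_opK t j (g := fun ι => foldK t ι f l) ih).comp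
      (f := fun p : (Π j, Idx (Nd j)) × X n Nd => (p.1 j, p.1, p.2)) (by fun_prop)

lemma integrable_foldK_update (t : Π j : Fin n, Fin (Nd j) → ℝ) {f : X n Nd → ℝ}
    (hf : Measurable f) (hfi : Integrable f) (l : List (Fin n)) (j : Fin n) :
    ∀ᵐ x : X n Nd, ∀ ι, Integrable fun z => foldK t ι f l (Function.update x j z) := by
  have hφ : Measurable fun v : Fin (Nd j) → ℝ => ENNReal.ofReal (wt 1 1 v) :=
    ENNReal.measurable_ofReal.comp (measurable_wt_right 1 1)
  have h := lintegral_update_mul j (Φ := fun w _ => ENNReal.ofReal (wt 1 1 w))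
    (hφ.comp measurable_fst) (measurable_domF hf l)
  have hm : Measurable fun p : X n Nd × (Fin (Nd j) → ℝ) =>
      ENNReal.ofReal (wt 1 1 (p.1 j)) * domF f l (Function.update p.1 j p.2) :=
    (hφ.comp (f := fun p : X n Nd × (Fin (Nd j) → ℝ) => p.1 j) (by fun_prop)).mul
      ((measurable_domF hf l).comp (measurable_update_left j))
  have hfin : ∫⁻ x : X n Nd, (∫⁻ z, ENNReal.ofReal (wt 1 1 (x j)) *
      domF f l (Function.update x j z)) ≠ ∞ := by
    rw [h, lintegral_mul_const _ (measurable_domF hf l), lintegral_wt 1 zero_lt_one]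
    have := lintegral_domF_lt_top hf hfi l
    have := wtI_lt_top (Nd j) (zero_lt_one (α := ℝ))
    finiteness
  have hmI : Measurable fun x : X n Nd => ∫⁻ z, ENNReal.ofReal (wt 1 1 (x j)) *
      domF f l (Function.update x j z) := hm.lintegral_prod_right'
  filter_upwards [ae_lt_top hmI hfin] with x hx ι
  obtain ⟨C, hC, hle⟩ := foldK_le_domF t ι l
  refine ⟨?_, ?_⟩
  · exact ((measurable_foldK t hf l).comp (f := fun z => (ι, Function.update x j z))
      (measurable_const.prodMk (measurable_update x))).aestronglyMeasurable
  · rw [lintegral_const_mul' _ _ ENNReal.ofReal_ne_top] at hx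
    have hpos : ENNReal.ofReal (wt 1 1 (x j)) ≠ 0 := (ENNReal.ofReal_pos.2
        (wt_pos 1 zero_lt_one _)).ne'
    have hx' : ∫⁻ z, domF f l (Function.update x j z) ≠ ∞ := fun h0 => by
      rw [h0, ENNReal.mul_top hpos] at hx
      exact lt_irrefl _ hx
    refine lt_of_le_of_lt (lintegral_mono fun z => ?_)
      (lt_of_eq_of_lt (lintegral_const_mul' _ _ hC) (ENNReal.mul_lt_top hC.lt_top hx'.lt_top))
    rw [← ofReal_norm, Real.norm_eq_abs]
    exact hle _ _

lemma foldC_eq_foldK (t : Π j : Fin n, Fin (Nd j) → ℝ) {f f' : X n Nd → ℝ}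
    (hf : Measurable f') (hfi : Integrable f') (hff : f =ᵐ[volume] f') (l : List (Fin n)) :
    ∀ᵐ x : X n Nd, ∀ ι : Π j, Idx (Nd j), (∀ j, Good (ι j)) →
      foldC t ι f l x = foldK t ι f' l x := by
  induction l with
  | nil =>
    filter_upwards [hff] with x hx ι _
    exact hx
  | cons j l ih =>
    filter_upwards [ae_ae_update j ih, integrable_foldK_update t hf hfi l j] with x hx hi ι hι
    refine (opComp_congr t j (ι j) (g' := foldK t ι f' l) ?_).trans
      (opComp_eq_opK t j (hι j) (hi ι))
    filter_upwards [hx] with z hz using hz ι hι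

/-- The components only depend on the indices of the variables in the list. -/
lemma foldK_congr (t : Π j : Fin n, Fin (Nd j) → ℝ) {ι ι' : Π j, Idx (Nd j)} (f : X n Nd → ℝ)
    {l : List (Fin n)} (h : ∀ j ∈ l, ι j = ι' j) : foldK t ι f l = foldK t ι' f l := by
  induction l with
  | nil => rfl
  | cons j l ih =>
    have := ih fun i hi => h i (List.mem_cons_of_mem _ hi)
    change opK t j (ι j) (foldK t ι f l) = opK t j (ι' j) (foldK t ι' f l)
    rw [this, h j List.mem_cons_self]

end

section

variable {n : ℕ} {Nd : Fin n → ℕ}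

lemma lintegral_idxMeas_false {M : ℕ} {F : Idx M → ℝ≥0∞} (hF : Measurable F) :
    ∫⁻ a, F a ∂idxMeas M false = ∑' m : ℤ, F (Sum.inl m) := by
  simp only [idxMeas, dyadIdxMeas, Bool.false_eq_true, if_false]
  rw [lintegral_map hF measurable_inl, lintegral_count]

lemma lintegral_idxMeas_true {M : ℕ} {F : Idx M → ℝ≥0∞} (hF : Measurable F) :
    ∫⁻ a, F a ∂idxMeas M true = ∫⁻ q, F (Sum.inr q) ∂coneMeas M := by
  simp only [idxMeas, lusinIdxMeas, if_true]
  rw [lintegral_map hF measurable_inr, coneMeas]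

lemma ae_coneMeas_pos (M : ℕ) : ∀ᵐ q ∂coneMeas M, 0 < q.1.2 := by
  have h1 : ∀ᵐ q ∂(volume.restrict (coneSet M)), q ∈ coneSet M :=
    ae_restrict_mem (measurableSet_coneSet M)
  have h2 : ∀ᵐ q ∂coneMeas M, q.1 ∈ coneSet M := Measure.quasiMeasurePreserving_fst.ae h1
  filter_upwards [h2] with q hq using (norm_nonneg _).trans_lt (coneSet_subset hq)

lemma measurableEmbedding_sum_inl {α β : Type*} [MeasurableSpace α] [MeasurableSpace β] :
    MeasurableEmbedding (Sum.inl : α → α ⊕ β) where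
  injective := Sum.inl_injective
  measurable := measurable_inl
  measurableSet_image' := fun _ => MeasurableSet.inl_image

lemma measurableEmbedding_sum_inr {α β : Type*} [MeasurableSpace α] [MeasurableSpace β] :
    MeasurableEmbedding (Sum.inr : β → α ⊕ β) where
  injective := Sum.inr_injective
  measurable := measurable_inr
  measurableSet_image' := fun _ => MeasurableSet.inr_image

instance sigmaFinite_idxMeas (M : ℕ) (b : Bool) : SigmaFinite (idxMeas M b) := by
  cases b
  · simp only [idxMeas, dyadIdxMeas, Bool.false_eq_true, if_false]
    exact measurableEmbedding_sum_inl.sigmaFinite_map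
  · simp only [idxMeas, lusinIdxMeas, if_true]
    exact measurableEmbedding_sum_inr.sigmaFinite_map

lemma ae_good (M : ℕ) (b : Bool) : ∀ᵐ a ∂idxMeas M b, Good a := by
  cases b
  · simp only [idxMeas, dyadIdxMeas, Bool.false_eq_true, if_false]
    rw [measurableEmbedding_sum_inl.ae_map_iff]
    exact ae_of_all _ fun _ => trivial
  · simp only [idxMeas, lusinIdxMeas, if_true]
    rw [measurableEmbedding_sum_inr.ae_map_iff]
    exact ae_coneMeas_pos M

lemma good_update {ι : Π j, Idx (Nd j)} (hι : ∀ j, Good (ι j)) {j : Fin n} {a : Idx (Nd j)}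
    (ha : Good a) (i : Fin n) : Good (Function.update ι j a i) := by
  rcases eq_or_ne i j with rfl | hij
  · simpa using ha
  · simpa [Function.update_of_ne hij] using hι i

lemma intAll_congr_good (ch : Fin n → Bool) (l : List (Fin n))
    {F G : (Π j, Idx (Nd j)) → ℝ≥0∞} (h : ∀ ι, (∀ j, Good (ι j)) → F ι = G ι) :
    ∀ ι, (∀ j, Good (ι j)) → intAll n Nd ch l F ι = intAll n Nd ch l G ι := by
  induction l with
  | nil => exact h
  | cons j l ih =>
    intro ι hι
    refine lintegral_congr_ae ?_
    filter_upwards [ae_good (Nd j) (ch j)] with a ha using ih _ (good_update hι ha)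

lemma intAll_eq_lmarginal {ch ch' : Fin n → Bool} {l : List (Fin n)} (hl : l.Nodup)
    (hch : ∀ j ∈ l, ch j = ch' j) {F : (Π j, Idx (Nd j)) → ℝ≥0∞} (hF : Measurable F) :
    ∀ ι, intAll n Nd ch l F ι =
      (∫⋯∫⁻_l.toFinset, F ∂fun j => idxMeas (Nd j) (ch' j)) ι := by
  induction l with
  | nil => intro ι; simp [intAll]
  | cons j l ih =>
    intro ι
    have ih' := ih (List.nodup_cons.1 hl).2 fun i hi => hch i (List.mem_cons_of_mem _ hi)
    have hj : j ∉ l.toFinset := fun h => (List.nodup_cons.1 hl).1 (List.mem_toFinset.1 h)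
    rw [List.toFinset_cons, lmarginal_insert F hF hj]
    simp only [intAll, ih', hch j List.mem_cons_self]

/-- The squared norm of a square function in the `j`-th variable of a vector valued function. -/
def colSq {Ω : Type} [MeasurableSpace Ω] (t : Π j : Fin n, Fin (Nd j) → ℝ) (j : Fin n) (b : Bool)
    (ν : Measure Ω) (H : Ω → X n Nd → ℝ) (x : X n Nd) : ℝ≥0∞ :=
  ∫⁻ a, ∫⁻ ω, ENNReal.ofReal (opK t j a (H ω) x ^ 2) ∂ν ∂idxMeas (Nd j) b

section colSq

variable {Ω : Type} [MeasurableSpace Ω] (t : Π j : Fin n, Fin (Nd j) → ℝ) (j : Fin n)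
  (ν : Measure Ω) [SFinite ν] {H : Ω → X n Nd → ℝ}

lemma measurable_colSq (b : Bool) (hH : Measurable fun p : Ω × X n Nd => H p.1 p.2) :
    Measurable (colSq t j b ν H) := by
  have h1 : Measurable fun p : (X n Nd × Idx (Nd j)) × Ω =>
      ENNReal.ofReal (opK t j p.1.2 (H p.2) p.1.1 ^ 2) :=
    (((measurable_opK t j hH).comp (f := fun p : (X n Nd × Idx (Nd j)) × Ω =>
      (p.1.2, p.2, p.1.1)) (by fun_prop)).pow_const 2).ennreal_ofReal
  have h2 : Measurable fun p : X n Nd × Idx (Nd j) =>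
      ∫⁻ ω, ENNReal.ofReal (opK t j p.2 (H ω) p.1 ^ 2) ∂ν := h1.lintegral_prod_right'
  exact h2.lintegral_prod_right'

lemma measurable_colSq_integrand (hH : Measurable fun p : Ω × X n Nd => H p.1 p.2) (x : X n Nd) :
    Measurable fun a : Idx (Nd j) => ∫⁻ ω, ENNReal.ofReal (opK t j a (H ω) x ^ 2) ∂ν := by
  have h1 : Measurable fun p : Idx (Nd j) × Ω => ENNReal.ofReal (opK t j p.1 (H p.2) x ^ 2) :=
    (((measurable_opK t j hH).comp (f := fun p : Idx (Nd j) × Ω =>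
      (p.1, p.2, x)) (by fun_prop)).pow_const 2).ennreal_ofReal
  exact h1.lintegral_prod_right'

lemma colSq_false_update (hH : Measurable fun p : Ω × X n Nd => H p.1 p.2) (x : X n Nd)
    (w : Fin (Nd j) → ℝ) : colSq t j false ν H (Function.update x j w) =
      ∑' m, ∫⁻ ω, ENNReal.ofReal
        (mdiff (fun _ => t j) m (fun z => H ω (Function.update x j z)) w ^ 2) ∂ν := by
  rw [colSq, lintegral_idxMeas_false (measurable_colSq_integrand t j ν hH _)]
  simp only [opK, Function.update_idem, Function.update_self]

lemma colSq_true_update (hH : Measurable fun p : Ω × X n Nd => H p.1 p.2) (x : X n Nd)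
    (w : Fin (Nd j) → ℝ) : colSq t j true ν H (Function.update x j w) =
      coneSq ν (fun d s ω y => ENNReal.ofReal |Tk d s (fun z => H ω (Function.update x j z)) y|)
        w := by
  rw [colSq, lintegral_idxMeas_true (measurable_colSq_integrand t j ν hH _), coneSq]
  refine lintegral_congr_ae ?_
  filter_upwards [ae_coneMeas_pos (Nd j)] with q hq
  refine lintegral_congr fun ω => ?_
  simp only [opK, if_pos hq, Function.update_idem, Function.update_self]
  rw [ofReal_sq_eq, abs_mul, ENNReal.ofReal_mul (abs_nonneg _),
      abs_of_pos (Real.rpow_pos_of_pos hq _)]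

end colSq

lemma wtI_ne_zero (N : ℕ) (β : ℝ) : wtI N β ≠ 0 := by
  intro h
  rw [wtI, lintegral_eq_zero_iff (measurable_wt_right β 1).ennreal_ofReal] at h
  have : ∀ᵐ _ : Fin N → ℝ, False := by
    filter_upwards [h] with v hv
    exact (ENNReal.ofReal_pos.2 (wt_pos β zero_lt_one v)).ne' hv
  rw [ae_iff] at this
  exact isOpen_univ.measure_ne_zero volume Set.univ_nonempty (by simpa using this)

lemma lintegral_wt_mul_update (j : Fin n) {G : X n Nd → ℝ≥0∞} (hG : Measurable G) :
    ∫⁻ x : X n Nd, ENNReal.ofReal (wt 1 1 (x j)) * ∫⁻ w, G (Function.update x j w) =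
      wtI (Nd j) 1 * ∫⁻ x, G x := by
  have hφ : Measurable fun v : Fin (Nd j) → ℝ => ENNReal.ofReal (wt 1 1 v) :=
    (measurable_wt_right 1 1).ennreal_ofReal
  have h := lintegral_update_mul j (Φ := fun w _ => ENNReal.ofReal (wt 1 1 w))
    (hφ.comp measurable_fst) hG
  simp only [lintegral_const_mul' _ _ ENNReal.ofReal_ne_top] at h
  rw [h, lintegral_mul_const _ hG, mul_comm, wtI]

lemma lintegral_colSq_le (j : Fin n) (hj : 0 < Nd j) : ∃ C : ℝ≥0∞, C ≠ ∞ ∧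
    ∀ {Ω : Type} [MeasurableSpace Ω] (ν : Measure Ω) [SFinite ν]
      (t : Π j : Fin n, Fin (Nd j) → ℝ) (H : Ω → X n Nd → ℝ),
      (Measurable fun p : Ω × X n Nd => H p.1 p.2) →
      (∀ᵐ x, ∀ ω, Integrable fun z => H ω (Function.update x j z)) →
      ∫⁻ x, colSq t j true ν H x ^ (1 / 2 : ℝ) ≤
        C * ∫⁻ x, colSq t j false ν H x ^ (1 / 2 : ℝ) := by
  obtain ⟨C, hC, hB⟩ := lintegral_coneSq_le_dyadic hj
  refine ⟨C + 1, by finiteness, fun {Ω} _ ν _ t H hH hI => ?_⟩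
  have hA : ∀ b, Measurable fun x => colSq t j b ν H x ^ (1 / 2 : ℝ) := fun b =>
    (measurable_colSq t j ν b hH).pow_const _
  have hc0 := wtI_ne_zero (Nd j) 1
  have hct := (wtI_lt_top (Nd j) (zero_lt_one (α := ℝ))).ne
  have h : wtI (Nd j) 1 * ∫⁻ x, colSq t j true ν H x ^ (1 / 2 : ℝ) ≤
      wtI (Nd j) 1 * ((C + 1) * ∫⁻ x, colSq t j false ν H x ^ (1 / 2 : ℝ)) := by
    have hC1 : C + 1 ≠ ∞ := by finiteness
    rw [mul_left_comm, ← lintegral_wt_mul_update j (hA true),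
        ← lintegral_wt_mul_update j (hA false),
      ← lintegral_const_mul' _ _ hC1]
    refine lintegral_mono_ae ?_
    filter_upwards [hI] with x hx
    rw [mul_left_comm]
    refine mul_le_mul_right ?_ _
    by_cases hR : ∫⁻ w, colSq t j false ν H (Function.update x j w) ^ (1 / 2 : ℝ) = ∞
    · rw [hR, ENNReal.mul_top (by simp)]
      exact le_top
    · simp only [colSq_false_update t j ν hH, colSq_true_update t j ν hH] at hR ⊢
      refine (hB ν (t j) (fun ω z => H ω (Function.update x j z)) ?_ hx hR).trans ?_
      · exact hH.comp (f := fun q : Ω × (Fin (Nd j) → ℝ) => (q.1, Function.update x j q.2))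
          (measurable_fst.prodMk ((measurable_update x).comp measurable_snd))
      · gcongr
        exact le_self_add
  exact (ENNReal.mul_le_mul_iff_right hc0 hct).1 h

lemma intAll_cons_eq_colSq (t : Π j : Fin n, Fin (Nd j) → ℝ) {ch ch' : Fin n → Bool}
    {j : Fin n} {l : List (Fin n)} (hl : (j :: l).Nodup) (hch : ∀ i ∈ l, ch i = ch' i)
    {f : X n Nd → ℝ} (hf : Measurable f) (x : X n Nd) :
    intAll n Nd ch (j :: l) (fun ι => ENNReal.ofReal (foldK t ι f (j :: l) x ^ 2))
        (defIdx n Nd) =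
      colSq t j (ch j) (Measure.pi fun i : l.toFinset => idxMeas (Nd i) (ch' i))
        (fun ω => foldK t (Function.updateFinset (defIdx n Nd) l.toFinset ω) f l) x := by
  have hF : Measurable fun ι => ENNReal.ofReal (foldK t ι f (j :: l) x ^ 2) :=
    (((measurable_foldK t hf (j :: l)).comp (measurable_id.prodMk measurable_const)).pow_const
      2).ennreal_ofReal
  obtain ⟨hjl, hl'⟩ := List.nodup_cons.1 hl
  rw [intAll, colSq]
  refine lintegral_congr fun a => ?_
  rw [intAll_eq_lmarginal hl' hch hF, lmarginal]
  refine lintegral_congr fun ω => ?_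
  have hj : Function.updateFinset (Function.update (defIdx n Nd) j a) l.toFinset ω j = a := by
    simp [Function.updateFinset, hjl]
  have hrest : foldK t (Function.updateFinset (Function.update (defIdx n Nd) j a) l.toFinset ω)
      f l =
      foldK t (Function.updateFinset (defIdx n Nd) l.toFinset ω) f l :=
    foldK_congr t f fun i hi => by simp [Function.updateFinset, hi]
  change ENNReal.ofReal (opK t j _ (foldK t _ f l) x ^ 2) = _
  rw [hj, hrest]

end

/-- The tensor norm, with the first variable separated, for almost every point. -/
lemma tensorL1Norm_eq_colSq {n : ℕ} (hn : 0 < n) {Nd : Fin n → ℕ}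
    (t : Π j : Fin n, Fin (Nd j) → ℝ) (ch : Fin n → Bool) (b : Bool) {l : List (Fin n)}
    (hl : List.finRange n = ⟨0, hn⟩ :: l) {f f' : X n Nd → ℝ} (hf : Measurable f')
    (hfi : Integrable f') (hff : f =ᵐ[volume] f') :
    tensorL1Norm n Nd t (Function.update ch ⟨0, hn⟩ b) f =
      ∫⁻ x, colSq t ⟨0, hn⟩ b (Measure.pi fun i : l.toFinset => idxMeas (Nd i) (ch i))
        (fun ω => foldK t (Function.updateFinset (defIdx n Nd) l.toFinset ω) f' l) x ^
          (1 / 2 : ℝ) := by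
  have hnd : ((⟨0, hn⟩ : Fin n) :: l).Nodup := hl ▸ List.nodup_finRange n
  refine lintegral_congr_ae ?_
  filter_upwards [foldC_eq_foldK t hf hfi hff (List.finRange n)] with x hx
  have h1 := intAll_congr_good (Function.update ch ⟨0, hn⟩ b) (List.finRange n)
    (F := fun ι => ENNReal.ofReal ((compAll n Nd t ι f x) ^ 2))
    (G := fun ι => ENNReal.ofReal ((foldK t ι f' (List.finRange n) x) ^ 2))
    (fun ι hι => by rw [← hx ι hι]; rfl) (defIdx n Nd) (fun _ => trivial)
  rw [tensorNormSq, h1, hl, intAll_cons_eq_colSq t hnd (ch' := ch) ?_ hf, Function.update_self]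
  intro i hi
  exact Function.update_of_ne (fun h : i = ⟨0, hn⟩ => (List.nodup_cons.1 hnd).1 (h ▸ hi)) _ _

/-- **Lemma 2.2**: fix dyadic lattices `𝒟_j = t_j + 𝒟₀` on the factors `X_j`, and for
`j ≥ 2` let `S̃_j` be an arbitrary fixed choice between the vectorized Lusin square function
`𝐒_j^L` and the vectorized dyadic square function `𝐒_{𝒟_j}` in the variable `x_j`. Then
`∫_X ‖(𝐒₁^L ⊗ S̃₂ ⊗ ⋯ ⊗ S̃ₙ f)(x)‖ dx ≤ C ∫_X ‖(𝐒_{𝒟₁} ⊗ S̃₂ ⊗ ⋯ ⊗ S̃ₙ f)(x)‖ dx`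
for every `f ∈ L¹(X)` for which the right-hand side is finite, with `C` independent of
`f`. -/
theorem lemma_2_2 (n : ℕ) (hn : 0 < n) (Nd : Fin n → ℕ) (hNd : ∀ j, 0 < Nd j)
    (t : Π j : Fin n, Fin (Nd j) → ℝ) (ch : Fin n → Bool) :
    ∃ C : ℝ, 0 < C ∧
      ∀ f : X n Nd → ℝ, Integrable f volume →
        tensorL1Norm n Nd t (Function.update ch ⟨0, hn⟩ false) f < ⊤ →
        tensorL1Norm n Nd t (Function.update ch ⟨0, hn⟩ true) f ≤
          ENNReal.ofReal C * tensorL1Norm n Nd t (Function.update ch ⟨0, hn⟩ false) f := by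
  obtain ⟨l, hl⟩ : ∃ l, List.finRange n = ⟨0, hn⟩ :: l := by
    obtain ⟨k, rfl⟩ := Nat.exists_eq_succ_of_ne_zero hn.ne'
    exact ⟨_, List.finRange_succ⟩
  obtain ⟨C, hC, hle⟩ := lintegral_colSq_le (Nd := Nd) ⟨0, hn⟩ (hNd _)
  refine ⟨C.toReal + 1, by positivity, fun f hf _ => ?_⟩
  obtain ⟨f', hf', hff⟩ := hf.aestronglyMeasurable.aemeasurable
  have hfi : Integrable f' := hf.congr hff
  rw [tensorL1Norm_eq_colSq hn t ch true hl hf' hfi hff,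
    tensorL1Norm_eq_colSq hn t ch false hl hf' hfi hff]
  refine (hle _ t _ ?_ ?_).trans (mul_le_mul_left ?_ _)
  · exact (measurable_foldK t hf' l).comp
      (f := fun p : (Π i : l.toFinset, Idx (Nd i)) × X n Nd =>
        (Function.updateFinset (defIdx n Nd) l.toFinset p.1, p.2))
      ((measurable_updateFinset.comp measurable_fst).prodMk measurable_snd)
  · filter_upwards [integrable_foldK_update t hf' hfi l ⟨0, hn⟩] with x hx ω using hx _
  · rw [← ENNReal.ofReal_toReal hC, ENNReal.toReal_ofReal ENNReal.toReal_nonneg]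
    exact ENNReal.ofReal_le_ofReal (by linarith)

end Treil
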